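/- Let K be a field of characteristic zero and Γ a subgroup of K^* of finite rank, and let n be a positive integer. Then there exists a constant C > 0, depending only on n and the rank of Γ, such that for every finite subset A of Γ of cardinality A = #A and all a_1, …, a_n ∈ K^*, the number of solutions (x_1, …, x_n) ∈ A^n of the equation a_1 x_1 + … + a_n x_n = 0 is at most C·A^{⌊n/2⌋}. -/

import Mathlib

/-- A subgroup `Γ` of a (commutative) group has finite rank `ρ` if there is a finitely
generated subgroup `Γ₀ ≤ Γ`, generated by `ρ` elements, such that every `x ∈ Γ` has a
positive power lying in `Γ₀`. -/
def FinRank {G : Type*} [CommGroup G] (Γ : Subgroup G) (ρ : ℕ) : Prop :=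
  ∃ S : Finset G, S.card = ρ ∧ (S : Set G) ⊆ (Γ : Set G) ∧
    ∀ x ∈ Γ, ∃ k : ℕ, 0 < k ∧ x ^ k ∈ Subgroup.closure (S : Set G)

universe u

section Auxiliary

set_option linter.unusedSectionVars false

open Finset

/-- A finite family of absolute values on a field, together with a subring whose nonzero elements
satisfy the inequality half of the product formula. -/
structure PlaceSystem (L : Type*) [Field L] (ι : Type*) [Fintype ι] where
  v : ι → AbsoluteValue L ℝ
  arch : Finset ι
  arch_nonempty : arch.Nonempty
  nonarch : ∀ i, i ∉ arch → ∀ x y, v i (x + y) ≤ max (v i x) (v i y)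
  map_natCast : ∀ i ∈ arch, ∀ m : ℕ, v i (m : L) = m
  R : Subring L
  one_le_prod : ∀ r ∈ R, r ≠ 0 → 1 ≤ ∏ i, v i r

/-- The `ℓ¹` norm of a finite real vector. -/
def lnorm {ι : Type*} [Fintype ι] (f : ι → ℝ) : ℝ := ∑ i, |f i|

section lnorm
variable {ι : Type*} [Fintype ι]

lemma lnorm_nonneg (f : ι → ℝ) : 0 ≤ lnorm f := sum_nonneg fun _ _ => abs_nonneg _

lemma lnorm_add_le (f g : ι → ℝ) : lnorm (f + g) ≤ lnorm f + lnorm g := by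
  unfold lnorm
  rw [← sum_add_distrib]
  exact sum_le_sum fun i _ => abs_add_le _ _

lemma lnorm_neg (f : ι → ℝ) : lnorm (-f) = lnorm f := by simp [lnorm]

lemma lnorm_sub_le (f g : ι → ℝ) : lnorm (f - g) ≤ lnorm f + lnorm g := by
  rw [sub_eq_add_neg, ← lnorm_neg g]
  exact lnorm_add_le _ _

lemma lnorm_sub_comm (f g : ι → ℝ) : lnorm (f - g) = lnorm (g - f) := by
  rw [← lnorm_neg, neg_sub]

lemma lnorm_sub_le_sub_add_sub (f g h : ι → ℝ) :
    lnorm (f - h) ≤ lnorm (f - g) + lnorm (g - h) := by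
  simpa using lnorm_add_le (f - g) (g - h)

@[simp] lemma lnorm_zero : lnorm (0 : ι → ℝ) = 0 := by simp [lnorm]

/-- If a vector has nonnegative sum of coordinates and is bounded above by `g`, then its norm is
controlled by the positive part of `g`. -/
lemma lnorm_le_two_mul_of_le {f g : ι → ℝ} (hf : 0 ≤ ∑ i, f i) (hfg : ∀ i, f i ≤ g i)
    (hg : ∀ i, 0 ≤ g i) : lnorm f ≤ 2 * ∑ i, g i := by
  have : ∀ i, |f i| ≤ 2 * g i - f i := fun i => by
    rw [abs_le]; constructor <;> linarith [hfg i, hg i]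
  calc lnorm f ≤ ∑ i, (2 * g i - f i) := sum_le_sum fun i _ => this i
    _ = 2 * ∑ i, g i - ∑ i, f i := by rw [sum_sub_distrib, mul_sum]
    _ ≤ _ := by linarith

end lnorm

namespace PlaceSystem
variable {L : Type*} [Field L] {ι : Type*} [Fintype ι] (P : PlaceSystem L ι)

open scoped Classical in
/-- The archimedean weight of a place. -/
noncomputable def wt (i : ι) : ℝ := if i ∈ P.arch then 1 else 0

/-- The number of archimedean places. -/
noncomputable def D : ℝ := P.arch.card

/-- The vector of logarithmic absolute values. -/
noncomputable def lv (x : L) (i : ι) : ℝ := Real.log (P.v i x)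

/-- Nonzero elements of the subring whose inverse lies in the subring. -/
def IsU (x : L) : Prop := x ≠ 0 ∧ x ∈ P.R ∧ x⁻¹ ∈ P.R

lemma one_le_D : 1 ≤ P.D := by
  unfold D; exact_mod_cast P.arch_nonempty.card_pos

lemma D_pos : 0 < P.D := zero_lt_one.trans_le P.one_le_D

lemma wt_nonneg (i : ι) : 0 ≤ P.wt i := by unfold wt; split_ifs <;> simp

lemma sum_wt : ∑ i, P.wt i = P.D := by simp [wt, D]

lemma sum_wt_mul (c : ℝ) : ∑ i, P.wt i * c = P.D * c := by rw [← sum_mul, sum_wt]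

lemma v_pos {x : L} (hx : x ≠ 0) (i : ι) : 0 < P.v i x := (P.v i).pos hx

lemma exp_lv {x : L} (hx : x ≠ 0) (i : ι) : Real.exp (P.lv x i) = P.v i x :=
  Real.exp_log (P.v_pos hx i)

lemma lv_mul {x y : L} (hx : x ≠ 0) (hy : y ≠ 0) : P.lv (x * y) = P.lv x + P.lv y := by
  ext i
  simp only [lv, map_mul, Pi.add_apply]
  exact Real.log_mul (P.v_pos hx i).ne' (P.v_pos hy i).ne'

@[simp] lemma lv_one : P.lv 1 = 0 := by ext i; simp [lv]

@[simp] lemma lv_inv (x : L) : P.lv x⁻¹ = - P.lv x := by ext i; simp [lv]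

@[simp] lemma lv_neg (x : L) : P.lv (-x) = P.lv x := by ext i; simp [lv]

lemma lv_div {x y : L} (hx : x ≠ 0) (hy : y ≠ 0) : P.lv (x / y) = P.lv x - P.lv y := by
  rw [div_eq_mul_inv, P.lv_mul hx (inv_ne_zero hy), lv_inv, sub_eq_add_neg]

lemma lv_pow (x : L) (m : ℕ) : P.lv (x ^ m) = (m : ℝ) • P.lv x := by
  ext i; simp [lv]

lemma lv_prod {κ : Type*} (s : Finset κ) (f : κ → L) (hf : ∀ k ∈ s, f k ≠ 0) :
    P.lv (∏ k ∈ s, f k) = ∑ k ∈ s, P.lv (f k) := by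
  classical
  induction s using Finset.induction_on with
  | empty => simp
  | insert a s ha ih =>
    rw [prod_insert ha, sum_insert ha, lv_mul, ih fun k hk => hf k (mem_insert_of_mem hk)]
    · exact hf a (mem_insert_self _ _)
    · exact prod_ne_zero_iff.2 fun k hk => hf k (mem_insert_of_mem hk)

lemma sum_lv_nonneg {r : L} (hr : r ∈ P.R) (h0 : r ≠ 0) : 0 ≤ ∑ i, P.lv r i := by
  unfold lv
  rw [← Real.log_prod fun i _ => (P.v_pos h0 i).ne']
  exact Real.log_nonneg (P.one_le_prod r hr h0)

lemma sum_lv_eq_zero {r : L} (h : P.IsU r) : ∑ i, P.lv r i = 0 := by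
  have h1 := P.sum_lv_nonneg h.2.1 h.1
  have h2 := P.sum_lv_nonneg h.2.2 (inv_ne_zero h.1)
  simp only [lv_inv, Pi.neg_apply, sum_neg_distrib] at h2
  linarith

lemma IsU.mul {x y : L} (hx : P.IsU x) (hy : P.IsU y) : P.IsU (x * y) :=
  ⟨mul_ne_zero hx.1 hy.1, mul_mem hx.2.1 hy.2.1, by
    rw [mul_inv]; exact mul_mem hx.2.2 hy.2.2⟩

lemma IsU.inv {x : L} (hx : P.IsU x) : P.IsU x⁻¹ :=
  ⟨inv_ne_zero hx.1, hx.2.2, by rw [inv_inv]; exact hx.2.1⟩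

lemma IsU.div {x y : L} (hx : P.IsU x) (hy : P.IsU y) : P.IsU (x / y) := by
  rw [div_eq_mul_inv]; exact hx.mul P hy.inv

lemma IsU.neg {x : L} (hx : P.IsU x) : P.IsU (-x) :=
  ⟨neg_ne_zero.2 hx.1, neg_mem hx.2.1, by rw [inv_neg]; exact neg_mem hx.2.2⟩

lemma IsU.one : P.IsU 1 := ⟨one_ne_zero, one_mem _, by rw [inv_one]; exact one_mem _⟩

lemma IsU.prod {κ : Type*} (s : Finset κ) (f : κ → L) (hf : ∀ k ∈ s, P.IsU (f k)) :
    P.IsU (∏ k ∈ s, f k) := by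
  classical
  induction s using Finset.induction_on with
  | empty => simpa using IsU.one P
  | insert a s ha ih =>
    rw [prod_insert ha]
    exact (hf a (mem_insert_self _ _)).mul P (ih fun k hk => hf k (mem_insert_of_mem hk))

lemma v_sum_le {κ : Type*} (s : Finset κ) (f : κ → L) (i : ι) {B : ℝ} (hB : 0 ≤ B)
    (hf : ∀ k ∈ s, P.v i (f k) ≤ B) :
    P.v i (∑ k ∈ s, f k) ≤ (s.card : ℝ) * B ∧ (i ∉ P.arch → P.v i (∑ k ∈ s, f k) ≤ B) := by
  classical
  induction s using Finset.induction_on with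
  | empty => simp [hB]
  | insert a s ha ih =>
    obtain ⟨h1, h2⟩ := ih fun k hk => hf k (mem_insert_of_mem hk)
    have h3 := hf a (mem_insert_self _ _)
    rw [sum_insert ha, card_insert_of_notMem ha]
    refine ⟨((P.v i).add_le _ _).trans ?_, fun hi => (P.nonarch i hi _ _).trans (max_le h3 (h2 hi))⟩
    push_cast; linarith

/-- Logarithmic triangle inequality. -/
lemma lv_sum_le {κ : Type*} (s : Finset κ) (f : κ → L) (i : ι) (g : ℝ)
    (hf : ∀ k ∈ s, f k ≠ 0 → P.lv (f k) i ≤ g) (h0 : ∑ k ∈ s, f k ≠ 0) :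
    P.lv (∑ k ∈ s, f k) i ≤ g + P.wt i * Real.log s.card := by
  have hs : 0 < s.card := card_pos.2 (nonempty_of_sum_ne_zero h0)
  have hB : ∀ k ∈ s, P.v i (f k) ≤ Real.exp g := fun k hk => by
    by_cases h : f k = 0
    · rw [h, map_zero]; positivity
    · rw [← P.exp_lv h]; exact Real.exp_le_exp.2 (hf k hk h)
  obtain ⟨h1, h2⟩ := P.v_sum_le s f i (Real.exp_pos g).le hB
  unfold lv wt
  split_ifs with hi
  · rw [one_mul, add_comm, ← Real.log_exp g, ← Real.log_mul (by positivity) (by positivity)]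
    exact Real.log_le_log (P.v_pos h0 i) h1
  · rw [zero_mul, add_zero]
    exact (Real.log_le_iff_le_exp (P.v_pos h0 i)).2 (h2 hi)

lemma v_natCast_le_one {i : ι} (hi : i ∉ P.arch) (m : ℕ) : P.v i (m : L) ≤ 1 := by
  have := (P.v_sum_le (range m) (fun _ => (1 : L)) i zero_le_one (by simp)).2 hi
  simpa using this

/-- The distance between two tuples, measured through logarithmic absolute values. -/
noncomputable def tdist {E : Type*} [Fintype E] (x y : E → L) : ℝ :=
  ∑ k, lnorm (P.lv (x k) - P.lv (y k))

section tdist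
variable {E : Type*} [Fintype E]

lemma tdist_nonneg (x y : E → L) : 0 ≤ P.tdist x y := sum_nonneg fun _ _ => lnorm_nonneg _

lemma tdist_comm (x y : E → L) : P.tdist x y = P.tdist y x := by
  unfold tdist; simp_rw [lnorm_sub_comm]

lemma tdist_triangle (x y z : E → L) : P.tdist x z ≤ P.tdist x y + P.tdist y z := by
  unfold tdist; rw [← sum_add_distrib]
  exact sum_le_sum fun k _ => lnorm_sub_le_sub_add_sub _ _ _

lemma lnorm_le_tdist (x y : E → L) (k : E) : lnorm (P.lv (x k) - P.lv (y k)) ≤ P.tdist x y :=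
  single_le_sum (f := fun k => lnorm (P.lv (x k) - P.lv (y k)))
    (fun _ _ => lnorm_nonneg _) (mem_univ k)

end tdist

end PlaceSystem

/-- `u` is the value of a unit with a positive power in the group generated by `S`. -/
def PowMem {L : Type*} [Field L] (S : Finset Lˣ) (b : L) : Prop :=
  ∃ u : Lˣ, (u : L) = b ∧ ∃ k : ℕ, 0 < k ∧ u ^ k ∈ Subgroup.closure (S : Set Lˣ)

lemma exists_half_cover (V : Type*) [NormedAddCommGroup V] [NormedSpace ℝ V]
    [FiniteDimensional ℝ V] {X : Type*} [DecidableEq X] (A : Finset X) (f : X → V) (c : V) (r : ℝ)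
    (hr : 0 < r) (hA : ∀ x ∈ A, ‖f x - c‖ ≤ r) :
    ∃ t ⊆ A, t.card ≤ 5 ^ Module.finrank ℝ V ∧ ∀ x ∈ A, ∃ y ∈ t, ‖f x - f y‖ ≤ r / 2 := by
  classical
  let T : Finset (Finset X) := A.powerset.filter
    fun t => ∀ x ∈ t, ∀ y ∈ t, x ≠ y → r / 2 < ‖f x - f y‖
  have hT : T.Nonempty := ⟨∅, by simp [T]⟩
  obtain ⟨t, htT, hmax⟩ := T.exists_max_image card hT
  have htT' := htT
  simp only [T, mem_filter, mem_powerset] at htT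
  obtain ⟨htA, hsep⟩ := htT
  refine ⟨t, htA, ?_, ?_⟩
  · let g : X → V := fun x => (2 / r) • (f x - c)
    have hg : ∀ x y, g x - g y = (2 / r) • (f x - f y) := fun x y => by
      simp only [g, ← smul_sub]; congr 1; abel
    have hn : ∀ w : V, ‖(2 / r) • w‖ = 2 / r * ‖w‖ := fun w => by
      rw [norm_smul, Real.norm_of_nonneg (by positivity)]
    have hinj : Set.InjOn g t := fun x hx y hy hxy => by
      by_contra hne
      have h1 := hsep x hx y hy hne
      have h2 : ‖g x - g y‖ = 0 := by rw [hxy, sub_self, norm_zero]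
      rw [hg, hn] at h2
      have : 0 < 2 / r * ‖f x - f y‖ := by
        have := half_pos hr
        have : 0 < ‖f x - f y‖ := by linarith
        positivity
      linarith
    rw [← card_image_of_injOn hinj]
    apply Besicovitch.card_le_of_separated
    · intro w hw
      obtain ⟨x, hx, rfl⟩ := mem_image.1 hw
      rw [hn]
      calc 2 / r * ‖f x - c‖ ≤ 2 / r * r := by gcongr; exact hA x (htA hx)
        _ = 2 := by field_simp
    · intro w hw w' hw' hne
      obtain ⟨x, hx, rfl⟩ := mem_image.1 hw
      obtain ⟨y, hy, rfl⟩ := mem_image.1 hw'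
      have := hsep x hx y hy (fun h => hne (by rw [h]))
      rw [hg, hn]
      calc 1 = 2 / r * (r / 2) := by field_simp
        _ ≤ _ := by gcongr
  · intro x hx
    by_contra! hcon
    have hxt : x ∉ t := fun h => by
      have := hcon x h
      rw [sub_self, norm_zero] at this
      linarith
    have : insert x t ∈ T := by
      simp only [T, mem_filter, mem_powerset]
      refine ⟨insert_subset hx htA, ?_⟩
      intro a ha b hb hab
      rw [mem_insert] at ha hb
      rcases ha with rfl | ha <;> rcases hb with rfl | hb
      · exact absurd rfl hab
      · exact hcon b hb
      · rw [norm_sub_rev]; exact hcon a ha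
      · exact hsep a ha b hb hab
    have := hmax _ this
    rw [card_insert_of_notMem hxt] at this
    omega

lemma exists_pow_half_cover (V : Type*) [NormedAddCommGroup V] [NormedSpace ℝ V]
    [FiniteDimensional ℝ V] {X : Type*} [DecidableEq X] (f : X → V) (r : ℝ) (hr : 0 < r) (k : ℕ)
    (A : Finset X) (c : V) (hA : ∀ x ∈ A, ‖f x - c‖ ≤ r) :
    ∃ t ⊆ A, t.card ≤ (5 ^ Module.finrank ℝ V) ^ (k + 1) ∧
      ∀ x ∈ A, ∃ y ∈ t, ‖f x - f y‖ ≤ r / 2 ^ (k + 1) := by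
  classical
  induction k with
  | zero => simpa using exists_half_cover V A f c r hr hA
  | succ k ih =>
    obtain ⟨t, htA, hcard, ht⟩ := ih
    have : ∀ y, ∃ t' ⊆ A.filter (fun x => ‖f x - f y‖ ≤ r / 2 ^ (k + 1)),
        t'.card ≤ 5 ^ Module.finrank ℝ V ∧
        ∀ x ∈ A.filter (fun x => ‖f x - f y‖ ≤ r / 2 ^ (k + 1)),
          ∃ z ∈ t', ‖f x - f z‖ ≤ r / 2 ^ (k + 1) / 2 := fun y =>
      exists_half_cover V _ f (f y) _ (by positivity) fun x hx => (mem_filter.1 hx).2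
    choose t' h1 h2 h3 using this
    refine ⟨t.biUnion t', ?_, ?_, ?_⟩
    · intro z hz
      obtain ⟨y, _, hz⟩ := mem_biUnion.1 hz
      exact (mem_filter.1 (h1 y hz)).1
    · rw [pow_succ]
      calc _ ≤ t.card * 5 ^ Module.finrank ℝ V := card_biUnion_le_card_mul _ _ _ fun y _ => h2 y
        _ ≤ _ := Nat.mul_le_mul_right _ hcard
    · intro x hx
      obtain ⟨y, hy, hxy⟩ := ht x hx
      obtain ⟨z, hz, hxz⟩ := h3 y x (mem_filter.2 ⟨hx, hxy⟩)
      refine ⟨z, mem_biUnion.2 ⟨y, hy, hz⟩, hxz.trans_eq ?_⟩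
      rw [pow_succ 2 (k + 1)]; field_simp

/-- Covering bound for finite sets in normed spaces of bounded dimension. -/
lemma exists_cover (m : ℕ) (q : ℝ) (hq : 0 < q) : ∃ C : ℕ, ∀ (V : Type*) [NormedAddCommGroup V]
    [NormedSpace ℝ V] [FiniteDimensional ℝ V] (_ : Module.finrank ℝ V ≤ m)
    (X : Type*) (f : X → V) (r : ℝ) (_ : 0 < r)
    (A : Finset X) (c : V) (_ : ∀ x ∈ A, ‖f x - c‖ ≤ r),
    ∃ t ⊆ A, t.card ≤ C ∧ ∀ x ∈ A, ∃ y ∈ t, ‖f x - f y‖ ≤ q * r := by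
  classical
  obtain ⟨k, hk⟩ := exists_pow_lt_of_lt_one hq (by norm_num : (1 / 2 : ℝ) < 1)
  refine ⟨(5 ^ m) ^ (k + 1), fun V _ _ _ hV X f r hr A c hA => ?_⟩
  obtain ⟨t, h1, h2, h3⟩ := exists_pow_half_cover V f r hr k A c hA
  refine ⟨t, h1, h2.trans ?_, fun x hx => ?_⟩
  · gcongr; norm_num
  · obtain ⟨y, hy, h⟩ := h3 x hx
    refine ⟨y, hy, h.trans ?_⟩
    have : (1 / 2 : ℝ) ^ (k + 1) ≤ q := by
      rw [pow_succ]; nlinarith [pow_pos (by norm_num : (0 : ℝ) < 1 / 2) k]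
    calc r / 2 ^ (k + 1) = (1 / 2 : ℝ) ^ (k + 1) * r := by rw [one_div, inv_pow]; field_simp
      _ ≤ _ := by gcongr

namespace PlaceSystem

variable {L : Type*} [Field L] {ι : Type*} [Fintype ι] (P : PlaceSystem L ι)

/-- The real span of the logarithmic vectors of a finite set of units. -/
noncomputable def lspan (S : Finset Lˣ) : Submodule ℝ (ι → ℝ) :=
  Submodule.span ℝ ((fun u : Lˣ => P.lv (u : L)) '' (S : Set Lˣ))

lemma lv_mem_lspan {S : Finset Lˣ} {b : L} (hb : PowMem S b) : P.lv b ∈ P.lspan S := by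
  obtain ⟨u, rfl, k, hk, hu⟩ := hb
  have key : ∀ w ∈ Subgroup.closure (S : Set Lˣ), P.lv (w : L) ∈ P.lspan S := by
    intro w hw
    induction hw using Subgroup.closure_induction with
    | mem x hx => exact Submodule.subset_span ⟨x, hx, rfl⟩
    | one => simp
    | mul x y _ _ hx hy =>
      rw [Units.val_mul, P.lv_mul x.ne_zero y.ne_zero]; exact add_mem hx hy
    | inv x _ hx => rw [Units.val_inv_eq_inv_val, lv_inv]; exact neg_mem hx
  have := key _ hu
  rw [Units.val_pow_eq_pow_val, lv_pow] at this
  have h2 := Submodule.smul_mem _ ((k : ℝ)⁻¹) this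
  rwa [smul_smul, inv_mul_cancel₀ (by positivity), one_smul] at h2

/-- The vector of all logarithms of a tuple, in the `ℓ¹` space. -/
noncomputable def tlog {E : Type*} (x : E → L) : PiLp 1 (fun _ : E × ι => ℝ) :=
  WithLp.toLp 1 fun p => P.lv (x p.1) p.2

lemma norm_tlog_sub {E : Type*} [Fintype E] (x y : E → L) :
    ‖P.tlog x - P.tlog y‖ = P.tdist x y := by
  rw [PiLp.norm_eq_of_L1, Fintype.sum_prod_type]
  simp [tdist, lnorm, tlog]

/-- The space of tuples of logarithmic vectors. -/
noncomputable def tspan (E : Type*) [Fintype E] (S : Finset Lˣ) :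
    Submodule ℝ (PiLp 1 (fun _ : E × ι => ℝ)) :=
  Submodule.span ℝ (Set.range fun p : E × S =>
    haveI := Classical.decEq E
    (WithLp.toLp 1 fun q : E × ι => if q.1 = p.1 then P.lv (p.2 : Lˣ) q.2 else 0))

lemma finrank_tspan_le (E : Type*) [Fintype E] (S : Finset Lˣ) :
    Module.finrank ℝ (P.tspan E S) ≤ Fintype.card E * S.card := by
  unfold tspan
  refine (finrank_range_le_card _).trans ?_
  simp

lemma tlog_mem_tspan {E : Type*} [Fintype E] {S : Finset Lˣ} {x : E → L}
    (hx : ∀ k, PowMem S (x k)) : P.tlog x ∈ P.tspan E S := by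
  classical
  have h1 : ∀ k, ∃ c : S → ℝ, ∑ s, c s • P.lv ((s : Lˣ) : L) = P.lv (x k) := by
    intro k
    have := P.lv_mem_lspan (hx k)
    unfold lspan at this
    rw [Set.image_eq_range] at this
    exact (Submodule.mem_span_range_iff_exists_fun ℝ).1 this
  choose c hc using h1
  unfold tspan
  rw [Submodule.mem_span_range_iff_exists_fun]
  refine ⟨fun p => c p.1 p.2, ?_⟩
  ext ⟨k, i⟩
  rw [Fintype.sum_prod_type]
  have := congrFun (hc k) i
  simp only [Finset.sum_apply, Pi.smul_apply, smul_eq_mul] at this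
  simp [tlog, ← this, Finset.sum_apply]

/-- Tuples from a group of bounded rank lying in a ball can be covered by a bounded number of
balls of proportionally smaller radius. -/
lemma exists_tuple_cover (n ρ : ℕ) (q : ℝ) (hq : 0 < q) : ∃ C : ℕ, ∀ (L : Type*) [Field L]
    (ι : Type*) [Fintype ι] (P : PlaceSystem L ι) (S : Finset Lˣ) (_ : S.card ≤ ρ)
    (E : Type*) [Fintype E] (_ : Fintype.card E ≤ n) (A : Finset (E → L))
    (_ : ∀ x ∈ A, ∀ k, PowMem S (x k)) (r : ℝ) (_ : 0 < r)
    (_ : ∀ x ∈ A, ∀ y ∈ A, P.tdist x y ≤ r),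
    ∃ t ⊆ A, t.card ≤ C ∧ ∀ x ∈ A, ∃ y ∈ t, P.tdist x y ≤ q * r := by
  classical
  obtain ⟨C, hC⟩ := exists_cover (n * ρ) q hq
  refine ⟨C, fun L _ ι _ P S hS E _ hE A hA r hr hAr => ?_⟩
  rcases A.eq_empty_or_nonempty with rfl | ⟨x0, hx0⟩
  · exact ⟨∅, by simp, by simp, by simp⟩
  let f : (E → L) → P.tspan E S := fun x =>
    if h : ∀ k, PowMem S (x k) then ⟨P.tlog x, P.tlog_mem_tspan h⟩ else 0
  have hf : ∀ x ∈ A, ∀ y ∈ A, ‖f x - f y‖ = P.tdist x y := by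
    intro x hx y hy
    simp only [f, dif_pos (hA x hx), dif_pos (hA y hy)]
    rw [← P.norm_tlog_sub]; rfl
  obtain ⟨t, h1, h2, h3⟩ := hC (P.tspan E S)
    ((P.finrank_tspan_le E S).trans (Nat.mul_le_mul hE hS)) _ f r hr A (f x0)
    (fun x hx => by rw [hf x hx x0 hx0]; exact hAr x hx x0 hx0)
  refine ⟨t, h1, h2, fun x hx => ?_⟩
  obtain ⟨y, hy, hxy⟩ := h3 x hx
  exact ⟨y, hy, by rwa [hf x hx y (h1 hy)] at hxy⟩

end PlaceSystem

/-- A sum of `p`-th powers differs from the `p`-th power of the sum by a multiple of `p`. -/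
lemma exists_sum_pow_prime_eq {O : Type*} [CommRing O] {p : ℕ} (hp : p.Prime) {κ : Type*}
    (s : Finset κ) (f : κ → O) : ∃ r, ∑ k ∈ s, f k ^ p = (∑ k ∈ s, f k) ^ p + p * r := by
  classical
  induction s using Finset.induction_on with
  | empty => exact ⟨0, by simp [hp.ne_zero]⟩
  | insert a s ha ih =>
    obtain ⟨r, hr⟩ := ih
    obtain ⟨r', hr'⟩ := exists_add_pow_prime_eq hp (f a) (∑ k ∈ s, f k)
    refine ⟨r - f a * (∑ k ∈ s, f k) * r', ?_⟩
    rw [sum_insert ha, sum_insert ha, hr, hr']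
    ring

lemma exists_mem_sum_pow_prime_eq {L : Type*} [Field L] (O : Subring L) {p : ℕ} (hp : p.Prime)
    {κ : Type*} (s : Finset κ) (f : κ → L) (hf : ∀ k, f k ∈ O) (h0 : ∑ k ∈ s, f k = 0) :
    ∃ r ∈ O, ∑ k ∈ s, f k ^ p = p * r := by
  obtain ⟨r, hr⟩ := exists_sum_pow_prime_eq hp s (fun k => (⟨f k, hf k⟩ : O))
  refine ⟨r, r.2, ?_⟩
  have := congrArg (Subtype.val : O → L) hr
  push_cast at this
  rwa [h0, zero_pow hp.ne_zero, zero_add] at this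

namespace PlaceSystem

variable {L : Type*} [Field L] {ι : Type*} [Fintype ι] (P : PlaceSystem L ι)

include P in
lemma natCast_ne_zero {m : ℕ} (hm : m ≠ 0) : (m : L) ≠ 0 := by
  obtain ⟨i, hi⟩ := P.arch_nonempty
  intro h
  have := P.map_natCast i hi m
  rw [h, map_zero] at this
  exact hm (by exact_mod_cast this.symm)

/-- The ring of elements of absolute value at most one at a nonarchimedean place. -/
def intRing (i : ι) (hi : i ∉ P.arch) : Subring L where
  carrier := {x | P.v i x ≤ 1}
  mul_mem' {a b} ha hb := by
    simp only [Set.mem_ofPred_eq, map_mul] at *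
    exact mul_le_one₀ ha ((P.v i).nonneg _) hb
  one_mem' := by simp
  add_mem' {a b} ha hb := (P.nonarch i hi a b).trans (max_le ha hb)
  zero_mem' := by simp
  neg_mem' {a} ha := by simpa using ha

lemma mem_intRing {i : ι} {hi : i ∉ P.arch} {x : L} : x ∈ P.intRing i hi ↔ P.v i x ≤ 1 := Iff.rfl

lemma sum_pow_prime_eq_zero {κ : Type*} [Fintype κ] (w : κ → L) (hw : ∀ k, w k ≠ 0)
    (hR : ∀ k, w k ∈ P.R) (g : ι → ℝ) (hg : ∀ k i, P.lv (w k) i ≤ g i) (δ : ℝ)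
    (hδ : ∑ i, g i ≤ δ * P.D) {p : ℕ} (hp : p.Prime)
    (hlog : p * δ + Real.log (Fintype.card κ) < Real.log p) (hsum : ∑ k, w k = 0) :
    ∑ k, w k ^ p = 0 := by
  rcases isEmpty_or_nonempty κ with _ | _
  · simp
  obtain ⟨r, hrR, hr⟩ := exists_mem_sum_pow_prime_eq P.R hp univ w hR hsum
  by_contra hne
  have hp0 : (p : L) ≠ 0 := P.natCast_ne_zero hp.ne_zero
  have hr0 : r ≠ 0 := by rintro rfl; simp [hr] at hne
  have key : ∀ i, P.lv r i ≤ p * g i + P.wt i * (Real.log (Fintype.card κ) - Real.log p) := by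
    intro i
    by_cases hi : i ∈ P.arch
    · have h1 := P.lv_sum_le univ (fun k => w k ^ p) i (p * g i) (fun k _ _ => by
        rw [lv_pow]; simp only [Pi.smul_apply, smul_eq_mul]; gcongr; exact hg k i) hne
      rw [hr, P.lv_mul hp0 hr0] at h1
      have h2 : P.lv (p : L) i = Real.log p := by unfold lv; rw [P.map_natCast i hi]
      have h3 : P.wt i = 1 := by simp [wt, hi]
      simp only [Pi.add_apply, h2, h3, card_univ] at h1 ⊢
      linarith
    · have h3 : P.wt i = 0 := by simp [wt, hi]
      obtain ⟨k0, -, hk0⟩ := univ.exists_max_image (fun k => P.v i (w k)) univ_nonempty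
      obtain ⟨r', hr'O, hr'⟩ := exists_mem_sum_pow_prime_eq (P.intRing i hi) hp univ
        (fun k => w k / w k0) (fun k => by
          rw [mem_intRing, map_div₀]
          exact div_le_one_of_le₀ (hk0 k (mem_univ _)) ((P.v i).nonneg _))
        (by rw [← sum_div, hsum, zero_div])
      have hrr : r = r' * w k0 ^ p := by
        have h4 : ∑ k, w k ^ p = p * (r' * w k0 ^ p) := by
          rw [← mul_assoc, ← hr', sum_mul]
          refine sum_congr rfl fun k _ => ?_
          rw [div_pow, div_mul_cancel₀ _ (pow_ne_zero _ (hw k0))]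
        exact mul_left_cancel₀ hp0 (hr.symm.trans h4)
      have hr'0 : r' ≠ 0 := by rintro rfl; simp [hrr] at hr0
      rw [hrr, P.lv_mul hr'0 (pow_ne_zero _ (hw k0)), lv_pow, h3]
      simp only [Pi.add_apply, Pi.smul_apply, smul_eq_mul, zero_mul, add_zero]
      have h5 : P.lv r' i ≤ 0 := Real.log_nonpos ((P.v i).nonneg _) hr'O
      have h6 : (p : ℝ) * P.lv (w k0) i ≤ p * g i := by gcongr; exact hg k0 i
      linarith
  have h1 := P.sum_lv_nonneg hrR hr0
  have h2 : ∑ i, P.lv r i ≤ p * (δ * P.D) + P.D * (Real.log (Fintype.card κ) - Real.log p) := by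
    refine (sum_le_sum fun i _ => key i).trans ?_
    rw [sum_add_distrib, ← mul_sum, sum_wt_mul]
    gcongr
  nlinarith [P.D_pos]

lemma sum_pow_eq_zero {κ : Type*} [Fintype κ] (w : κ → L) (hw : ∀ k, w k ≠ 0)
    (hR : ∀ k, w k ∈ P.R) (g : ι → ℝ) (hg : ∀ k i, P.lv (w k) i ≤ g i) (δ : ℝ)
    (hδ : ∑ i, g i ≤ δ * P.D) (hδ0 : 0 ≤ δ) {N M : ℕ} (hN : 0 < N) (hκ : Fintype.card κ ≤ N)
    (hlog : M * δ + Real.log N < Real.log (N + 1 : ℕ)) (hsum : ∑ k, w k = 0) (m : ℕ)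
    (hm0 : m ≠ 0) (hm : m ≤ M) (hmp : ∀ p, p.Prime → p ∣ m → N < p) :
    ∑ k, w k ^ m = 0 := by
  rcases isEmpty_or_nonempty κ with _ | _
  · simp
  induction m using induction_on_primes with
  | zero => exact absurd rfl hm0
  | one => simpa using hsum
  | prime_mul p a hp ih =>
    have ha0 : a ≠ 0 := right_ne_zero_of_mul hm0
    have ha := ih ha0 ((Nat.le_mul_of_pos_left a hp.pos).trans hm)
      fun q hq hqa => hmp q hq (hqa.mul_left p)
    have := P.sum_pow_prime_eq_zero (fun k => w k ^ a) (fun k => pow_ne_zero _ (hw k))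
      (fun k => pow_mem (hR k) a) (fun i => a * g i)
      (fun k i => by
        rw [lv_pow]; simp only [Pi.smul_apply, smul_eq_mul]; gcongr; exact hg k i) (a * δ)
      (by rw [← mul_sum, mul_assoc]; gcongr) hp ?_ ha
    · rw [← this]
      exact sum_congr rfl fun k _ => by rw [← pow_mul, mul_comm p]
    · have h1 : (p : ℝ) * (a * δ) ≤ M * δ := by
        rw [← mul_assoc]; gcongr; exact_mod_cast hm
      have h2 : Real.log (Fintype.card κ) ≤ Real.log N :=
        Real.log_le_log (by exact_mod_cast Fintype.card_pos) (by exact_mod_cast hκ)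
      have h3 : Real.log (N + 1 : ℕ) ≤ Real.log p :=
        Real.log_le_log (by positivity) (by exact_mod_cast hmp p hp (dvd_mul_right _ _))
      linarith

/-- The closeness threshold for sums of `N` units. -/
noncomputable def delta (N : ℕ) : ℝ :=
  (Real.log (N + 1 : ℕ) - Real.log N) / (2 * (2 * (1 + N.factorial * N : ℕ)))

lemma delta_pos {N : ℕ} (hN : 0 < N) : 0 < delta N := by
  unfold delta
  have : Real.log N < Real.log (N + 1 : ℕ) :=
    Real.log_lt_log (by exact_mod_cast hN) (by exact_mod_cast N.lt_succ_self)
  have := sub_pos.2 this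
  positivity

open scoped Classical in
/-- A vanishing sum of units which are close to each other at all places splits according to the
values of a fixed power. -/
lemma sum_filter_pow_eq_zero {κ : Type*} [Fintype κ] (N : ℕ) (hN : 0 < N)
    (hκ : Fintype.card κ ≤ N) (w : κ → L) (hw : ∀ k, P.IsU (w k)) (e h : ι → ℝ)
    (hclose : ∀ k i, |P.lv (w k) i - e i| ≤ h i) (hh : ∑ i, h i ≤ delta N * P.D)
    (hsum : ∑ k, w k = 0) (Θ : Finset L) :
    ∑ k with w k ^ N.factorial ∈ Θ, w k = 0 := by
  rcases isEmpty_or_nonempty κ with _ | ⟨⟨k0⟩⟩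
  · simp
  set Q := N.factorial with hQ
  have hδ := delta_pos hN
  have hpow : ∀ l < N, ∑ k, w k * (w k ^ Q) ^ l = 0 := by
    intro l hl
    have := P.sum_pow_eq_zero (fun k => w k / w k0) (fun k => div_ne_zero (hw k).1 (hw k0).1)
      (fun k => ((hw k).div P (hw k0)).2.1) (fun i => 2 * h i)
      (fun k i => by
        rw [P.lv_div (hw k).1 (hw k0).1]
        have h1 := abs_le.1 (hclose k i)
        have h2 := abs_le.1 (hclose k0 i)
        simp only [Pi.sub_apply]; linarith) (2 * delta N)
      (by rw [← mul_sum]; linarith) (by positivity) hN hκ (M := 1 + Q * N) ?_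
      (by rw [← sum_div, hsum, zero_div]) (1 + Q * l) (by positivity) (by gcongr) ?_
    · have h2 := congrArg (· * w k0 ^ (1 + Q * l)) this
      simp only [zero_mul, sum_mul, div_pow] at h2
      rw [← h2]
      refine sum_congr rfl fun k _ => ?_
      rw [div_mul_cancel₀ _ (pow_ne_zero _ (hw k0).1)]
      ring
    · unfold delta
      have h3 : Real.log N < Real.log (N + 1 : ℕ) :=
        Real.log_lt_log (by exact_mod_cast hN) (by exact_mod_cast N.lt_succ_self)
      have h4 : (0 : ℝ) < (1 + Q * N : ℕ) := by positivity
      rw [← hQ]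
      have : ((1 + Q * N : ℕ) : ℝ) * (2 * ((Real.log (N + 1 : ℕ) - Real.log N) /
          (2 * (2 * (1 + Q * N : ℕ))))) = (Real.log (N + 1 : ℕ) - Real.log N) / 2 := by
        field_simp
      rw [this]
      linarith
    · intro p hp hpd
      by_contra! hle
      have h5 : p ∣ Q := (hp.dvd_factorial).2 hle
      exact hp.one_lt.ne' (Nat.dvd_one.1 ((Nat.dvd_add_left (h5.mul_right l)).1 hpd))
  have hpoly : ∀ f : Polynomial L, f.natDegree < N → ∑ k, w k * f.eval (w k ^ Q) = 0 := by
    intro f hf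
    simp_rw [Polynomial.eval_eq_sum_range, mul_sum]
    rw [sum_comm]
    refine sum_eq_zero fun l hl => ?_
    have := hpow l (by rw [mem_range] at hl; omega)
    calc _ = f.coeff l * ∑ k, w k * (w k ^ Q) ^ l := by
          rw [mul_sum]; exact sum_congr rfl fun k _ => by ring
      _ = 0 := by rw [this, mul_zero]
  let s : Finset L := univ.image fun k => w k ^ Q
  have hs : s.card ≤ N := card_image_le.trans (by simpa using hκ)
  have hinj : Set.InjOn (id : L → L) s := Set.injOn_id _
  have h6 := hpoly (Lagrange.interpolate s id fun θ => if θ ∈ Θ then 1 else 0) ?_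
  · rw [sum_filter]
    refine (sum_congr rfl fun k _ => ?_).trans h6
    have hk : w k ^ Q ∈ s := mem_image_of_mem _ (mem_univ k)
    have := Lagrange.eval_interpolate_at_node (fun θ => if θ ∈ Θ then (1 : L) else 0) hinj hk
    simp only [id] at this
    rw [this]
    split_ifs <;> simp
  · have := Lagrange.degree_interpolate_lt (fun θ => if θ ∈ Θ then (1 : L) else 0) hinj
    by_cases h0 : Lagrange.interpolate s id (fun θ => if θ ∈ Θ then (1 : L) else 0) = 0
    · rw [h0]; simpa using hN
    · rw [Polynomial.degree_eq_natDegree h0] at this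
      exact (by exact_mod_cast this : _ < s.card).trans_le hs

end PlaceSystem

section Frame

variable {L : Type*} [Field L] {E : Type*} [Fintype E] [DecidableEq E]

/-- A set of coordinates on a subspace of `E → L`, together with the dual basis. -/
structure IsFrame (W : Submodule L (E → L)) (J : Finset E) (u : E → E → L) : Prop where
  mem : ∀ k ∈ J, u k ∈ W
  apply_self : ∀ k ∈ J, u k k = 1
  apply_ne : ∀ k ∈ J, ∀ l ∈ J, k ≠ l → u k l = 0
  expand : ∀ w ∈ W, w = ∑ k ∈ J, w k • u k

lemma exists_isFrame (W : Submodule L (E → L)) (F : Finset E)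
    (hF : ∀ w ∈ W, (∀ k ∈ F, w k = 0) → w = 0) : ∃ J ⊆ F, ∃ u, IsFrame W J u := by
  classical
  obtain ⟨J, hJ⟩ := exists_minimal (s := F.powerset.filter
    fun J => ∀ w ∈ W, (∀ k ∈ J, w k = 0) → w = 0) ⟨F, by simpa using hF⟩
  have hJ' := hJ.1
  simp only [mem_filter, mem_powerset] at hJ'
  obtain ⟨hJF, hsep⟩ := hJ'
  have h1 : ∀ k ∈ J, ∃ w ∈ W, w k = 1 ∧ ∀ l ∈ J, k ≠ l → w l = 0 := by
    intro k hk
    have h2 : ¬ ∀ w ∈ W, (∀ l ∈ J.erase k, w l = 0) → w = 0 := by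
      intro h
      have := hJ.2 (y := J.erase k)
        (mem_filter.2 ⟨mem_powerset.2 ((erase_subset _ _).trans hJF), h⟩) (erase_subset _ _)
      exact notMem_erase k J (this hk)
    push Not at h2
    obtain ⟨w, hw, hw0, hne⟩ := h2
    have hwk : w k ≠ 0 := fun h => hne (hsep w hw fun l hl => by
      by_cases hlk : l = k
      · rw [hlk, h]
      · exact hw0 l (mem_erase.2 ⟨hlk, hl⟩))
    refine ⟨(w k)⁻¹ • w, W.smul_mem _ hw, by simp [hwk], fun l hl hkl => ?_⟩
    simp [hw0 l (mem_erase.2 ⟨hkl.symm, hl⟩)]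
  choose! u hu1 hu2 hu3 using h1
  refine ⟨J, hJF, u, hu1, hu2, hu3, fun w hw => ?_⟩
  rw [← sub_eq_zero]
  refine hsep _ (W.sub_mem hw (W.sum_mem fun k hk => W.smul_mem _ (hu1 k hk))) fun l hl => ?_
  simp only [Pi.sub_apply, Finset.sum_apply, Pi.smul_apply, smul_eq_mul]
  rw [sum_eq_single l, hu2 l hl, mul_one, sub_self]
  · intro k hk hkl
    rw [hu3 k hk l hl hkl, mul_zero]
  · exact fun h => absurd hl h

/-- A subspace is connected if it is not the direct sum of its coordinate projections along a
nontrivial partition of the coordinates. -/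
def Conn (W : Submodule L (E → L)) : Prop :=
  ∀ I : Finset E, I.Nonempty → I ≠ univ → ∃ w ∈ W, (fun k => if k ∈ I then w k else 0) ∉ W

namespace IsFrame

variable {W : Submodule L (E → L)} {J : Finset E} {u : E → E → L} (h : IsFrame W J u)
include h

lemma apply_eq {w : E → L} (hw : w ∈ W) (j : E) : w j = ∑ k ∈ J, w k * u k j := by
  conv_lhs => rw [h.expand w hw]
  simp

lemma eq_zero {w : E → L} (hw : w ∈ W) (h0 : ∀ k ∈ J, w k = 0) : w = 0 := by
  rw [h.expand w hw]
  exact sum_eq_zero fun k hk => by rw [h0 k hk, zero_smul]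

lemma linearIndependent : LinearIndependent L (fun k : J => u k) := by
  rw [Fintype.linearIndependent_iff]
  intro g hg l
  have := congrFun hg l
  simp only [Finset.sum_apply, Pi.smul_apply, smul_eq_mul, Pi.zero_apply] at this
  rwa [sum_eq_single l, h.apply_self l l.2, mul_one] at this
  · intro k _ hkl
    rw [h.apply_ne k k.2 l l.2 (fun e => hkl (Subtype.ext e)), mul_zero]
  · simp

lemma span_eq : Submodule.span L (Set.range fun k : J => u k) = W := by
  apply le_antisymm
  · rw [Submodule.span_le]
    rintro _ ⟨k, rfl⟩
    exact h.mem k k.2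
  · intro w hw
    rw [h.expand w hw, ← sum_coe_sort]
    exact Submodule.sum_mem _ fun k _ =>
      Submodule.smul_mem _ _ (Submodule.subset_span ⟨k, rfl⟩)

lemma card_eq : J.card = Module.finrank L W := by
  have := finrank_span_eq_card h.linearIndependent
  rw [h.span_eq] at this
  rw [this, Fintype.card_coe]

lemma exists_crossing (hW : Conn W) (I : Finset E) (hI : I.Nonempty) (hI' : I ≠ univ) :
    ∃ k ∈ J, ∃ j ∉ J, u k j ≠ 0 ∧ (k ∈ I ↔ j ∉ I) := by
  by_contra! hcon
  obtain ⟨w, hw, hwI⟩ := hW I hI hI'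
  refine hwI ?_
  have : (fun j => if j ∈ I then w j else 0) = ∑ k ∈ J with k ∈ I, w k • u k := by
    ext j
    rw [h.apply_eq hw j]
    simp only [Finset.sum_apply, Pi.smul_apply, smul_eq_mul, sum_filter]
    split_ifs with hj
    · refine sum_congr rfl fun k hk => ?_
      split_ifs with hkI
      · rfl
      · by_cases hjJ : j ∈ J
        · rw [h.apply_ne k hk j hjJ (by rintro rfl; exact hkI hj), mul_zero]
        · by_cases h0 : u k j = 0
          · rw [h0, mul_zero]
          · have := hcon k hk j hjJ h0
            tauto
    · refine (sum_eq_zero fun k hk => ?_).symm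
      split_ifs with hkI
      · by_cases hjJ : j ∈ J
        · rw [h.apply_ne k hk j hjJ (by rintro rfl; exact hj hkI), mul_zero]
        · by_cases h0 : u k j = 0
          · rw [h0, mul_zero]
          · have := hcon k hk j hjJ h0
            tauto
      · rfl
  rw [this]
  exact W.sum_mem fun k hk => W.smul_mem _ (h.mem k (mem_filter.1 hk).1)

open scoped Classical in
lemma exists_two_ne_zero (hW : Conn W) (hd : 2 ≤ Module.finrank L W) :
    ∃ j ∉ J, ∃ k₁ ∈ J, ∃ k₂ ∈ J, k₁ ≠ k₂ ∧ u k₁ j ≠ 0 ∧ u k₂ j ≠ 0 := by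
  rw [← h.card_eq] at hd
  obtain ⟨k0, hk0, k1, hk1, hne⟩ := one_lt_card.1 hd
  obtain ⟨k, hk, j, hj, hkj, hI⟩ := h.exists_crossing hW
    (insert k0 (univ.filter fun j => j ∉ J ∧ u k0 j ≠ 0)) ⟨k0, mem_insert_self _ _⟩ (by
      intro heq
      have := heq ▸ mem_univ k1
      simp only [mem_insert, mem_filter] at this
      rcases this with h | h
      · exact hne h.symm
      · exact h.2.1 hk1)
  simp only [mem_insert, mem_filter, mem_univ, true_and] at hI
  have hjk0 : j ≠ k0 := by rintro rfl; exact hj hk0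
  by_cases hkk : k = k0
  · subst hkk
    have := hI.1 (Or.inl rfl)
    tauto
  · refine ⟨j, hj, k0, hk0, k, hk, Ne.symm hkk, ?_, hkj⟩
    tauto

open Matrix in
/-- The Cramer rule in a frame. -/
lemma det_updateCol_eq {s : J → E → L} (hs : ∀ a, s a ∈ W) (j : E) (k : J) :
    ((of fun a l : J => s a l).updateCol k (fun a => s a j)).det =
      u k j * (of fun a l : J => s a l).det := by
  have h1 : (fun a => s a j) = (of fun a l : J => s a l) *ᵥ (fun l : J => u l j) := by
    ext a
    rw [h.apply_eq (hs a) j, ← sum_coe_sort]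
    rfl
  rw [← cramer_apply, h1, cramer_eq_adjugate_mulVec, mulVec_mulVec, adjugate_mul, smul_mulVec,
    one_mulVec, Pi.smul_apply, smul_eq_mul, mul_comm]

open Matrix in
lemma det_ne_zero {s : J → E → L} (hs : ∀ a, s a ∈ W) (hind : LinearIndependent L s) :
    (of fun a l : J => s a l).det ≠ 0 := by
  rw [← isUnit_iff_ne_zero, ← isUnit_iff_isUnit_det, ← linearIndependent_rows_iff_isUnit]
  rw [Fintype.linearIndependent_iff] at hind ⊢
  intro g hg
  refine hind g (h.eq_zero (W.sum_mem fun a _ => W.smul_mem _ (hs a)) fun l hl => ?_)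
  have := congrFun hg ⟨l, hl⟩
  simpa [Matrix.row] using this

end IsFrame

lemma exists_isFrame_univ (W : Submodule L (E → L)) : ∃ J u, IsFrame W J u := by
  obtain ⟨J, -, u, h⟩ := exists_isFrame W univ fun w _ h => funext fun k => h k (mem_univ k)
  exact ⟨J, u, h⟩

/-- A spanning set of a subspace contains a basis indexed by the coordinates of a frame. -/
lemma IsFrame.exists_independent {W : Submodule L (E → L)} {J : Finset E} {u : E → E → L}
    (h : IsFrame W J u) (S : Set (E → L)) (hS : Submodule.span L S = W) :
    ∃ s : J → E → L, (∀ a, s a ∈ S) ∧ LinearIndependent L s := by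
  obtain ⟨b, hbS, hspan, hb⟩ := exists_linearIndependent L S
  have hfin : b.Finite := hb.setFinite
  have := hfin.fintype
  have hcard : Fintype.card J = Fintype.card b := by
    have h1 := finrank_span_eq_card hb
    rw [Subtype.range_coe, hspan, hS, ← h.card_eq] at h1
    rw [← h1, Fintype.card_coe]
  let e : J ≃ b := Fintype.equivOfCardEq hcard
  exact ⟨fun a => e a, fun a => hbS (e a).2, hb.comp e e.injective⟩

end Frame

/-- The hyperplane of tuples whose coordinates `j` and `k` satisfy `a * x j = b * x k`. -/
def ratioSubmodule {L : Type*} [Field L] {E : Type*} (a b : L) (j k : E) :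
    Submodule L (E → L) :=
  LinearMap.ker (a • LinearMap.proj (R := L) (φ := fun _ : E => L) j - b • LinearMap.proj k)

lemma mem_ratioSubmodule {L : Type*} [Field L] {E : Type*} {a b : L} {j k : E} {x : E → L} :
    x ∈ ratioSubmodule a b j k ↔ a * x j = b * x k := by
  simp [ratioSubmodule, sub_eq_zero]

namespace PlaceSystem

variable {L : Type*} [Field L] {ι : Type*} [Fintype ι] (P : PlaceSystem L ι)

lemma lv_units_smul (e : ℤˣ) (z : L) : P.lv (e • z) = P.lv z := by
  rcases Int.units_eq_one_or e with rfl | rfl <;> simp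

lemma IsU.units_smul (e : ℤˣ) {z : L} (hz : P.IsU z) : P.IsU (e • z) := by
  rcases Int.units_eq_one_or e with rfl | rfl
  · simpa using hz
  · simpa using hz.neg P

/-- A signed monomial in the determinant expansion. -/
def detTerm {E J : Type*} [Fintype J] [DecidableEq J] (s : J → E → L) (φ : J → E)
    (σ : Equiv.Perm J) : L := Equiv.Perm.sign σ • ∏ l, s (σ l) (φ l)

variable {E J : Type*} [Fintype E] [Fintype J] [DecidableEq J]

lemma det_eq_sum_detTerm (s : J → E → L) (φ : J → E) :
    (Matrix.of fun a l : J => s a (φ l)).det = ∑ σ, detTerm s φ σ := by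
  rw [Matrix.det_apply]; rfl

lemma isU_detTerm {s : J → E → L} (hs : ∀ a m, P.IsU (s a m)) (φ : J → E) (σ : Equiv.Perm J) :
    P.IsU (detTerm s φ σ) :=
  IsU.units_smul P _ (IsU.prod P _ _ fun _ _ => hs _ _)

lemma lv_detTerm {s : J → E → L} (hs : ∀ a m, s a m ≠ 0) (φ : J → E) (σ : Equiv.Perm J) :
    P.lv (detTerm s φ σ) = ∑ l, P.lv (s (σ l) (φ l)) := by
  unfold detTerm
  rw [lv_units_smul, P.lv_prod _ _ fun _ _ => hs _ _]

lemma abs_lv_detTerm_sub_le {s : J → E → L} (hs : ∀ a m, s a m ≠ 0) (φ : J → E)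
    (σ : Equiv.Perm J) (c : E → L) (i : ι) :
    |P.lv (detTerm s φ σ) i - ∑ l, P.lv (c (φ l)) i| ≤
      ∑ a, ∑ m, |P.lv (s a m) i - P.lv (c m) i| := by
  rw [P.lv_detTerm hs, Finset.sum_apply, ← sum_sub_distrib,
    ← Equiv.sum_comp σ (fun a => ∑ m, |P.lv (s a m) i - P.lv (c m) i|)]
  refine (abs_sum_le_sum_abs _ _).trans (sum_le_sum fun l _ => ?_)
  exact single_le_sum (f := fun m => |P.lv (s (σ l) m) i - P.lv (c m) i|)
    (fun _ _ => abs_nonneg _) (mem_univ _)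

lemma sum_sum_abs_lv_sub (x c : E → L) :
    ∑ i, ∑ m, |P.lv (x m) i - P.lv (c m) i| = P.tdist x c := by
  rw [sum_comm]; rfl

end PlaceSystem

open PlaceSystem in
open scoped Classical in
/-- Solutions in units of a connected linear system which are very close to each other lie in
boundedly many proper subspaces. -/
lemma exists_tiny_cell_cover (n : ℕ) : ∃ δ : ℝ, 0 < δ ∧ ∃ C : ℕ, ∀ (L : Type*) [Field L]
    (ι : Type*) [Fintype ι] (P : PlaceSystem L ι) (E : Type*) [Fintype E] [DecidableEq E]
    (_ : Fintype.card E ≤ n) (W : Submodule L (E → L)) (_ : Conn W)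
    (_ : 2 ≤ Module.finrank L W) (S : Set (E → L)) (_ : ∀ x ∈ S, x ∈ W)
    (_ : ∀ x ∈ S, ∀ k, P.IsU (x k)) (c : E → L) (_ : ∀ x ∈ S, P.tdist x c ≤ δ * P.D),
    ∃ T : Finset (Submodule L (E → L)), T.card ≤ C ∧ (∀ V ∈ T, V < W) ∧ ∀ x ∈ S, ∃ V ∈ T, x ∈ V := by
  set N := (n + 1) * n.factorial with hN
  have hN0 : 0 < N := by positivity
  refine ⟨delta N / (n + 1), div_pos (delta_pos hN0) (by positivity),
    1 + n * n.factorial * n.factorial * N.factorial, ?_⟩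
  intro L _ ι _ P E _ _ hE W hW hd S hSW hSU c hc
  by_cases hspan : Submodule.span L S = W
  swap
  · refine ⟨{Submodule.span L S}, by simp, ?_, fun x hx =>
      ⟨_, mem_singleton_self _, Submodule.subset_span hx⟩⟩
    intro V hV
    rw [mem_singleton.1 hV]
    exact lt_of_le_of_ne (Submodule.span_le.2 hSW) hspan
  obtain ⟨J, u, h⟩ := exists_isFrame_univ W
  obtain ⟨s, hsS, hind⟩ := h.exists_independent S hspan
  have hsW : ∀ a, s a ∈ W := fun a => hSW _ (hsS a)
  have hsU : ∀ a m, P.IsU (s a m) := fun a => hSU _ (hsS a)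
  have hs0 : ∀ a m, s a m ≠ 0 := fun a m => (hsU a m).1
  obtain ⟨j, hj, k₁, hk₁, k₂, hk₂, hne, hu₁, hu₂⟩ := h.exists_two_ne_zero hW hd
  have hJn : Fintype.card J ≤ n := by
    rw [Fintype.card_coe]; exact (card_le_univ J).trans hE
  let K := {k : J // u k j ≠ 0}
  have hKn : Fintype.card K ≤ n := (Fintype.card_subtype_le _).trans hJn
  let col : J → J → E := fun k l => if l = k then j else l
  let A : K → Equiv.Perm J → L := fun k σ => detTerm s (col k) σ
  let B : Equiv.Perm J → L := fun σ => detTerm s (fun l : J => (l : E)) σ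
  have hAU : ∀ k σ, P.IsU (A k σ) := fun k σ => P.isU_detTerm hsU _ _
  have hBU : ∀ σ, P.IsU (B σ) := fun σ => P.isU_detTerm hsU _ _
  set Y : Matrix J J L := Matrix.of fun a l : J => s a l with hY
  have hdet : Y.det ≠ 0 := h.det_ne_zero hsW hind
  have hB : ∑ σ, B σ = Y.det := (det_eq_sum_detTerm s _).symm
  have hA : ∀ k, ∑ σ, A k σ = u k j * Y.det := by
    intro k
    rw [← h.det_updateCol_eq hsW, ← det_eq_sum_detTerm s (col k)]
    congr 1
    ext a l
    simp only [Matrix.of_apply, Matrix.updateCol_apply, col]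
    split_ifs <;> rfl
  let T : Finset (Submodule L (E → L)) :=
    (univ : Finset (K × Equiv.Perm J × Equiv.Perm J)).biUnion fun p =>
      (Polynomial.nthRoots N.factorial ((-(A p.1 p.2.1) / B p.2.2) ^ N.factorial)).toFinset.image
        fun z => W ⊓ ratioSubmodule 1 z j p.1
  refine ⟨T, ?_, ?_, ?_⟩
  · have h1 : T.card ≤ (univ : Finset (K × Equiv.Perm J × Equiv.Perm J)).card * N.factorial :=
      card_biUnion_le_card_mul _ _ _ fun p _ => card_image_le.trans
        ((Multiset.toFinset_card_le _).trans (Polynomial.card_nthRoots _ _))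
    refine h1.trans ?_
    rw [card_univ, Fintype.card_prod, Fintype.card_prod, Fintype.card_perm, ← mul_assoc]
    have := Nat.factorial_le hJn
    calc _ ≤ n * n.factorial * n.factorial * N.factorial := by gcongr
      _ ≤ _ := by omega
  · intro V hV
    simp only [T, mem_biUnion, mem_image] at hV
    obtain ⟨p, -, z, -, rfl⟩ := hV
    refine lt_of_le_of_ne inf_le_left fun heq => ?_
    obtain ⟨k', hk', hk'p, huk'⟩ : ∃ k' ∈ J, k' ≠ p.1 ∧ u k' j ≠ 0 := by
      by_cases h1 : k₁ = p.1
      · exact ⟨k₂, hk₂, fun h2 => hne (h1.trans h2.symm), hu₂⟩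
      · exact ⟨k₁, hk₁, h1, hu₁⟩
    have h1 : u k' ∈ W ⊓ ratioSubmodule 1 z j p.1 := by rw [heq]; exact h.mem k' hk'
    have h2 := mem_ratioSubmodule.1 h1.2
    rw [h.apply_ne k' hk' _ p.1.1.2 hk'p, mul_zero, one_mul] at h2
    exact huk' h2
  · intro x hx
    have hxU := hSU x hx
    let w : Option K × Equiv.Perm J → L := fun p =>
      p.1.elim (B p.2 * x j) fun k => -(A k p.2 * x k)
    have hw0 : ∑ p, w p = 0 := by
      rw [Fintype.sum_prod_type, Fintype.sum_option]
      simp only [w, Option.elim]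
      simp_rw [sum_neg_distrib, ← sum_mul, hA, hB]
      rw [h.apply_eq (hSW x hx) j, ← sub_eq_add_neg, sub_eq_zero, mul_sum, ← sum_coe_sort]
      have h3 : ∀ k : J, Y.det * (x k * u k j) = u k j * Y.det * x k := fun k => by ring
      simp_rw [h3]
      rw [← sum_subtype (univ.filter fun k : J => u k j ≠ 0) (by simp)
        fun k : J => u k j * Y.det * x k]
      rw [sum_filter_of_ne]
      rintro k _ hk h0
      exact hk (by rw [h0, zero_mul, zero_mul])
    have hwU : ∀ p, P.IsU (w p) := by
      rintro ⟨_ | k, σ⟩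
      · exact (hBU σ).mul P (hxU j)
      · exact ((hAU k σ).mul P (hxU k)).neg P
    let e : ι → ℝ := fun i => P.lv (c j) i + ∑ l : J, P.lv (c l) i
    let g : ι → ℝ := fun i => (∑ a, ∑ m, |P.lv (s a m) i - P.lv (c m) i|) +
      ∑ m, |P.lv (x m) i - P.lv (c m) i|
    have hx1 : ∀ m i, |P.lv (x m) i - P.lv (c m) i| ≤ ∑ m, |P.lv (x m) i - P.lv (c m) i| :=
      fun m i => single_le_sum (f := fun m => |P.lv (x m) i - P.lv (c m) i|)
        (fun _ _ => abs_nonneg _) (mem_univ m)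
    have hclose : ∀ p i, |P.lv (w p) i - e i| ≤ g i := by
      have key : ∀ (φ : J → E) (σ : Equiv.Perm J) (m : E) (i : ι),
          ∑ l, P.lv (c (φ l)) i + P.lv (c m) i = e i →
          |P.lv (detTerm s φ σ * x m) i - e i| ≤ g i := by
        intro φ σ m i he
        rw [P.lv_mul (P.isU_detTerm hsU φ σ).1 (hxU m).1, Pi.add_apply, ← he]
        calc _ = |(P.lv (detTerm s φ σ) i - ∑ l, P.lv (c (φ l)) i) +
              (P.lv (x m) i - P.lv (c m) i)| := by congr 1; ring
          _ ≤ _ := (abs_add_le _ _).trans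
              (add_le_add (P.abs_lv_detTerm_sub_le hs0 φ σ c i) (hx1 m i))
      rintro ⟨_ | k, σ⟩ i
      · exact key _ σ j i (add_comm _ _)
      · simp only [w, Option.elim, lv_neg]
        refine key (col k) σ k i ?_
        simp only [e, col]
        rw [← add_sum_erase _ _ (mem_univ k.1), ← add_sum_erase (a := k.1) _ _ (mem_univ k.1),
          if_pos rfl, sum_congr rfl fun l hl => by rw [if_neg (ne_of_mem_erase hl)]]
        ring
    have hg : ∑ i, g i ≤ delta N * P.D := by
      simp only [g]
      rw [sum_add_distrib, P.sum_sum_abs_lv_sub, sum_comm]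
      simp_rw [P.sum_sum_abs_lv_sub]
      have h1 : ∑ a, P.tdist (s a) c ≤ (univ : Finset J).card • (delta N / (n + 1) * P.D) :=
        sum_le_card_nsmul _ _ _ fun a _ => hc _ (hsS a)
      have h2 := hc x hx
      rw [card_univ, nsmul_eq_mul] at h1
      have h3 : (Fintype.card J : ℝ) ≤ n := by exact_mod_cast hJn
      have h4 : 0 < delta N / (n + 1) * P.D :=
        mul_pos (div_pos (delta_pos hN0) (by positivity)) P.D_pos
      calc _ ≤ (Fintype.card J : ℝ) * (delta N / (n + 1) * P.D) + delta N / (n + 1) * P.D :=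
            add_le_add h1 h2
        _ ≤ n * (delta N / (n + 1) * P.D) + delta N / (n + 1) * P.D := by gcongr
        _ = delta N * P.D := by field_simp
    have hcard : Fintype.card (Option K × Equiv.Perm J) ≤ N := by
      rw [Fintype.card_prod, Fintype.card_option, Fintype.card_perm]
      exact Nat.mul_le_mul (by omega) (Nat.factorial_le hJn)
    have hsplit := P.sum_filter_pow_eq_zero N hN0 hcard w hwU e g hclose hg hw0
      (univ.image fun σ => w (none, σ) ^ N.factorial)
    obtain ⟨k, σ, τ, hpow⟩ : ∃ k σ τ, w (some k, σ) ^ N.factorial = w (none, τ) ^ N.factorial := by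
      by_contra! hcon
      rw [sum_filter, Fintype.sum_prod_type, Fintype.sum_option] at hsplit
      rw [sum_eq_zero (s := (univ : Finset K))] at hsplit
      · rw [add_zero, sum_congr rfl fun σ _ => if_pos (mem_image_of_mem _ (mem_univ σ))] at hsplit
        simp only [w, Option.elim, ← sum_mul, hB] at hsplit
        exact mul_ne_zero hdet (hxU j).1 hsplit
      · intro k _
        refine sum_eq_zero fun σ _ => if_neg fun hmem => ?_
        obtain ⟨τ, -, hτ⟩ := mem_image.1 hmem
        exact hcon k σ τ hτ.symm
    refine ⟨W ⊓ ratioSubmodule 1 (x j / x k) j k, ?_, hSW x hx, ?_⟩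
    · simp only [T, mem_biUnion, mem_image]
      refine ⟨(k, σ, τ), mem_univ _, x j / x k, ?_, rfl⟩
      rw [Multiset.mem_toFinset, Polynomial.mem_nthRoots (Nat.factorial_pos _)]
      simp only [w, Option.elim] at hpow
      rw [div_pow, div_pow, div_eq_div_iff (pow_ne_zero _ (hxU k).1) (pow_ne_zero _ (hBU τ).1),
        ← mul_pow, ← mul_pow, mul_comm (x j), ← hpow]
      ring
    · rw [SetLike.mem_coe, mem_ratioSubmodule, div_mul_cancel₀ _ (hxU k).1, one_mul]

/-- Vectors attached to the coordinates of a connected subspace which vary little along the edges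
of a frame vary little altogether. -/
lemma IsFrame.lnorm_le_of_edges {L : Type*} [Field L] {E : Type*} [Fintype E] [DecidableEq E]
    {W : Submodule L (E → L)} {J : Finset E} {u : E → E → L} (h : IsFrame W J u) (hW : Conn W)
    {ι : Type*} [Fintype ι] (ρ : E → ι → ℝ) (B : ℝ) (hB : 0 ≤ B) (i₀ : E) (h₀ : ρ i₀ = 0)
    (hedge : ∀ k ∈ J, ∀ j ∉ J, u k j ≠ 0 → lnorm (ρ j - ρ k) ≤ B) (m : E) :
    lnorm (ρ m) ≤ Fintype.card E * B := by
  classical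
  let I : ℕ → Finset E := fun t => univ.filter fun m => lnorm (ρ m) ≤ t * B
  have hI : ∀ t m, m ∈ I t ↔ lnorm (ρ m) ≤ t * B := fun t m => by simp [I]
  have hmono : ∀ t, I t ⊆ I (t + 1) := fun t m hm => by
    rw [hI] at hm ⊢
    push_cast
    linarith
  have hi0 : ∀ t, i₀ ∈ I t := fun t => by
    rw [hI, h₀, lnorm_zero]
    positivity
  have key : ∀ t, t + 1 ≤ (I t).card ∨ I t = univ := by
    intro t
    induction t with
    | zero => exact Or.inl (card_pos.2 ⟨i₀, hi0 0⟩)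
    | succ t ih =>
      by_cases huniv : I t = univ
      · exact Or.inr (univ_subset_iff.1 (huniv ▸ hmono t))
      left
      have h1 := ih.resolve_right huniv
      obtain ⟨k, hk, j, hj, hkj, hiff⟩ := h.exists_crossing hW (I t) ⟨i₀, hi0 t⟩ huniv
      have hE := hedge k hk j hj hkj
      obtain ⟨a, haI, haI'⟩ : ∃ a, a ∉ I t ∧ a ∈ I (t + 1) := by
        by_cases hkI : k ∈ I t
        · refine ⟨j, hiff.1 hkI, ?_⟩
          rw [hI] at hkI ⊢
          have := lnorm_add_le (ρ j - ρ k) (ρ k)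
          rw [sub_add_cancel] at this
          push_cast; linarith
        · have hjI : j ∈ I t := by tauto
          refine ⟨k, hkI, ?_⟩
          rw [hI] at hjI ⊢
          have := lnorm_add_le (ρ k - ρ j) (ρ j)
          rw [sub_add_cancel, lnorm_sub_comm] at this
          push_cast; linarith
      have : (I t).card < (I (t + 1)).card :=
        card_lt_card ⟨hmono t, fun hsub => haI (hsub haI')⟩
      omega
  rw [← hI]
  rcases key (Fintype.card E) with h1 | h1
  · have := card_le_univ (I (Fintype.card E))
    omega
  · rw [h1]; exact mem_univ m

namespace PlaceSystem

variable {L : Type*} [Field L] {ι : Type*} [Fintype ι] (P : PlaceSystem L ι)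

/-- A nonzero determinant of units close to a given tuple has predictable absolute values. -/
lemma lnorm_lv_det_sub_le {E J : Type*} [Fintype E] [Fintype J] [DecidableEq J]
    {n : ℕ} (hJ : Fintype.card J ≤ n) {y : J → E → L} (hy : ∀ a m, P.IsU (y a m)) {c : E → L}
    (hc : ∀ m, ∑ i, P.lv (c m) i = 0) {r : ℝ} (hr : 0 ≤ r) (hyc : ∀ a, P.tdist (y a) c ≤ r)
    (φ : J → E) (hdet : (Matrix.of fun a l : J => y a (φ l)).det ≠ 0) :
    lnorm (P.lv (Matrix.of fun a l : J => y a (φ l)).det - ∑ l, P.lv (c (φ l))) ≤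
      2 * (n * r + P.D * Real.log n.factorial) := by
  have hdetR : (Matrix.of fun a l : J => y a (φ l)).det ∈ P.R := by
    rw [det_eq_sum_detTerm]
    exact P.R.sum_mem fun σ _ => (P.isU_detTerm hy φ σ).2.1
  have hlog : Real.log (univ : Finset (Equiv.Perm J)).card ≤ Real.log n.factorial := by
    rw [card_univ, Fintype.card_perm]
    exact Real.log_le_log (by exact_mod_cast Nat.factorial_pos _)
      (by exact_mod_cast Nat.factorial_le hJ)
  have hlog0 : 0 ≤ Real.log n.factorial := Real.log_natCast_nonneg _
  refine (lnorm_le_two_mul_of_le (g := fun i => (∑ a, ∑ m, |P.lv (y a m) i - P.lv (c m) i|) +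
    P.wt i * Real.log n.factorial) ?_ ?_ ?_).trans ?_
  · simp only [Pi.sub_apply, Finset.sum_apply, sum_sub_distrib]
    rw [sum_comm, sum_eq_zero (s := univ) (f := fun l => ∑ i, P.lv (c (φ l)) i) fun l _ => hc _,
      sub_zero]
    exact P.sum_lv_nonneg hdetR hdet
  · intro i
    have := P.lv_sum_le univ (fun σ => detTerm y φ σ) i
      ((∑ l, P.lv (c (φ l)) i) + ∑ a, ∑ m, |P.lv (y a m) i - P.lv (c m) i|)
      (fun σ _ _ => by
        have := abs_le.1 (P.abs_lv_detTerm_sub_le (fun a m => (hy a m).1) φ σ c i)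
        linarith) (by rwa [← det_eq_sum_detTerm])
    rw [← det_eq_sum_detTerm] at this
    have h2 := mul_le_mul_of_nonneg_left hlog (P.wt_nonneg i)
    simp only [Pi.sub_apply, Finset.sum_apply]
    linarith
  · intro i
    have := P.wt_nonneg i
    positivity
  · rw [sum_add_distrib, sum_wt_mul, sum_comm]
    simp_rw [sum_sum_abs_lv_sub]
    have h1 : ∑ a, P.tdist (y a) c ≤ (univ : Finset J).card • r :=
      sum_le_card_nsmul _ _ _ fun a _ => hyc a
    rw [card_univ, nsmul_eq_mul] at h1
    have h3 : (Fintype.card J : ℝ) ≤ n := by exact_mod_cast hJ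
    have h4 : (Fintype.card J : ℝ) * r ≤ n * r := by gcongr
    linarith

variable {E : Type*} [Fintype E] [DecidableEq E]

/-- If unit solutions near `c` span the subspace, the frame coefficients have the size of ratios of
coordinates of `c`. -/
lemma lnorm_lv_frame_sub_le {n : ℕ} (hE : Fintype.card E ≤ n) {W : Submodule L (E → L)}
    {J : Finset E} {u : E → E → L} (h : IsFrame W J u) {S : Set (E → L)}
    (hS : Submodule.span L S = W) (hSU : ∀ x ∈ S, ∀ m, P.IsU (x m)) {c : E → L}
    (hc : ∀ m, P.IsU (c m)) {r : ℝ} (hr : 0 ≤ r) (hSc : ∀ x ∈ S, P.tdist x c ≤ r)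
    {k : E} (hk : k ∈ J) {j : E} (hkj : u k j ≠ 0) :
    lnorm (P.lv (u k j) - (P.lv (c j) - P.lv (c k))) ≤
      4 * (n * r + P.D * Real.log n.factorial) := by
  obtain ⟨y, hyS, hind⟩ := h.exists_independent S hS
  have hSW : ∀ x ∈ S, x ∈ W := fun x hx => hS ▸ Submodule.subset_span hx
  have hyW : ∀ a, y a ∈ W := fun a => hSW _ (hyS a)
  have hdet := h.det_ne_zero hyW hind
  have hJ : Fintype.card J ≤ n := by rw [Fintype.card_coe]; exact (card_le_univ J).trans hE
  let col : J → E := fun l => if l = ⟨k, hk⟩ then j else l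
  have hcol : (Matrix.of fun a l : J => y a (col l)).det =
      u k j * (Matrix.of fun a l : J => y a l).det := by
    rw [← h.det_updateCol_eq hyW j ⟨k, hk⟩]
    congr 1
    ext a l
    simp only [Matrix.of_apply, Matrix.updateCol_apply, col]
    split_ifs <;> rfl
  have hc0 : ∀ m, ∑ i, P.lv (c m) i = 0 := fun m => P.sum_lv_eq_zero (hc m)
  have h1 := P.lnorm_lv_det_sub_le hJ (fun a => hSU _ (hyS a)) hc0 hr (fun a => hSc _ (hyS a))
    (fun l : J => (l : E)) hdet
  have h2 := P.lnorm_lv_det_sub_le hJ (fun a => hSU _ (hyS a)) hc0 hr (fun a => hSc _ (hyS a))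
    col (by rw [hcol]; exact mul_ne_zero hkj hdet)
  rw [hcol, P.lv_mul hkj hdet] at h2
  have h3 : ∑ l : J, P.lv (c (col l)) - ∑ l : J, P.lv (c l) = P.lv (c j) - P.lv (c k) := by
    rw [← sum_sub_distrib, sum_eq_single (⟨k, hk⟩ : J)]
    · simp [col]
    · intro l _ hl
      simp [col, hl]
    · simp
  have h4 := lnorm_sub_le
    (P.lv (u k j) + P.lv (Matrix.of fun a l : J => y a l).det - ∑ l, P.lv (c (col l)))
    (P.lv (Matrix.of fun a l : J => y a l).det - ∑ l : J, P.lv (c l))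
  rw [← h3]
  have h5 : P.lv (u k j) - (∑ l : J, P.lv (c (col l)) - ∑ l : J, P.lv (c l)) =
    (P.lv (u k j) + P.lv (Matrix.of fun a l : J => y a l).det - ∑ l, P.lv (c (col l))) -
    (P.lv (Matrix.of fun a l : J => y a l).det - ∑ l : J, P.lv (c l)) := by abel
  rw [h5]
  linarith

/-- Two spanning clusters of normalized unit solutions of a connected system are close. -/
lemma tdist_le_of_span_eq {n : ℕ} (hE : Fintype.card E ≤ n) {W : Submodule L (E → L)}
    (hW : Conn W) {c c' : E → L} (hc : ∀ m, P.IsU (c m)) (hc' : ∀ m, P.IsU (c' m))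
    {i₀ : E} (h₀ : c i₀ = c' i₀) {S S' : Set (E → L)}
    (hS : Submodule.span L S = W) (hSU : ∀ x ∈ S, ∀ m, P.IsU (x m))
    (hS' : Submodule.span L S' = W) (hSU' : ∀ x ∈ S', ∀ m, P.IsU (x m))
    {r r' : ℝ} (hr : 0 ≤ r) (hr' : 0 ≤ r') (hSc : ∀ x ∈ S, P.tdist x c ≤ r)
    (hSc' : ∀ x ∈ S', P.tdist x c' ≤ r') :
    P.tdist c c' ≤ (8 * n ^ 2 * (n + Real.log n.factorial)) * (r + r' + P.D) := by
  obtain ⟨J, u, h⟩ := exists_isFrame_univ W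
  have hlog0 : 0 ≤ Real.log n.factorial := Real.log_natCast_nonneg _
  set B := 4 * (n * r + P.D * Real.log n.factorial) +
    4 * (n * r' + P.D * Real.log n.factorial) with hBdef
  have hD := P.D_pos
  have hB : 0 ≤ B := by positivity
  have h1 := h.lnorm_le_of_edges hW (fun m => P.lv (c m) - P.lv (c' m)) B hB i₀ (by simp [h₀])
    (fun k hk j _ hkj => by
      have h2 := P.lnorm_lv_frame_sub_le hE h hS hSU hc hr hSc hk hkj
      have h3 := P.lnorm_lv_frame_sub_le hE h hS' hSU' hc' hr' hSc' hk hkj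
      have h4 := lnorm_sub_le (P.lv (u k j) - (P.lv (c' j) - P.lv (c' k)))
        (P.lv (u k j) - (P.lv (c j) - P.lv (c k)))
      have h5 : P.lv (c j) - P.lv (c' j) - (P.lv (c k) - P.lv (c' k)) =
        P.lv (u k j) - (P.lv (c' j) - P.lv (c' k)) -
        (P.lv (u k j) - (P.lv (c j) - P.lv (c k))) := by abel
      rw [h5]
      linarith)
  have hn : (Fintype.card E : ℝ) ≤ n := by exact_mod_cast hE
  have h6 : P.tdist c c' ≤ (univ : Finset E).card • (Fintype.card E * B) :=
    sum_le_card_nsmul _ _ _ fun m _ => h1 m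
  rw [card_univ, nsmul_eq_mul] at h6
  have h7 : (Fintype.card E : ℝ) * (Fintype.card E * B) ≤ n * (n * B) := by gcongr
  refine (h6.trans h7).trans ?_
  rw [hBdef]
  have h8 : 0 ≤ Real.log n.factorial * (r + r') := by positivity
  have h9 : 0 ≤ n * P.D := by positivity
  have : 4 * (n * r + P.D * Real.log n.factorial) + 4 * (n * r' + P.D * Real.log n.factorial) ≤
      8 * ((n + Real.log n.factorial) * (r + r' + P.D)) := by
    have : 0 ≤ (n : ℝ) * (r + r') := by positivity
    nlinarith
  calc (n : ℝ) * (n * (4 * (n * r + P.D * Real.log n.factorial) +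
      4 * (n * r' + P.D * Real.log n.factorial)))
      ≤ n * (n * (8 * ((n + Real.log n.factorial) * (r + r' + P.D)))) := by gcongr
    _ = _ := by ring

end PlaceSystem

section Existence

open NumberField

open scoped Classical in
/-- The places of a number field needed to see a given finite set of nonzero elements as units. -/
noncomputable def numberFieldPlaces (L : Type u) [Field L] [NumberField L]
    (T : Finset (FinitePlace L)) : PlaceSystem L ((Σ w : InfinitePlace L, Fin w.mult) ⊕ T) where
  v := Sum.elim (fun w => w.1.1) (fun w => w.1.1)
  arch := univ.image Sum.inl
  arch_nonempty := by
    obtain ⟨w⟩ : Nonempty (InfinitePlace L) := inferInstance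
    exact ⟨_, mem_image_of_mem _ (mem_univ ⟨w, ⟨0, w.mult_pos⟩⟩)⟩
  nonarch := by
    rintro (w | w) hw x y
    · exact absurd (mem_image_of_mem _ (mem_univ w)) hw
    · exact FinitePlace.add_le w.1 x y
  map_natCast := by
    rintro (w | w) hw m
    · exact InfinitePlace.map_natCast w.1 m
    · simp at hw
  R :=
  { carrier := {x | ∀ w, w ∉ T → w x ≤ 1}
    mul_mem' := fun {a b} ha hb w hw => by
      rw [map_mul]; exact mul_le_one₀ (ha w hw) (apply_nonneg w b) (hb w hw)
    one_mem' := fun w _ => by rw [map_one]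
    add_mem' := fun {a b} ha hb w hw =>
      (FinitePlace.add_le w a b).trans (max_le (ha w hw) (hb w hw))
    zero_mem' := fun w _ => by rw [map_zero]; exact zero_le_one
    neg_mem' := fun {a} ha w hw => by rw [map_neg_eq_map]; exact ha w hw }
  one_le_prod := by
    intro r hr h0
    have hfin : (Function.mulSupport fun w : FinitePlace L => w r).Finite :=
      FinitePlace.hasFiniteMulSupport h0
    have h1 := prod_abs_eq_one h0
    rw [finprod_eq_prod_of_mulSupport_subset (s := T ∪ hfin.toFinset) _
        fun w hw => by rw [coe_union]; exact Or.inr (hfin.mem_toFinset.2 hw),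
      ← prod_sdiff (subset_union_left (s₁ := T))] at h1
    have h2 : ∏ w ∈ (T ∪ hfin.toFinset) \ T, w r ≤ 1 :=
      prod_le_one (fun w _ => apply_nonneg w r) fun w hw => hr w (mem_sdiff.1 hw).2
    rw [Fintype.prod_sum_type, Fintype.prod_sigma]
    simp only [Sum.elim_inl, Sum.elim_inr, prod_const, card_univ, Fintype.card_fin]
    rw [prod_coe_sort T (fun w => w.1 r), ← h1]
    change (∏ w : InfinitePlace L, w r ^ w.mult) * _ ≤
      (∏ w : InfinitePlace L, w r ^ w.mult) * ∏ w ∈ T, w r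
    refine mul_le_mul_of_nonneg_left ?_
      (prod_nonneg fun w _ => pow_nonneg (apply_nonneg w r) _)
    exact mul_le_of_le_one_left (prod_nonneg fun w _ => apply_nonneg w r) h2

lemma exists_placeSystem (L : Type u) [Field L] [NumberField L] (B : Finset L)
    (hB : ∀ b ∈ B, b ≠ 0) : ∃ (ι : Type u) (_ : Fintype ι) (P : PlaceSystem L ι),
    ∀ b ∈ B, P.IsU b := by
  classical
  have hfin : ∀ b ∈ B, {w : FinitePlace L | w b ≠ 1}.Finite := fun b hb =>
    FinitePlace.hasFiniteMulSupport (hB b hb)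
  choose! T hT using fun b hb => (hfin b hb).exists_finset_coe
  refine ⟨_, inferInstance, numberFieldPlaces L (B.biUnion T), fun b hb => ?_⟩
  have h1 : ∀ w, w ∉ B.biUnion T → w b = 1 := by
    intro w hw
    by_contra hne
    refine hw (mem_biUnion.2 ⟨b, hb, ?_⟩)
    rw [← mem_coe, hT b hb]
    exact hne
  refine ⟨hB b hb, fun w hw => (h1 w hw).le, fun w hw => ?_⟩
  rw [map_inv₀, h1 w hw, inv_one]

end Existence

section PadeApproximation

open Polynomial

section Pade

variable {L : Type*} [Field L] [CharZero L]

/-- The Jacobi-type polynomials giving Padé approximations to a sum of three units. -/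
def padePoly {L : Type*} [Field L] (M : ℕ) (x y : L) : L :=
  ∑ k ∈ range (M + 1), (-1) ^ k * ((M + k).choose M * (2 * M - k).choose M : ℕ) * x ^ k * y ^ (M - k)

lemma exists_derivative_eq (p : L[X]) : ∃ q, derivative q = p := by
  induction p using Polynomial.induction_on' with
  | add p q hp hq =>
    obtain ⟨a, rfl⟩ := hp
    obtain ⟨b, rfl⟩ := hq
    exact ⟨a + b, derivative_add⟩
  | monomial n a =>
    refine ⟨monomial (n + 1) (a / (n + 1)), ?_⟩
    rw [derivative_monomial]
    congr 1
    push_cast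
    exact div_mul_cancel₀ _ (Nat.cast_add_one_ne_zero n)

lemma eval_sub_eval_eq_of_derivative_eq {p q : L[X]} (h : derivative p = derivative q) (a b : L) :
    p.eval b - p.eval a = q.eval b - q.eval a := by
  have h1 : derivative (p - q) = 0 := by rw [derivative_sub, h, sub_self]
  have h2 := eq_C_of_natDegree_eq_zero (derivative_eq_zero.1 h1)
  have h3 : ∀ z, p.eval z - q.eval z = (p - q).coeff 0 := fun z => by
    rw [← eval_sub, h2, eval_C, coeff_C_zero]
  linear_combination h3 b - h3 a

lemma exists_beta (j : ℕ) : ∀ i : ℕ, ∃ H : L[X], derivative H = X ^ i * (1 - X) ^ j ∧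
    H.eval 1 - H.eval 0 = (i.factorial * j.factorial : L) / (i + j + 1).factorial := by
  induction j with
  | zero =>
    intro i
    have hi : ((i : L) + 1) ≠ 0 := Nat.cast_add_one_ne_zero i
    refine ⟨C ((i + 1 : L)⁻¹) * X ^ (i + 1), ?_, ?_⟩
    · rw [derivative_C_mul, derivative_X_pow, ← mul_assoc, ← C_mul]
      push_cast
      rw [inv_mul_cancel₀ hi]
      simp
    · have : ((i.factorial : ℕ) : L) ≠ 0 := Nat.cast_ne_zero.2 i.factorial_ne_zero
      simp [Nat.factorial_succ]
      field_simp
  | succ j ih =>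
    intro i
    obtain ⟨H, h1, h2⟩ := ih (i + 1)
    have hi : ((i : L) + 1) ≠ 0 := Nat.cast_add_one_ne_zero i
    refine ⟨C ((i + 1 : L)⁻¹) * (X ^ (i + 1) * (1 - X) ^ (j + 1) + C (j + 1 : L) * H), ?_, ?_⟩
    · have h3 : derivative (X ^ (i + 1) * (1 - X) ^ (j + 1) + C (j + 1 : L) * H) =
          C (i + 1 : L) * (X ^ i * (1 - X) ^ (j + 1)) := by
        rw [derivative_add, derivative_mul, derivative_C_mul, h1, derivative_X_pow,
          derivative_pow]
        simp only [derivative_sub, derivative_one, derivative_X, Nat.cast_add, Nat.cast_one,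
          Nat.add_sub_cancel]
        ring
      rw [derivative_C_mul, h3, ← mul_assoc, ← C_mul, inv_mul_cancel₀ hi, C_1, one_mul]
    · have h4 : ((i + 1 + j + 1).factorial : L) ≠ 0 :=
        Nat.cast_ne_zero.2 (Nat.factorial_ne_zero _)
      simp only [eval_mul, eval_C, eval_add, eval_pow, eval_X, eval_sub, eval_one]
      have h5 : (i + 1 : L)⁻¹ * (1 ^ (i + 1) * (1 - 1) ^ (j + 1) + (j + 1) * H.eval 1) -
          (i + 1 : L)⁻¹ * (0 ^ (i + 1) * (1 - 0) ^ (j + 1) + (j + 1) * H.eval 0) =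
          (i + 1 : L)⁻¹ * (j + 1) * (H.eval 1 - H.eval 0) := by
        rw [sub_self, zero_pow (Nat.succ_ne_zero j), zero_pow (Nat.succ_ne_zero i)]; ring
      rw [h5, h2, show i + (j + 1) + 1 = i + 1 + j + 1 by ring, Nat.factorial_succ i,
        Nat.factorial_succ j]
      push_cast
      field_simp

/-- The normalizing constant of the Padé integrals. -/
def padeConst (L : Type*) [Field L] (M : ℕ) : L :=
  (-1) ^ M * (3 * M + 1).factorial / (M.factorial : L) ^ 3

lemma padeConst_ne_zero (M : ℕ) : padeConst L M ≠ 0 := by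
  unfold padeConst
  refine div_ne_zero (mul_ne_zero (pow_ne_zero _ (neg_ne_zero.2 one_ne_zero)) ?_)
    (pow_ne_zero _ ?_) <;> exact Nat.cast_ne_zero.2 (Nat.factorial_ne_zero _)

lemma pade_coeff (M k : ℕ) (hk : k ≤ M) :
    ((3 * M + 1).factorial : L) / (M.factorial : L) ^ 3 * M.choose k *
      (((M + k).factorial * (2 * M - k).factorial : L) / (M + k + (2 * M - k) + 1).factorial) =
    ((M + k).choose M * (2 * M - k).choose M : ℕ) := by
  have h0 : ∀ m : ℕ, ((m.factorial : ℕ) : L) ≠ 0 := fun m =>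
    Nat.cast_ne_zero.2 m.factorial_ne_zero
  rw [show M + k + (2 * M - k) + 1 = 3 * M + 1 by omega]
  have h1 := congrArg (Nat.cast : ℕ → L) (Nat.choose_mul_factorial_mul_factorial hk)
  have h2 := congrArg (Nat.cast : ℕ → L)
    (Nat.choose_mul_factorial_mul_factorial (show M ≤ M + k by omega))
  have h3 := congrArg (Nat.cast : ℕ → L)
    (Nat.choose_mul_factorial_mul_factorial (show M ≤ 2 * M - k by omega))
  rw [show M + k - M = k by omega] at h2
  rw [show 2 * M - k - M = M - k by omega] at h3
  push_cast at h1 h2 h3 ⊢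
  rw [← h2, ← h3]
  have h4 := h0 M
  have h5 := h0 (3 * M + 1)
  field_simp
  rw [← h1]
  ring

lemma neg_one_pow_mul_mul_pow {R : Type*} [CommRing R] (e t x y q : R) (M : ℕ) :
    (-1) ^ M * e * (t * x * -(t * y) * q) ^ M = t ^ (2 * M) * e * (x ^ M * y ^ M * q ^ M) := by
  have h : ((-1 : R) ^ M) * (-1) ^ M = 1 := by rw [← mul_pow]; simp
  rw [show t * x * -(t * y) * q = -1 * (t ^ 2 * (x * y * q)) by ring, mul_pow, mul_pow (t ^ 2),
    mul_pow (x * y), mul_pow x, ← pow_mul]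
  linear_combination (e * (t ^ (2 * M) * (x ^ M * y ^ M * q ^ M))) * h

/-- The increments of an antiderivative of `((X - a)(X - b)(X - c)) ^ M`. -/
lemma eval_sub_eval_eq_padePoly (M : ℕ) (a b c : L) (G : L[X])
    (hG : derivative G = C (padeConst L M) * ((X - C a) * (X - C b) * (X - C c)) ^ M) :
    G.eval b - G.eval a = (b - a) ^ (2 * M + 1) * padePoly M (c - b) (a - c) := by
  choose H hH1 hH2 using fun j i => exists_beta (L := L) j i
  let z : ℕ → L := fun k => (b - a) ^ (2 * M + 1) * ((3 * M + 1).factorial / (M.factorial : L) ^ 3) *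
    M.choose k * (b - c) ^ k * (a - c) ^ (M - k)
  let F : L[X] := ∑ k ∈ range (M + 1), C (z k) * H (2 * M - k) (M + k)
  have hF : derivative F = derivative (G.comp (C a + C (b - a) * X)) := by
    rw [derivative_comp, hG]
    simp only [F, derivative_sum, derivative_C_mul, hH1]
    have h1 : (C (padeConst L M) * ((X - C a) * (X - C b) * (X - C c)) ^ M).comp
        (C a + C (b - a) * X) = C ((b - a) ^ (2 * M) * ((3 * M + 1).factorial /
          (M.factorial : L) ^ 3)) * (X ^ M * (1 - X) ^ M *
          (C (b - c) * X + C (a - c) * (1 - X)) ^ M) := by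
      simp only [mul_comp, pow_comp, sub_comp, X_comp, C_comp]
      have e1 : C a + C (b - a) * X - C a = C (b - a) * X := by ring
      have e2 : C a + C (b - a) * X - C b = - (C (b - a) * (1 - X)) := by
        rw [C_sub]; ring
      have e3 : C a + C (b - a) * X - C c = C (b - c) * X + C (a - c) * (1 - X) := by
        simp only [C_sub]; ring
      rw [e1, e2, e3, padeConst, mul_div_assoc]
      simp only [C_mul, C_pow, C_neg, C_1]
      exact neg_one_pow_mul_mul_pow _ _ _ _ _ M
    rw [h1, add_pow, mul_sum, mul_sum, mul_sum]
    refine sum_congr rfl fun k hk => ?_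
    have hk' : k ≤ M := by rw [mem_range] at hk; omega
    simp only [derivative_add, derivative_C, zero_add, derivative_C_mul, derivative_X, mul_one, z,
      C_mul, C_pow, mul_pow]
    rw [show 2 * M - k = M + (M - k) by omega, pow_add, pow_add X M, pow_succ, C_eq_natCast]
    ring
  have h2 := eval_sub_eval_eq_of_derivative_eq hF 0 1
  simp only [eval_comp, eval_add, eval_C, eval_mul, eval_X, mul_zero, add_zero, mul_one,
    add_sub_cancel] at h2
  rw [← h2]
  simp only [F, eval_finsetSum, eval_mul, eval_C]
  rw [← sum_sub_distrib, padePoly, mul_sum]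
  refine sum_congr rfl fun k hk => ?_
  have hk' : k ≤ M := by rw [mem_range] at hk; omega
  rw [← mul_sub, hH2, ← pade_coeff (L := L) M k hk', ← neg_sub b c, neg_pow (b - c) k]
  have e5 : ((-1 : L) ^ k) * (-1) ^ k = 1 := by rw [← mul_pow]; simp
  simp only [z]
  linear_combination (-(b - a) ^ (2 * M + 1) * ((3 * M + 1).factorial / (M.factorial : L) ^ 3) *
    M.choose k * (b - c) ^ k * (a - c) ^ (M - k) * (((M + k).factorial * (2 * M - k).factorial : L)
    / (M + k + (2 * M - k) + 1).factorial)) * e5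

end Pade

section PadeNonproportional

variable {L : Type*} [Field L] [CharZero L]

lemma X_sub_C_pow_succ_dvd {G : L[X]} {a : L} {N : ℕ} (h0 : G.IsRoot a)
    (h : (X - C a) ^ N ∣ derivative G) : (X - C a) ^ (N + 1) ∣ G := by
  by_cases hG : derivative G = 0
  · have h1 := eq_C_of_natDegree_eq_zero (derivative_eq_zero.1 hG)
    have h2 : G = 0 := by
      rw [h1, IsRoot, eval_C] at h0
      rw [h1, h0, C_0]
    rw [h2]; exact dvd_zero _
  have hG' : G ≠ 0 := fun h => hG (by rw [h, derivative_zero])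
  have h1 := (le_rootMultiplicity_iff hG).2 h
  rw [derivative_rootMultiplicity_of_root h0] at h1
  have h2 := (rootMultiplicity_pos hG').2 h0
  exact (le_rootMultiplicity_iff hG').1 (by omega)

lemma eq_zero_of_eval_eq {a b c : L} (hab : a ≠ b) (hac : a ≠ c) (hbc : b ≠ c)
    (hq : a ^ 2 + b ^ 2 + c ^ 2 - a * b - b * c - c * a ≠ 0) (N : ℕ) (α β : L) (F : L[X])
    (hF : derivative F = C α * ((X - C a) * (X - C b) * (X - C c)) ^ N +
      C β * ((X - C a) * (X - C b) * (X - C c)) ^ (N + 1))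
    (h1 : F.eval b = F.eval a) (h2 : F.eval c = F.eval a) : α = 0 ∧ β = 0 := by
  set p : L[X] := (X - C a) * (X - C b) * (X - C c) with hp
  have hp0 : p ≠ 0 := mul_ne_zero (mul_ne_zero (X_sub_C_ne_zero a) (X_sub_C_ne_zero b))
    (X_sub_C_ne_zero c)
  have hpdeg : p.natDegree = 3 := by
    rw [hp, natDegree_mul (mul_ne_zero (X_sub_C_ne_zero a) (X_sub_C_ne_zero b))
      (X_sub_C_ne_zero c), natDegree_mul (X_sub_C_ne_zero a) (X_sub_C_ne_zero b)]
    simp only [natDegree_X_sub_C]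
  have hpa : p.eval a = 0 := by simp [hp]
  have hF' : derivative F = p ^ N * (C α + C β * p) := by rw [hF]; ring
  set G := F - C (F.eval a) with hG
  have hG' : derivative G = derivative F := by rw [hG, derivative_sub, derivative_C, sub_zero]
  have hdvd : ∀ z, X - C z ∣ p → F.eval z = F.eval a → (X - C z) ^ (N + 1) ∣ G := by
    intro z hz hz'
    apply X_sub_C_pow_succ_dvd
    · simp [hG, IsRoot, hz']
    · rw [hG', hF']
      exact (pow_dvd_pow_of_dvd hz N).mul_right _
  have hda := hdvd a ((dvd_mul_right _ _).mul_right _) rfl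
  have hdb := hdvd b ((dvd_mul_left _ _).mul_right _) h1
  have hdc := hdvd c (dvd_mul_left _ _) h2
  have hco : ∀ {s t : L}, s ≠ t → IsCoprime ((X - C s) ^ (N + 1)) ((X - C t) ^ (N + 1)) :=
    fun h => (isCoprime_X_sub_C_of_isUnit_sub (sub_ne_zero.2 h).isUnit).pow
  have hd : p ^ (N + 1) ∣ G := by
    rw [hp, mul_pow, mul_pow]
    exact ((hco hac).mul_left (hco hbc)).mul_dvd ((hco hab).mul_dvd hda hdb) hdc
  obtain ⟨H, hH⟩ := hd
  have hdeg : H.natDegree ≤ 1 := by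
    by_cases h0 : H = 0
    · simp [h0]
    have e1 : G.natDegree = (N + 1) * 3 + H.natDegree := by
      rw [hH, natDegree_mul (pow_ne_zero _ hp0) h0, natDegree_pow, hpdeg]
    have e2 : (derivative G).natDegree ≤ N * 3 + 3 := by
      rw [hG', hF']
      refine natDegree_mul_le.trans (add_le_add ?_ ?_)
      · rw [natDegree_pow, hpdeg]
      · refine (natDegree_add_le _ _).trans (max_le (by simp) ?_)
        exact (natDegree_C_mul_le _ _).trans hpdeg.le
    have e3 : (derivative G).natDegree = G.natDegree - 1 := natDegree_derivative _
    omega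
  have hcancel : C ((N : L) + 1) * derivative p * H + p * derivative H = C α + C β * p := by
    apply mul_left_cancel₀ (pow_ne_zero N hp0)
    rw [← hF', ← hG', hH, derivative_mul (f := p ^ (N + 1)), derivative_pow]
    simp only [Nat.add_sub_cancel, Nat.cast_add, Nat.cast_one, C_add, C_eq_natCast, C_1]
    ring
  obtain ⟨h₁, h₀, hHe⟩ := exists_eq_X_add_C_of_natDegree_le_one hdeg
  have hN : ((N : L) + 1) ≠ 0 := Nat.cast_add_one_ne_zero N
  have heval : ∀ z, p.eval z = 0 → (N + 1) * (derivative p).eval z * (h₁ * z + h₀) = α := by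
    intro z hz
    have := congrArg (eval z) hcancel
    simpa [hz, hHe] using this
  have ea := heval a hpa
  have eb := heval b (by simp [hp])
  have ec := heval c (by simp [hp])
  have hdp : derivative p = (X - C b) * (X - C c) + (X - C a) * (X - C c) +
      (X - C a) * (X - C b) := by
    rw [hp]
    simp only [derivative_mul, derivative_sub, derivative_X, derivative_C, sub_zero]
    ring
  simp only [hdp, eval_add, eval_mul, eval_sub, eval_X, eval_C, sub_self, mul_zero, zero_mul,
    add_zero, zero_add] at ea eb ec
  have f1 : (a - c) * (h₁ * a + h₀) + (b - c) * (h₁ * b + h₀) = 0 := by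
    apply mul_left_cancel₀ (mul_ne_zero hN (sub_ne_zero.2 hab))
    linear_combination ea - eb
  have f2 : (a - b) * (h₁ * a + h₀) + (c - b) * (h₁ * c + h₀) = 0 := by
    apply mul_left_cancel₀ (mul_ne_zero hN (sub_ne_zero.2 hac))
    linear_combination ea - ec
  have hdet : 2 * (b - c) * (a ^ 2 + b ^ 2 + c ^ 2 - a * b - b * c - c * a) ≠ 0 :=
    mul_ne_zero (mul_ne_zero two_ne_zero (sub_ne_zero.2 hbc)) hq
  have g1 : h₁ = 0 := by
    apply mul_left_cancel₀ hdet
    linear_combination (a + b - 2 * c) * f2 - (a + c - 2 * b) * f1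
  have g0 : h₀ = 0 := by
    apply mul_left_cancel₀ hdet
    linear_combination (a ^ 2 - a * b + c ^ 2 - b * c) * f1 - (a ^ 2 - a * c + b ^ 2 - b * c) * f2
  have hα : α = 0 := by rw [← ea, g1, g0]; ring
  refine ⟨hα, ?_⟩
  rw [hHe, g1, g0, hα] at hcancel
  simp only [C_0, zero_mul, zero_add, mul_zero, derivative_zero] at hcancel
  exact C_eq_zero.1 ((mul_eq_zero.1 hcancel.symm).resolve_right hp0)

lemma padePoly_add_eq_zero_and_nonprop {x y : L} (hx : x ≠ 0) (hy : y ≠ 0)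
    (hxy : x + y + 1 = 0) :
    (∀ M, x ^ (2 * M + 1) * padePoly M y 1 + y ^ (2 * M + 1) * padePoly M 1 x +
      padePoly M x y = 0) ∧
    ∀ (_ : x ^ 2 + x + 1 ≠ 0) (x' y' : L) (_ : x' + y' + 1 = 0) (N : ℕ),
      ¬ (x ^ (2 * N + 1) * padePoly N y 1 * y' = y ^ (2 * N + 1) * padePoly N 1 x * x' ∧
        x ^ (2 * (N + 1) + 1) * padePoly (N + 1) y 1 * y' =
          y ^ (2 * (N + 1) + 1) * padePoly (N + 1) 1 x * x') := by
  choose G hG using fun M => exists_derivative_eq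
    (C (padeConst L M) * ((X - C 0) * (X - C 1) * (X - C (-y))) ^ M)
  have e3 : ∀ M, (G M).eval 1 - (G M).eval 0 = padePoly M x y := fun M => by
    rw [eval_sub_eval_eq_padePoly M 0 1 (-y) (G M) (hG M), sub_zero, one_pow, one_mul, zero_sub,
      neg_neg, show -y - 1 = x by linear_combination -hxy]
  have e1 : ∀ M, (G M).eval (-y) - (G M).eval 1 = x ^ (2 * M + 1) * padePoly M y 1 := fun M => by
    rw [eval_sub_eval_eq_padePoly M 1 (-y) 0 (G M) (by rw [hG M]; ring), sub_zero, zero_sub,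
      neg_neg, show -y - 1 = x by linear_combination -hxy]
  have e2 : ∀ M, (G M).eval 0 - (G M).eval (-y) = y ^ (2 * M + 1) * padePoly M 1 x := fun M => by
    rw [eval_sub_eval_eq_padePoly M (-y) 0 1 (G M) (by rw [hG M]; ring), sub_zero, zero_sub,
      neg_neg, show -y - 1 = x by linear_combination -hxy]
  refine ⟨fun M => by rw [← e1, ← e2, ← e3]; ring, ?_⟩
  rintro hq x' y' hxy' N ⟨h1, h2⟩
  rw [← e1, ← e2] at h1 h2
  have key : ∀ α β : L,
      α * ((G N).eval (-y) - (G N).eval 1) +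
        β * ((G (N + 1)).eval (-y) - (G (N + 1)).eval 1) = 0 →
      α * ((G N).eval 0 - (G N).eval (-y)) +
        β * ((G (N + 1)).eval 0 - (G (N + 1)).eval (-y)) = 0 → α = 0 ∧ β = 0 := by
    intro α β k1 k2
    have := eq_zero_of_eval_eq (a := 0) (b := 1) (c := -y) zero_ne_one
      (by simpa using hy) (fun h => hx (by linear_combination hxy - h))
      (by
        convert hq using 1
        linear_combination (y - x) * hxy) N (α * padeConst L N)
      (β * padeConst L (N + 1)) (C α * G N + C β * G (N + 1))
      (by
        rw [derivative_add, derivative_C_mul, derivative_C_mul, hG, hG, C_mul, C_mul]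
        ring)
      (by
        simp only [eval_add, eval_mul, eval_C]
        linear_combination -k1 - k2)
      (by
        simp only [eval_add, eval_mul, eval_C]
        linear_combination -k2)
    exact ⟨(mul_eq_zero.1 this.1).resolve_right (padeConst_ne_zero N),
      (mul_eq_zero.1 this.2).resolve_right (padeConst_ne_zero _)⟩
  generalize (G N).eval (-y) - (G N).eval 1 = u1 at *
  generalize (G N).eval 0 - (G N).eval (-y) = u2 at *
  generalize (G (N + 1)).eval (-y) - (G (N + 1)).eval 1 = w1 at *
  generalize (G (N + 1)).eval 0 - (G (N + 1)).eval (-y) = w2 at *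
  have r1 : u1 = -(u1 + u2) * x' := by linear_combination u1 * hxy' - h1
  have r2 : u2 = -(u1 + u2) * y' := by linear_combination u2 * hxy' + h1
  have r3 : w1 = -(w1 + w2) * x' := by linear_combination w1 * hxy' - h2
  have r4 : w2 = -(w1 + w2) * y' := by linear_combination w2 * hxy' + h2
  obtain ⟨k1, k2⟩ := key (w1 + w2) (-(u1 + u2))
    (by linear_combination (w1 + w2) * r1 - (u1 + u2) * r3)
    (by linear_combination (w1 + w2) * r2 - (u1 + u2) * r4)
  have k3 : u1 + u2 = 0 := neg_eq_zero.1 k2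
  have := key 1 0 (by rw [r1, k3]; ring) (by rw [r2, k3]; ring)
  exact one_ne_zero this.1

end PadeNonproportional

namespace PlaceSystem

variable {L : Type*} [Field L] {ι : Type*} [Fintype ι] (P : PlaceSystem L ι)

lemma lv_natCast_le {m B : ℕ} (hm : m ≠ 0) (hB : m ≤ B) (i : ι) :
    P.lv (m : L) i ≤ P.wt i * Real.log B := by
  unfold lv wt
  split_ifs with hi
  · rw [one_mul, P.map_natCast i hi]
    exact Real.log_le_log (by exact_mod_cast Nat.pos_of_ne_zero hm) (by exact_mod_cast hB)
  · rw [zero_mul]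
    exact Real.log_nonpos ((P.v i).nonneg _) (P.v_natCast_le_one hi m)

lemma padePoly_mem {M : ℕ} {x y : L} (hx : x ∈ P.R) (hy : y ∈ P.R) : padePoly M x y ∈ P.R :=
  sum_mem fun _ _ => mul_mem (mul_mem (mul_mem (pow_mem (neg_mem (one_mem _)) _)
    (natCast_mem _ _)) (pow_mem hx _)) (pow_mem hy _)

lemma lv_add_le {x y : L} (h : x + y ≠ 0) (i : ι) {g : ℝ} (hx : x ≠ 0 → P.lv x i ≤ g)
    (hy : y ≠ 0 → P.lv y i ≤ g) : P.lv (x + y) i ≤ g + P.wt i * Real.log 2 := by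
  have := P.lv_sum_le univ ![x, y] i g (by simpa [Fin.forall_fin_two] using ⟨hx, hy⟩)
    (by simpa using h)
  simpa using this

/-- The height of a solution of the unit equation `x + y + 1 = 0`. -/
noncomputable def height₂ (x y : L) : ℝ := ∑ i, max (max (P.lv x i) (P.lv y i)) 0

variable [CharZero L]

lemma lv_padePoly_le {M : ℕ} {x y : L} (hx : x ≠ 0) (hy : y ≠ 0) (h0 : padePoly M x y ≠ 0)
    (i : ι) {m : ℝ} (hxm : P.lv x i ≤ m) (hym : P.lv y i ≤ m) :
    P.lv (padePoly M x y) i ≤ M * m + P.wt i * (M * Real.log 32) := by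
  unfold padePoly at h0 ⊢
  refine (P.lv_sum_le _ _ i (M * m + P.wt i * (M * Real.log 16)) ?_ h0).trans ?_
  · intro k hk _
    have hk' : k ≤ M := by rw [mem_range] at hk; omega
    have hc : (M + k).choose M * (2 * M - k).choose M ≠ 0 :=
      mul_ne_zero (Nat.choose_pos (by omega)).ne' (Nat.choose_pos (by omega)).ne'
    have hB : (M + k).choose M * (2 * M - k).choose M ≤ 16 ^ M := by
      have h1 : (M + k).choose M ≤ 4 ^ M := by
        refine (Nat.choose_le_two_pow _ _).trans ?_
        rw [show 4 ^ M = 2 ^ (2 * M) by rw [pow_mul]; norm_num]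
        exact Nat.pow_le_pow_right (by norm_num) (by omega)
      have h2 : (2 * M - k).choose M ≤ 4 ^ M := by
        refine (Nat.choose_le_two_pow _ _).trans ?_
        rw [show 4 ^ M = 2 ^ (2 * M) by rw [pow_mul]; norm_num]
        exact Nat.pow_le_pow_right (by norm_num) (by omega)
      exact (Nat.mul_le_mul h1 h2).trans (by rw [← mul_pow]; norm_num)
    have hcL : (((M + k).choose M * (2 * M - k).choose M : ℕ) : L) ≠ 0 := Nat.cast_ne_zero.2 hc
    have hs : ((-1 : L) ^ k) ≠ 0 := pow_ne_zero _ (neg_ne_zero.2 one_ne_zero)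
    rw [P.lv_mul (mul_ne_zero (mul_ne_zero hs hcL) (pow_ne_zero _ hx)) (pow_ne_zero _ hy),
      P.lv_mul (mul_ne_zero hs hcL) (pow_ne_zero _ hx), P.lv_mul hs hcL, lv_pow, lv_pow, lv_pow,
      lv_neg, lv_one, smul_zero, zero_add]
    have h3 := P.lv_natCast_le hc hB i
    push_cast [Real.log_pow] at h3
    simp only [Pi.add_apply, Pi.smul_apply, smul_eq_mul]
    push_cast
    have h4 : (k : ℝ) * P.lv x i ≤ k * m := by gcongr
    have h5 : ((M - k : ℕ) : ℝ) * P.lv y i ≤ (M - k : ℕ) * m := by gcongr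
    rw [Nat.cast_sub hk'] at h5 ⊢
    linarith
  · have h1 : Real.log ((range (M + 1)).card : ℝ) ≤ M * Real.log 2 := by
      rw [card_range, ← Real.log_pow]
      apply Real.log_le_log (by positivity)
      exact_mod_cast Nat.lt_two_pow_self
    have h2 : Real.log 32 = Real.log 16 + Real.log 2 := by
      rw [← Real.log_mul (by norm_num) (by norm_num)]; norm_num
    have := mul_le_mul_of_nonneg_left h1 (P.wt_nonneg i)
    rw [h2]
    linarith

/-- Two solutions of the unit equation cannot be in an almost exact odd ratio. -/
lemma mul_height_le_of_ne {x y x' y' : L} (hx : P.IsU x) (hy : P.IsU y) (hx' : P.IsU x')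
    (hy' : P.IsU y') (hxy : x + y + 1 = 0) (hxy' : x' + y' + 1 = 0) (M : ℕ)
    (hne : x ^ (2 * M + 1) * padePoly M y 1 * y' ≠ y ^ (2 * M + 1) * padePoly M 1 x * x') :
    (M + 1) * P.height₂ x y - P.D * (M * Real.log 32 + Real.log 2) ≤
      lnorm (P.lv x' - ((2 * M + 1 : ℕ) : ℝ) • P.lv x) +
        lnorm (P.lv y' - ((2 * M + 1 : ℕ) : ℝ) • P.lv y) := by
  have hsum := (padePoly_add_eq_zero_and_nonprop hx.1 hy.1 hxy).1 M
  set k := 2 * M + 1 with hk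
  have hk' : (k : ℝ) = 2 * M + 1 := by rw [hk]; push_cast; ring
  set Q₁ := padePoly M y 1
  set Q₂ := padePoly M 1 x
  set Q₃ := padePoly M x y
  have hxk : P.IsU (x ^ k) := by
    simpa using IsU.prod P (range k) (fun _ => x) fun _ _ => hx
  have hyk : P.IsU (y ^ k) := by
    simpa using IsU.prod P (range k) (fun _ => y) fun _ _ => hy
  set Δ : L := x ^ k * Q₁ * y' - y ^ k * Q₂ * x' with hΔ
  have hΔ0 : Δ ≠ 0 := sub_ne_zero.2 hne
  have hΔR : Δ ∈ P.R := sub_mem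
    (mul_mem (mul_mem hxk.2.1 (P.padePoly_mem hy.2.1 (one_mem _))) hy'.2.1)
    (mul_mem (mul_mem hyk.2.1 (P.padePoly_mem (one_mem _) hx.2.1)) hx'.2.1)
  have hΔs : 0 ≤ ∑ i, P.lv Δ i := P.sum_lv_nonneg hΔR hΔ0
  have hsx := P.sum_lv_eq_zero hx
  have hsy := P.sum_lv_eq_zero hy
  set η₁ := P.lv x' - (k : ℝ) • P.lv x with hη₁
  set η₂ := P.lv y' - (k : ℝ) • P.lv y with hη₂
  have hmain : ∀ i, P.lv Δ i ≤ k * P.lv x i + k * P.lv y i +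
      (|η₁ i| + |η₂ i| - (M + 1) * max (max (P.lv x i) (P.lv y i)) 0) +
        P.wt i * (M * Real.log 32 + Real.log 2) := by
    intro i
    set m := max (max (P.lv x i) (P.lv y i)) 0 with hm
    have hxm : P.lv x i ≤ m := (le_max_left _ _).trans (le_max_left _ _)
    have hym : P.lv y i ≤ m := (le_max_right _ _).trans (le_max_left _ _)
    have h1m : P.lv (1 : L) i ≤ m := by rw [lv_one]; exact le_max_right _ _
    have q₁ : Q₁ ≠ 0 → P.lv Q₁ i ≤ M * m + P.wt i * (M * Real.log 32) :=
      fun h => P.lv_padePoly_le hy.1 one_ne_zero h i hym h1m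
    have q₂ : Q₂ ≠ 0 → P.lv Q₂ i ≤ M * m + P.wt i * (M * Real.log 32) :=
      fun h => P.lv_padePoly_le one_ne_zero hx.1 h i h1m hxm
    have q₃ : Q₃ ≠ 0 → P.lv Q₃ i ≤ M * m + P.wt i * (M * Real.log 32) :=
      fun h => P.lv_padePoly_le hx.1 hy.1 h i hxm hym
    have a₁ := le_abs_self (η₁ i)
    have a₂ := le_abs_self (η₂ i)
    have b₁ := abs_nonneg (η₁ i)
    have b₂ := abs_nonneg (η₂ i)
    have c₁ : P.lv x' i = η₁ i + k * P.lv x i := by simp [hη₁]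
    have c₂ : P.lv y' i = η₂ i + k * P.lv y i := by simp [hη₂]
    have t₁ : ∀ {u Q : L}, u ≠ 0 → u * Q ≠ 0 → P.lv (u * Q) i = P.lv u i + P.lv Q i :=
      fun h h' => by rw [P.lv_mul h (right_ne_zero_of_mul h')]; rfl
    have t₂ : ∀ {u w Q : L}, u ≠ 0 → w ≠ 0 → u * Q * w ≠ 0 →
        P.lv (u * Q * w) i = P.lv u i + P.lv Q i + P.lv w i := fun hu hw h => by
      rw [P.lv_mul (left_ne_zero_of_mul h) hw,
        P.lv_mul hu (right_ne_zero_of_mul (left_ne_zero_of_mul h))]; rfl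
    have px : P.lv (x ^ k) i = k * P.lv x i := by rw [lv_pow]; rfl
    have py : P.lv (y ^ k) i = k * P.lv y i := by rw [lv_pow]; rfl
    have goal_of : ∀ {s t : L}, Δ = s + t → (∀ g : ℝ,
        g = k * P.lv x i + k * P.lv y i + (|η₁ i| + |η₂ i| - (M + 1) * m) +
          P.wt i * (M * Real.log 32) → (s ≠ 0 → P.lv s i ≤ g) ∧ (t ≠ 0 → P.lv t i ≤ g)) →
        P.lv Δ i ≤ k * P.lv x i + k * P.lv y i +
          (|η₁ i| + |η₂ i| - (M + 1) * m) + P.wt i * (M * Real.log 32 + Real.log 2) := by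
      intro s t hst h
      obtain ⟨h1, h2⟩ := h _ rfl
      have := P.lv_add_le (hst ▸ hΔ0) i h1 h2
      rw [← hst] at this
      linarith
    rcases max_choice (max (P.lv x i) (P.lv y i)) 0 with h | h
    · rcases max_choice (P.lv x i) (P.lv y i) with h' | h'
      · have hmx : m = P.lv x i := h.trans h'
        have hkm : k * P.lv x i = (2 * M + 1) * m := by rw [hk', hmx]
        refine goal_of (s := y ^ k * Q₂) (t := -(Q₃ * y')) ?_ fun g hg => ⟨fun h0 => ?_, fun h0 => ?_⟩
        · linear_combination hΔ + y ^ k * Q₂ * (-hxy') + y' * hsum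
        · rw [t₁ hyk.1 h0, py]
          have := q₂ (right_ne_zero_of_mul h0)
          linarith
        · rw [neg_ne_zero, mul_comm] at h0
          rw [lv_neg, mul_comm Q₃, t₁ hy'.1 h0, c₂]
          have := q₃ (right_ne_zero_of_mul h0)
          linarith
      · have hmy : m = P.lv y i := h.trans h'
        have hkm : k * P.lv y i = (2 * M + 1) * m := by rw [hk', hmy]
        refine goal_of (s := -(x ^ k * Q₁)) (t := Q₃ * x') ?_ fun g hg => ⟨fun h0 => ?_, fun h0 => ?_⟩
        · linear_combination hΔ + x ^ k * Q₁ * hxy' - x' * hsum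
        · rw [neg_ne_zero] at h0
          rw [lv_neg, t₁ hxk.1 h0, px]
          have := q₁ (right_ne_zero_of_mul h0)
          linarith
        · rw [mul_comm] at h0
          rw [mul_comm Q₃, t₁ hx'.1 h0, c₁]
          have := q₃ (right_ne_zero_of_mul h0)
          linarith
    · have hm0 : m = 0 := h
      refine goal_of (s := x ^ k * Q₁ * y') (t := -(y ^ k * Q₂ * x')) (by rw [hΔ]; ring)
        fun g hg => ⟨fun h0 => ?_, fun h0 => ?_⟩
      · rw [t₂ hxk.1 hy'.1 h0, px, c₂]
        have := q₁ (right_ne_zero_of_mul (left_ne_zero_of_mul h0))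
        rw [hm0, mul_zero] at *
        linarith
      · rw [neg_ne_zero] at h0
        rw [lv_neg, t₂ hyk.1 hx'.1 h0, py, c₁]
        have := q₂ (right_ne_zero_of_mul (left_ne_zero_of_mul h0))
        rw [hm0, mul_zero] at *
        linarith
  have := hΔs.trans (sum_le_sum fun i _ => hmain i)
  simp only [sum_add_distrib, sum_sub_distrib, ← mul_sum, hsx, hsy, ← sum_mul, P.sum_wt] at this
  unfold height₂ lnorm
  linarith

end PlaceSystem

lemma card_le_mul_of_cover {α β : Type*} (A : Finset α) (t : Finset β) (R : α → β → Prop) (c : ℕ)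
    (h1 : ∀ x ∈ A, ∃ y ∈ t, R x y)
    (h2 : ∀ y ∈ t, ∀ B ⊆ A, (∀ x ∈ B, R x y) → B.card ≤ c) : A.card ≤ t.card * c := by
  classical
  have : A ⊆ t.biUnion fun y => A.filter fun x => R x y := fun x hx => by
    obtain ⟨y, hy, hxy⟩ := h1 x hx
    exact mem_biUnion.2 ⟨y, hy, mem_filter.2 ⟨hx, hxy⟩⟩
  refine (card_le_card this).trans (card_biUnion_le_card_mul _ _ _ fun y hy => ?_)
  exact h2 y hy _ (filter_subset _ _) fun x hx => (mem_filter.1 hx).2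

namespace PlaceSystem

section cone

variable {L : Type*} [Field L] {ι : Type*} [Fintype ι] (P : PlaceSystem L ι)

lemma norm_tlog_sub_smul {E : Type*} [Fintype E] (x y : E → L) (c : ℝ) :
    ‖P.tlog x - c • P.tlog y‖ = ∑ k, lnorm (P.lv (x k) - c • P.lv (y k)) := by
  rw [PiLp.norm_eq_of_L1, Fintype.sum_prod_type]
  simp [lnorm, tlog]

/-- Tuples from a group of bounded rank can be covered by a bounded number of narrow cones. -/
lemma exists_cone_cover (n ρ : ℕ) (q : ℝ) (hq : 0 < q) : ∃ C : ℕ, ∀ (L : Type*) [Field L]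
    (ι : Type*) [Fintype ι] (P : PlaceSystem L ι) (S : Finset Lˣ) (_ : S.card ≤ ρ)
    (E : Type*) [Fintype E] (_ : Fintype.card E ≤ n) (A : Finset (E → L))
    (_ : ∀ x ∈ A, ∀ k, PowMem S (x k)),
    ∃ t ⊆ A, t.card ≤ C ∧ ∀ x ∈ A, ∃ y ∈ t,
      ‖‖P.tlog x‖⁻¹ • P.tlog x - ‖P.tlog y‖⁻¹ • P.tlog y‖ ≤ q := by
  classical
  obtain ⟨C, hC⟩ := exists_cover (n * ρ) q hq
  refine ⟨C, fun L _ ι _ P S hS E _ hE A hA => ?_⟩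
  let g : (E → L) → PiLp 1 (fun _ : E × ι => ℝ) := fun x => ‖P.tlog x‖⁻¹ • P.tlog x
  let f : (E → L) → P.tspan E S := fun x =>
    if h : ∀ k, PowMem S (x k) then ⟨g x, Submodule.smul_mem _ _ (P.tlog_mem_tspan h)⟩ else 0
  have hf : ∀ x ∈ A, (f x : PiLp 1 (fun _ : E × ι => ℝ)) = g x := fun x hx => by
    simp only [f, dif_pos (hA x hx)]
  obtain ⟨t, h1, h2, h3⟩ := hC (P.tspan E S)
    ((P.finrank_tspan_le E S).trans (Nat.mul_le_mul hE hS)) _ f 1 one_pos A 0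
    (fun x hx => by
      rw [sub_zero]
      change ‖(f x : PiLp 1 (fun _ : E × ι => ℝ))‖ ≤ 1
      rw [hf x hx, norm_smul, norm_inv, norm_norm]
      exact inv_mul_le_one)
  refine ⟨t, h1, h2, fun x hx => ?_⟩
  obtain ⟨y, hy, hxy⟩ := h3 x hx
  refine ⟨y, hy, ?_⟩
  change ‖(f x : PiLp 1 (fun _ : E × ι => ℝ)) - f y‖ ≤ q * 1 at hxy
  rwa [hf x hx, hf y (h1 hy), mul_one] at hxy

end cone

section

variable {L : Type*} [Field L] {ι : Type*} [Fintype ι] (P : PlaceSystem L ι)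

lemma tdist_one_le_height {x y : L} (hx : P.IsU x) (hy : P.IsU y) :
    lnorm (P.lv x) + lnorm (P.lv y) ≤ 4 * P.height₂ x y := by
  have h1 : lnorm (P.lv x) ≤ 2 * P.height₂ x y :=
    lnorm_le_two_mul_of_le (P.sum_lv_eq_zero hx).ge
      (fun i => (le_max_left _ _).trans (le_max_left _ _)) fun i => le_max_right _ _
  have h2 : lnorm (P.lv y) ≤ 2 * P.height₂ x y :=
    lnorm_le_two_mul_of_le (P.sum_lv_eq_zero hy).ge
      (fun i => (le_max_right _ _).trans (le_max_left _ _)) fun i => le_max_right _ _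
  linarith

lemma norm_tlog_fin_three {x x' : Fin 3 → L} (hx : x 2 = 1) (hx' : x' 2 = 1) (c : ℝ) :
    ‖P.tlog x' - c • P.tlog x‖ = lnorm (P.lv (x' 0) - c • P.lv (x 0)) +
      lnorm (P.lv (x' 1) - c • P.lv (x 1)) := by
  rw [norm_tlog_sub_smul, Fin.sum_univ_three, hx, hx']; simp

variable [CharZero L]

lemma le_norm_tlog_sub_smul {x x' : Fin 3 → L} (hU : ∀ k, P.IsU (x k)) (hU' : ∀ k, P.IsU (x' k))
    (hx : x 2 = 1) (hx' : x' 2 = 1) (hs : x 0 + x 1 + 1 = 0) (hs' : x' 0 + x' 1 + 1 = 0)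
    (hD : 32 * P.D ≤ ‖P.tlog x‖) (M : ℕ)
    (hne : x 0 ^ (2 * M + 1) * padePoly M (x 1) 1 * x' 1 ≠
      x 1 ^ (2 * M + 1) * padePoly M 1 (x 0) * x' 0) :
    (M + 1) / 8 * ‖P.tlog x‖ ≤ ‖P.tlog x' - (2 * M + 1 : ℝ) • P.tlog x‖ := by
  have h1 := P.mul_height_le_of_ne (hU 0) (hU 1) (hU' 0) (hU' 1) hs hs' M hne
  have h2 := P.tdist_one_le_height (hU 0) (hU 1)
  have h3 := P.norm_tlog_fin_three hx hx' (2 * M + 1)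
  have h4 : ‖P.tlog x‖ = lnorm (P.lv (x 0)) + lnorm (P.lv (x 1)) := by
    have := P.norm_tlog_fin_three hx hx 0
    simpa using this
  push_cast at h1
  rw [← h3] at h1
  rw [← h4] at h2
  have hlog : Real.log 32 = 5 * Real.log 2 := by
    rw [show (32 : ℝ) = 2 ^ (5 : ℕ) by norm_num, Real.log_pow]; norm_num
  have hl2 := Real.log_two_lt_d9
  have hl2' := Real.log_pos one_lt_two
  have hM : (0 : ℝ) ≤ M := Nat.cast_nonneg M
  have h5 : M * Real.log 32 + Real.log 2 ≤ 4 * (M + 1) := by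
    rw [hlog]; nlinarith
  have h6 : P.D * (M * Real.log 32 + Real.log 2) ≤ P.D * (4 * (M + 1)) :=
    mul_le_mul_of_nonneg_left h5 P.D_pos.le
  have h7 : (M + 1 : ℝ) * ‖P.tlog x‖ ≤ (M + 1) * (4 * P.height₂ (x 0) (x 1)) := by gcongr
  have h8 : (M + 1 : ℝ) * (32 * P.D) ≤ (M + 1) * ‖P.tlog x‖ := by gcongr
  linarith

lemma norm_tlog_gap {x x' : Fin 3 → L} (hU : ∀ k, P.IsU (x k)) (hU' : ∀ k, P.IsU (x' k))
    (hx : x 2 = 1) (hx' : x' 2 = 1) (hs : x 0 + x 1 + 1 = 0) (hs' : x' 0 + x' 1 + 1 = 0)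
    (hD : 32 * P.D ≤ ‖P.tlog x‖) (hne : x ≠ x') :
    1 / 8 * ‖P.tlog x‖ ≤ ‖P.tlog x' - P.tlog x‖ := by
  have := P.le_norm_tlog_sub_smul hU hU' hx hx' hs hs' hD 0 (by
    simp only [padePoly, mul_zero, zero_add, pow_one, range_one, sum_singleton]
    simp only [pow_zero, Nat.zero_sub, Nat.choose_self, Nat.cast_one, mul_one]
    intro h
    apply hne
    have h0 : x 0 = x' 0 := by linear_combination x 0 * hs' - x' 0 * hs - h
    ext k
    fin_cases k
    · exact h0
    · change x 1 = x' 1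
      linear_combination hs - hs' - h0
    · exact hx.trans hx'.symm)
  simpa using this

lemma norm_tlog_lt_of_cone {x x' : Fin 3 → L} (hU : ∀ k, P.IsU (x k)) (hU' : ∀ k, P.IsU (x' k))
    (hx : x 2 = 1) (hx' : x' 2 = 1) (hs : x 0 + x 1 + 1 = 0) (hs' : x' 0 + x' 1 + 1 = 0)
    (hD : 32 * P.D ≤ ‖P.tlog x‖) (hD' : 32 * P.D ≤ ‖P.tlog x'‖)
    (hc : ‖‖P.tlog x'‖⁻¹ • P.tlog x' - ‖P.tlog x‖⁻¹ • P.tlog x‖ ≤ 1 / 48) :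
    ‖P.tlog x'‖ < 67 * ‖P.tlog x‖ := by
  by_contra! hlt
  have hN : 0 < ‖P.tlog x‖ := lt_of_lt_of_le (by linarith [P.D_pos]) hD
  have hN' : 0 < ‖P.tlog x'‖ := lt_of_lt_of_le (by linarith [P.D_pos]) hD'
  set l : ℝ := ‖P.tlog x'‖ / ‖P.tlog x‖ with hl
  have hl67 : 67 ≤ l := (le_div_iff₀ hN).2 hlt
  have hlN : l * ‖P.tlog x‖ = ‖P.tlog x'‖ := div_mul_cancel₀ _ hN.ne'
  have hdir : ‖P.tlog x' - l • P.tlog x‖ ≤ l * ‖P.tlog x‖ / 48 := by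
    have : P.tlog x' - l • P.tlog x =
        ‖P.tlog x'‖ • (‖P.tlog x'‖⁻¹ • P.tlog x' - ‖P.tlog x‖⁻¹ • P.tlog x) := by
      rw [smul_sub, smul_smul, smul_smul, mul_inv_cancel₀ hN'.ne', one_smul, hl, div_eq_mul_inv]
    rw [this, norm_smul, norm_norm, hlN]
    nlinarith
  have hq : x 0 ^ 2 + x 0 + 1 ≠ 0 := by
    intro h
    have h3 : x 0 ^ 3 = 1 := by linear_combination (x 0 - 1) * h
    have h3' : x 1 ^ 3 = 1 := by
      have : x 1 = -1 - x 0 := by linear_combination hs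
      rw [this]; linear_combination (-x 0 - 2) * h
    have hz : ∀ {w : L}, w ^ 3 = 1 → P.lv w = 0 := by
      intro w hw
      have := P.lv_pow w 3
      rw [hw, lv_one] at this
      exact (smul_eq_zero.1 this.symm).resolve_left (by norm_num)
    have := P.norm_tlog_fin_three hx hx 0
    rw [hz h3, hz h3'] at this
    simp at this
    rw [this] at hN
    simp at hN
  have hnp := (padePoly_add_eq_zero_and_nonprop (hU 0).1 (hU 1).1 hs).2 hq (x' 0) (x' 1) hs'
  set N : ℕ := ⌊(l - 1) / 2⌋₊ with hNdef
  have hf1 : (N : ℝ) ≤ (l - 1) / 2 := Nat.floor_le (by linarith)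
  have hf2 : (l - 1) / 2 < N + 1 := Nat.lt_floor_add_one _
  have key : ∀ M : ℕ, (33 : ℝ) ≤ M → |l - (2 * M + 1)| ≤ 2 →
      x 0 ^ (2 * M + 1) * padePoly M (x 1) 1 * x' 1 =
        x 1 ^ (2 * M + 1) * padePoly M 1 (x 0) * x' 0 := by
    intro M hM hlM
    by_contra hne
    have h1 := P.le_norm_tlog_sub_smul hU hU' hx hx' hs hs' hD M hne
    have h2 : ‖P.tlog x' - (2 * M + 1 : ℝ) • P.tlog x‖ ≤
        l * ‖P.tlog x‖ / 48 + 2 * ‖P.tlog x‖ := by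
      have : P.tlog x' - (2 * M + 1 : ℝ) • P.tlog x =
          (P.tlog x' - l • P.tlog x) + (l - (2 * M + 1)) • P.tlog x := by
        rw [sub_smul]; abel
      rw [this]
      refine (norm_add_le _ _).trans (add_le_add hdir ?_)
      rw [norm_smul, Real.norm_eq_abs]
      gcongr
    have h3 := (abs_le.1 hlM).2
    have h4 : l * ‖P.tlog x‖ ≤ (2 * M + 3) * ‖P.tlog x‖ := by
      gcongr; linarith
    have h5 : (33 : ℝ) * ‖P.tlog x‖ ≤ M * ‖P.tlog x‖ := by gcongr
    linarith
  refine hnp N ⟨key N ?_ ?_, key (N + 1) ?_ ?_⟩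
  · have : (33 : ℕ) ≤ N := Nat.le_floor (by push_cast; linarith)
    exact_mod_cast this
  · rw [abs_le]; constructor <;> linarith
  · have : (33 : ℕ) ≤ N := Nat.le_floor (by push_cast; linarith)
    exact_mod_cast this.trans (Nat.le_succ N)
  · push_cast
    rw [abs_le]; constructor <;> linarith

end

end PlaceSystem

section sumZero

variable (L : Type*) [Field L] (E : Type*) [Fintype E]

/-- The space of tuples with vanishing sum. -/
def sumZero : Submodule L (E → L) where
  carrier := {x | ∑ k, x k = 0}
  add_mem' := fun {x y} hx hy => by
    simp only [Set.mem_ofPred_eq, Pi.add_apply, sum_add_distrib] at *; rw [hx, hy, add_zero]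
  zero_mem' := by simp
  smul_mem' := fun c x hx => by
    simp only [Set.mem_ofPred_eq, Pi.smul_apply, smul_eq_mul, ← mul_sum] at *; rw [hx, mul_zero]

variable {L E}

lemma mem_sumZero {x : E → L} : x ∈ sumZero L E ↔ ∑ k, x k = 0 := Iff.rfl

lemma finrank_sumZero [Nonempty E] : Module.finrank L (sumZero L E) + 1 = Fintype.card E := by
  classical
  let φ : (E → L) →ₗ[L] L := ∑ k, LinearMap.proj k
  have hφ : ∀ x, φ x = ∑ k, x k := fun x => by simp [φ, LinearMap.sum_apply]
  have h1 : sumZero L E = LinearMap.ker φ := by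
    ext x; rw [LinearMap.mem_ker, hφ]; rfl
  have h2 : LinearMap.range φ = ⊤ := by
    rw [LinearMap.range_eq_top]
    intro c
    exact ⟨Pi.single (Classical.arbitrary E) c, by rw [hφ]; simp⟩
  have h3 := φ.finrank_range_add_finrank_ker
  rw [h2, finrank_top, Module.finrank_self, ← h1, Module.finrank_fintype_fun_eq_card] at h3
  omega

lemma conn_sumZero [DecidableEq E] : Conn (sumZero L E) := by
  intro I hI hI'
  obtain ⟨i, hi⟩ := hI
  obtain ⟨j, hj⟩ : ∃ j, j ∉ I := by
    by_contra! h; exact hI' (eq_univ_iff_forall.2 h)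
  have hij : j ≠ i := fun h => hj (h ▸ hi)
  refine ⟨Pi.single i 1 - Pi.single j 1, ?_, ?_⟩
  · rw [mem_sumZero]; simp
  · rw [mem_sumZero]
    have : (fun k => if k ∈ I then (Pi.single i 1 - Pi.single j 1 : E → L) k else 0) =
        Pi.single i 1 := by
      ext k
      by_cases hk : k = i
      · subst hk; simp [hi, hij.symm]
      · by_cases hk' : k ∈ I
        · have : k ≠ j := fun h => hj (h ▸ hk')
          simp [hk', hk, this]
        · simp [hk', hk]
    rw [this]; simp

omit [Fintype E] in
lemma eq_of_finrank_le_one [Finite E] {V : Submodule L (E → L)} (hV : Module.finrank L V ≤ 1)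
    {x y : E → L} (hx : x ∈ V) (hy : y ∈ V) {i : E} (h : x i = y i) (h0 : x i ≠ 0) : x = y := by
  obtain ⟨v, hv⟩ := finrank_le_one_iff.1 hV
  obtain ⟨c, hc⟩ := hv ⟨x, hx⟩
  obtain ⟨c', hc'⟩ := hv ⟨y, hy⟩
  have e1 : x = c • (v : E → L) := congrArg Subtype.val hc.symm
  have e2 : y = c' • (v : E → L) := congrArg Subtype.val hc'.symm
  rw [e1] at h0
  rw [e1, e2, Pi.smul_apply, Pi.smul_apply, smul_eq_mul, smul_eq_mul] at h
  rw [e1, e2, mul_right_cancel₀ (right_ne_zero_of_mul h0) h]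

end sumZero

namespace PlaceSystem

lemma exists_card_large_le (ρ : ℕ) : ∃ C : ℕ, ∀ (L : Type*) [Field L] [CharZero L]
    (ι : Type*) [Fintype ι] (P : PlaceSystem L ι) (S : Finset Lˣ) (_ : S.card ≤ ρ)
    (A : Finset (Fin 3 → L)) (_ : ∀ x ∈ A, ∀ k, PowMem S (x k)) (_ : ∀ x ∈ A, ∀ k, P.IsU (x k))
    (_ : ∀ x ∈ A, x 2 = 1) (_ : ∀ x ∈ A, x 0 + x 1 + 1 = 0)
    (_ : ∀ x ∈ A, 32 * P.D ≤ ‖P.tlog x‖), A.card ≤ C := by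
  classical
  obtain ⟨C₁, hC₁⟩ := exists_cone_cover 3 ρ (1 / 96) (by norm_num)
  obtain ⟨C₂, hC₂⟩ := exists_tuple_cover 3 ρ (1 / 4000) (by norm_num)
  refine ⟨C₁ * (C₂ * 1), fun L _ _ ι _ P S hS A hA hU h2 hs hD => ?_⟩
  obtain ⟨t, _, htc, hcov⟩ := hC₁ L ι P S hS (Fin 3) (by simp) A hA
  refine (card_le_mul_of_cover A t _ (C₂ * 1) hcov ?_).trans (Nat.mul_le_mul_right _ htc)
  intro y _ B hBA hB
  rcases B.eq_empty_or_nonempty with rfl | hne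
  · simp
  obtain ⟨z, hz, hmin⟩ := B.exists_min_image (fun x => ‖P.tlog x‖) hne
  have hz0 : 0 < ‖P.tlog z‖ := lt_of_lt_of_le (by linarith [P.D_pos]) (hD z (hBA hz))
  have hle : ∀ x ∈ B, ‖P.tlog x‖ ≤ 67 * ‖P.tlog z‖ := by
    intro x hx
    refine (P.norm_tlog_lt_of_cone (hU z (hBA hz)) (hU x (hBA hx)) (h2 z (hBA hz)) (h2 x (hBA hx))
      (hs z (hBA hz)) (hs x (hBA hx)) (hD z (hBA hz)) (hD x (hBA hx)) ?_).le
    have e1 := hB x hx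
    have e2 := hB z hz
    rw [norm_sub_rev] at e2
    have := norm_sub_le_norm_sub_add_norm_sub (‖P.tlog x‖⁻¹ • P.tlog x) (‖P.tlog y‖⁻¹ • P.tlog y)
      (‖P.tlog z‖⁻¹ • P.tlog z)
    linarith
  obtain ⟨s, _, hsc, hcov'⟩ := hC₂ L ι P S hS (Fin 3) (by simp) B (fun x hx => hA x (hBA hx))
    (134 * ‖P.tlog z‖) (by positivity) (fun x hx x' hx' => by
      rw [← norm_tlog_sub]
      refine (norm_sub_le _ _).trans ?_
      linarith [hle x hx, hle x' hx'])
  refine (card_le_mul_of_cover B s _ 1 hcov' ?_).trans (Nat.mul_le_mul_right _ hsc)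
  intro w _ B' hB' hw
  rw [card_le_one]
  intro x hx x' hx'
  by_contra hxx
  have hxB := hB' hx
  have hxB' := hB' hx'
  have e1 := P.norm_tlog_gap (hU x (hBA hxB)) (hU x' (hBA hxB')) (h2 x (hBA hxB))
    (h2 x' (hBA hxB')) (hs x (hBA hxB)) (hs x' (hBA hxB')) (hD x (hBA hxB)) hxx
  have e2 := hmin x hxB
  have e3 := P.tdist_triangle x' w x
  rw [norm_tlog_sub] at e1
  have e4 := hw x hx
  have e5 := hw x' hx'
  rw [tdist_comm] at e4
  linarith

lemma exists_card_small_le (ρ : ℕ) : ∃ C : ℕ, ∀ (L : Type*) [Field L]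
    (ι : Type*) [Fintype ι] (P : PlaceSystem L ι) (S : Finset Lˣ) (_ : S.card ≤ ρ)
    (A : Finset (Fin 3 → L)) (_ : ∀ x ∈ A, ∀ k, PowMem S (x k)) (_ : ∀ x ∈ A, ∀ k, P.IsU (x k))
    (_ : ∀ x ∈ A, x 2 = 1) (_ : ∀ x ∈ A, x 0 + x 1 + 1 = 0)
    (_ : ∀ x ∈ A, ‖P.tlog x‖ ≤ 32 * P.D), A.card ≤ C := by
  classical
  obtain ⟨δ, hδ, C₁, hC₁⟩ := exists_tiny_cell_cover 3
  obtain ⟨C₂, hC₂⟩ := exists_tuple_cover 3 ρ (δ / 64) (by positivity)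
  refine ⟨C₂ * (C₁ * 1), fun L _ ι _ P S hS A hA hU h2 hs hD => ?_⟩
  obtain ⟨t, _, htc, hcov⟩ := hC₂ L ι P S hS (Fin 3) (by simp) A hA (64 * P.D)
    (mul_pos (by norm_num) P.D_pos) (fun x hx x' hx' => by
      rw [← norm_tlog_sub]
      refine (norm_sub_le _ _).trans ?_
      linarith [hD x hx, hD x' hx'])
  refine (card_le_mul_of_cover A t _ (C₁ * 1) hcov ?_).trans (Nat.mul_le_mul_right _ htc)
  intro y _ B hBA hB
  have hrank : Module.finrank L (sumZero L (Fin 3)) = 2 := by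
    have := finrank_sumZero (L := L) (E := Fin 3)
    simpa using this
  obtain ⟨T, hTc, hTV, hT⟩ := hC₁ L ι P (Fin 3) (by simp) (sumZero L (Fin 3)) conn_sumZero hrank.ge
    (B : Set (Fin 3 → L)) (fun x hx => by
      rw [mem_sumZero, Fin.sum_univ_three, h2 x (hBA hx)]; exact hs x (hBA hx))
    (fun x hx => hU x (hBA hx)) y (fun x hx => (hB x hx).trans (by linarith))
  refine (card_le_mul_of_cover B T (fun x V => x ∈ V) 1 hT ?_).trans (Nat.mul_le_mul_right _ hTc)
  intro V hV B' hB' hw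
  rw [card_le_one]
  intro x hx x' hx'
  have hVr : Module.finrank L V < 2 := hrank ▸ Submodule.finrank_lt_finrank_of_lt (hTV V hV)
  have e1 := h2 x (hBA (hB' hx))
  have e2 := h2 x' (hBA (hB' hx'))
  exact eq_of_finrank_le_one (by omega) (hw x hx) (hw x' hx') (e1.trans e2.symm)
    (by rw [e1]; exact one_ne_zero)

end PlaceSystem

/-- The unit equation `x + y + 1 = 0` has boundedly many solutions in a group of bounded rank. -/
lemma exists_card_unit_le (ρ : ℕ) : ∃ C : ℕ, ∀ (L : Type u) [Field L] [NumberField L]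
    (S : Finset Lˣ) (_ : S.card ≤ ρ) (A : Finset (Fin 3 → L)) (_ : ∀ x ∈ A, ∀ k, PowMem S (x k))
    (_ : ∀ x ∈ A, x 2 = 1) (_ : ∀ x ∈ A, x 0 + x 1 + 1 = 0), A.card ≤ C := by
  classical
  obtain ⟨C₁, hC₁⟩ := PlaceSystem.exists_card_large_le.{u, u} ρ
  obtain ⟨C₂, hC₂⟩ := PlaceSystem.exists_card_small_le.{u, u} ρ
  refine ⟨C₁ + C₂, fun L _ _ S hS A hA h2 hs => ?_⟩
  obtain ⟨ι, _, P, hP⟩ := exists_placeSystem L (A.biUnion fun x => univ.image x) (by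
    intro b hb
    obtain ⟨x, hx, hb⟩ := mem_biUnion.1 hb
    obtain ⟨k, _, rfl⟩ := mem_image.1 hb
    obtain ⟨u, hu, _⟩ := hA x hx k
    rw [← hu]; exact u.ne_zero)
  have hU : ∀ x ∈ A, ∀ k, P.IsU (x k) := fun x hx k =>
    hP _ (mem_biUnion.2 ⟨x, hx, mem_image_of_mem _ (mem_univ k)⟩)
  have hsub := filter_subset (fun x => 32 * P.D ≤ ‖P.tlog x‖) A
  have hsub' := filter_subset (fun x => ¬ 32 * P.D ≤ ‖P.tlog x‖) A
  rw [← card_filter_add_card_filter_not (fun x => 32 * P.D ≤ ‖P.tlog x‖)]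
  refine add_le_add
    (hC₁ L ι P S hS _ (fun x hx => hA x (hsub hx)) (fun x hx => hU x (hsub hx))
      (fun x hx => h2 x (hsub hx)) (fun x hx => hs x (hsub hx)) fun x hx => (mem_filter.1 hx).2)
    (hC₂ L ι P S hS _ (fun x hx => hA x (hsub' hx)) (fun x hx => hU x (hsub' hx))
      (fun x hx => h2 x (hsub' hx)) (fun x hx => hs x (hsub' hx))
      fun x hx => (not_le.1 (mem_filter.1 hx).2).le)

section PowMem

variable {L : Type*} [Field L] {S S' : Finset Lˣ} {a b : L}

lemma PowMem.ne_zero (h : PowMem S a) : a ≠ 0 := by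
  obtain ⟨u, rfl, _⟩ := h
  exact u.ne_zero

lemma PowMem.mono (h : PowMem S a) (hS : S ⊆ S') : PowMem S' a := by
  obtain ⟨u, rfl, k, hk, hu⟩ := h
  exact ⟨u, rfl, k, hk, Subgroup.closure_mono (by exact_mod_cast hS) hu⟩

lemma PowMem.mul (ha : PowMem S a) (hb : PowMem S b) : PowMem S (a * b) := by
  obtain ⟨u, rfl, k, hk, hu⟩ := ha
  obtain ⟨w, rfl, l, hl, hw⟩ := hb
  refine ⟨u * w, rfl, k * l, by positivity, ?_⟩
  rw [mul_pow, pow_mul u k l, mul_comm k l, pow_mul w l k]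
  exact mul_mem (pow_mem hu _) (pow_mem hw _)

lemma powMem_of_mem {u : Lˣ} (hu : u ∈ S) : PowMem S (u : L) :=
  ⟨u, rfl, 1, one_pos, by rw [pow_one]; exact Subgroup.subset_closure hu⟩

lemma powMem_one : PowMem S (1 : L) := ⟨1, rfl, 1, one_pos, by simp⟩

end PowMem

lemma exists_card_value_le (ρ : ℕ) : ∃ C : ℕ, ∀ (L : Type u) [Field L] [NumberField L]
    (S : Finset Lˣ) (_ : S.card ≤ ρ) (a b c : L) (_ : a ≠ 0) (_ : b ≠ 0) (_ : c ≠ 0)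
    (Y : Finset L) (_ : ∀ y ∈ Y, PowMem S y ∧ ∃ z, PowMem S z ∧ a + b * y + c * z = 0),
    Y.card ≤ C := by
  classical
  obtain ⟨C, hC⟩ := exists_card_unit_le.{u} (ρ + 2)
  refine ⟨C, fun L _ _ S hS a b c ha hb hc Y hY => ?_⟩
  choose! hY1 z hz hsum using hY
  let S' := insert (Units.mk0 (b / a) (div_ne_zero hb ha))
    (insert (Units.mk0 (c / a) (div_ne_zero hc ha)) S)
  have hS' : S'.card ≤ ρ + 2 :=
    (card_insert_le _ _).trans (by linarith [card_insert_le (Units.mk0 (c / a) (div_ne_zero hc ha)) S])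
  have hSS' : S ⊆ S' := (subset_insert _ _).trans (subset_insert _ _)
  let f : L → Fin 3 → L := fun y => ![b / a * y, c / a * z y, 1]
  have hf : Function.Injective f := fun y y' h => by
    have := congrFun h 0
    simp only [f, Matrix.cons_val_zero] at this
    exact mul_left_cancel₀ (div_ne_zero hb ha) this
  rw [← card_image_of_injective Y hf]
  refine hC L S' hS' _ ?_ ?_ ?_
  · intro x hx k
    obtain ⟨y, hy, rfl⟩ := mem_image.1 hx
    fin_cases k
    · exact (powMem_of_mem (mem_insert_self _ _) : PowMem S' (b / a)).mul ((hY1 y hy).mono hSS')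
    · exact (powMem_of_mem (mem_insert_of_mem (mem_insert_self _ _)) : PowMem S' (c / a)).mul
        ((hz y hy).mono hSS')
    · exact powMem_one
  · intro x hx
    obtain ⟨y, hy, rfl⟩ := mem_image.1 hx
    rfl
  · intro x hx
    obtain ⟨y, hy, rfl⟩ := mem_image.1 hx
    have := hsum y hy
    simp only [f, Matrix.cons_val_zero, Matrix.cons_val_one]
    field_simp
    linear_combination this

section Par

variable {L : Type*} [Field L] {E : Type*}

/-- Proportionality of two coordinates on a subspace. -/
def Par (W : Submodule L (E → L)) (j k : E) : Prop := ∃ a : L, ∀ w ∈ W, w j = a * w k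

lemma inf_ratioSubmodule_lt {W : Submodule L (E → L)} {z i₀ : E} {b s : L} (hb : b ≠ 0)
    (h : ¬ Par W z i₀) : W ⊓ ratioSubmodule b s z i₀ < W := by
  refine lt_of_le_of_ne inf_le_left fun heq => h ⟨s / b, fun w hw => ?_⟩
  have := mem_ratioSubmodule.1 (inf_eq_left.1 heq hw)
  field_simp
  linear_combination this

lemma exists_relation [Finite E] {W V : Submodule L (E → L)} (hV : V < W) {z z' i₀ : E}
    {b s s' : L} (hb : b ≠ 0) (hz : ¬ Par W z i₀) (hz' : ¬ Par W z' i₀) (hzz' : ¬ Par W z z')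
    (h : ¬ Module.finrank L (V ⊓ ratioSubmodule b s z i₀ : Submodule L (E → L)) + 2 ≤
      Module.finrank L W)
    (h' : ¬ Module.finrank L (V ⊓ ratioSubmodule b s' z' i₀ : Submodule L (E → L)) + 2 ≤
      Module.finrank L W) :
    ∃ α β γ : L, α ≠ 0 ∧ β ≠ 0 ∧ γ ≠ 0 ∧ ∀ w ∈ W, α * w i₀ + β * w z + γ * w z' = 0 := by
  have hVr := Submodule.finrank_lt_finrank_of_lt hV
  have key : ∀ {z : E} {s : L}, ¬ Par W z i₀ →
      ¬ Module.finrank L (V ⊓ ratioSubmodule b s z i₀ : Submodule L (E → L)) + 2 ≤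
        Module.finrank L W → V = W ⊓ ratioSubmodule b s z i₀ := by
    intro z s hz h
    have h1 := Submodule.finrank_lt_finrank_of_lt (inf_ratioSubmodule_lt (s := s) hb hz)
    have h2 : V ⊓ ratioSubmodule b s z i₀ = V :=
      Submodule.eq_of_le_of_finrank_le inf_le_left (by omega)
    refine Submodule.eq_of_le_of_finrank_le (le_inf hV.le (inf_eq_left.1 h2)) ?_
    rw [h2] at h
    omega
  have e1 := key hz h
  have e2 := key hz' h'
  obtain ⟨v, hvW, hv⟩ : ∃ v ∈ W, v ∉ V := SetLike.exists_of_lt hV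
  have hφ : b * v z - s * v i₀ ≠ 0 := fun h0 => hv (by
    rw [e1]; exact ⟨hvW, mem_ratioSubmodule.2 (sub_eq_zero.1 h0)⟩)
  have hφ' : b * v z' - s' * v i₀ ≠ 0 := fun h0 => hv (by
    rw [e2]; exact ⟨hvW, mem_ratioSubmodule.2 (sub_eq_zero.1 h0)⟩)
  have hrel : ∀ w ∈ W, (b * v z - s * v i₀) * (b * w z' - s' * w i₀) =
      (b * w z - s * w i₀) * (b * v z' - s' * v i₀) := by
    intro w hw
    have h1 : (b * v z - s * v i₀) • w - (b * w z - s * w i₀) • v ∈ V := by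
      rw [e1]
      refine ⟨sub_mem (W.smul_mem _ hw) (W.smul_mem _ hvW), mem_ratioSubmodule.2 ?_⟩
      simp only [Pi.sub_apply, Pi.smul_apply, smul_eq_mul]
      ring
    rw [e2] at h1
    have h2 := mem_ratioSubmodule.1 h1.2
    simp only [Pi.sub_apply, Pi.smul_apply, smul_eq_mul] at h2
    linear_combination h2
  refine ⟨(b * v z - s * v i₀) * s' - (b * v z' - s' * v i₀) * s, (b * v z' - s' * v i₀) * b,
    -((b * v z - s * v i₀) * b), fun h0 => hzz' ⟨(b * v z - s * v i₀) / (b * v z' - s' * v i₀),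
      fun w hw => ?_⟩, mul_ne_zero hφ' hb, neg_ne_zero.2 (mul_ne_zero hφ hb), fun w hw => ?_⟩
  · have h1 := hrel w hw
    rw [div_mul_eq_mul_div, eq_div_iff hφ']
    apply mul_left_cancel₀ hb
    linear_combination -h1 - w i₀ * h0
  · linear_combination -hrel w hw

end Par

namespace PlaceSystem

variable {L : Type*} [Field L] {ι : Type*} [Fintype ι] (P : PlaceSystem L ι)
variable {E : Type*} [Fintype E] [DecidableEq E]

omit [Fintype ι] in
lemma exists_frame_not_par {W : Submodule L (E → L)} (hW : Conn W)
    (hd : 2 ≤ Module.finrank L W) (z : E) :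
    ∃ J u, IsFrame W J u ∧ ∀ k ∈ J, ¬ Par W k z := by
  classical
  let I : Finset E := univ.filter fun k => Par W k z
  have hI : I.Nonempty := ⟨z, mem_filter.2 ⟨mem_univ _, 1, fun w _ => (one_mul _).symm⟩⟩
  have hpar : ∀ {w v : E → L}, w ∈ W → v ∈ W → w z ≠ 0 → ∀ k ∈ I, v k = v z / w z * w k := by
    intro w v hw hv h0 k hk
    obtain ⟨a, ha⟩ := (mem_filter.1 hk).2
    rw [ha w hw, ha v hv]
    field_simp
  have hzero : ∀ {w : E → L}, w ∈ W → w z = 0 → ∀ k ∈ I, w k = 0 := by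
    intro w hw h0 k hk
    obtain ⟨a, ha⟩ := (mem_filter.1 hk).2
    rw [ha w hw, h0, mul_zero]
  have hI' : I ≠ univ := by
    intro huniv
    have : Module.finrank L W ≤ 1 := by
      by_cases hex : ∃ w ∈ W, w z ≠ 0
      · obtain ⟨w, hw, h0⟩ := hex
        refine finrank_le_one (⟨w, hw⟩ : W) fun v => ⟨(v : E → L) z / w z, ?_⟩
        ext k
        exact (hpar hw v.2 h0 k (huniv ▸ mem_univ k)).symm
      · push Not at hex
        refine finrank_le_one (0 : W) fun v => ⟨0, ?_⟩
        ext k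
        rw [smul_zero]
        exact (hzero v.2 (hex v v.2) k (huniv ▸ mem_univ k)).symm
    omega
  obtain ⟨v, hv, hv'⟩ := hW I hI hI'
  obtain ⟨J, hJ, u, h⟩ := exists_isFrame W Iᶜ (by
    intro w hw h0
    have h0' : w z = 0 := by
      by_contra hz
      apply hv'
      have : (fun k => if k ∈ I then v k else 0) = (v z / w z) • w := by
        ext k
        by_cases hk : k ∈ I
        · rw [if_pos hk, Pi.smul_apply, smul_eq_mul]; exact hpar hw hv hz k hk
        · rw [if_neg hk, Pi.smul_apply, h0 k (mem_compl.2 hk), smul_zero]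
      rw [this]
      exact W.smul_mem _ hw
    ext k
    by_cases hk : k ∈ I
    · exact hzero hw h0' k hk
    · exact h0 k (mem_compl.2 hk))
  exact ⟨J, u, h, fun k hk hp => mem_compl.1 (hJ hk) (mem_filter.2 ⟨mem_univ _, hp⟩)⟩

/-- A solution which is far from a spanning cluster deviates from it in two coordinates which are
not proportional. -/
lemma exists_not_par {n : ℕ} (hE : Fintype.card E ≤ n) {W : Submodule L (E → L)} (hW : Conn W)
    (hd : 2 ≤ Module.finrank L W) {S : Set (E → L)} (hS : Submodule.span L S = W)
    (hSU : ∀ x ∈ S, ∀ m, P.IsU (x m)) {c : E → L} (hc : ∀ m, P.IsU (c m)) {r : ℝ} (hr : 0 ≤ r)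
    (hSc : ∀ x ∈ S, P.tdist x c ≤ r) {x : E → L} (hx : x ∈ W) (hxU : ∀ m, P.IsU (x m)) {z : E}
    {T : ℝ} (hz : T / n ≤ lnorm (P.lv (x z) - P.lv (c z)))
    (hT : 3 * n * (n * (4 * (n * r + P.D * Real.log n.factorial)) + P.D * Real.log n) < T) :
    ∃ z', ¬ Par W z' z ∧ T / (6 * n ^ 2) ≤ lnorm (P.lv (x z') - P.lv (c z')) := by
  classical
  by_contra! hcon
  obtain ⟨J, u, h, hJ⟩ := exists_frame_not_par hW hd z
  set β := 4 * (n * r + P.D * Real.log n.factorial) with hβ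
  have hn : 0 < n := (Fintype.card_pos_iff.2 ⟨z⟩).trans_le hE
  have hn' : (1 : ℝ) ≤ n := by exact_mod_cast hn
  have hD := P.D_pos
  have hβ0 : 0 ≤ β := by
    have : 0 ≤ Real.log n.factorial := Real.log_natCast_nonneg _
    positivity
  have hlogn : 0 ≤ Real.log n := Real.log_natCast_nonneg _
  have hT0 : 0 < T := lt_of_le_of_lt (by positivity) hT
  let e : E → ι → ℝ := fun k => P.lv (x k * u k z) - P.lv (c z)
  let J' := J.filter fun k => u k z ≠ 0
  have he : ∀ k ∈ J', lnorm (e k) ≤ T / (6 * n ^ 2) + β := by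
    intro k hk
    obtain ⟨hkJ, hku⟩ := mem_filter.1 hk
    have h1 := (hcon k (hJ k hkJ)).le
    have h2 := P.lnorm_lv_frame_sub_le hE h hS hSU hc hr hSc hkJ hku
    have : e k = (P.lv (x k) - P.lv (c k)) + (P.lv (u k z) - (P.lv (c z) - P.lv (c k))) := by
      simp only [e]
      rw [P.lv_mul (hxU k).1 hku]; abel
    rw [this]
    exact (lnorm_add_le _ _).trans (add_le_add h1 h2)
  have hxz : x z = ∑ k ∈ J, x k * u k z := h.apply_eq hx z
  have hcardJ : (J.card : ℝ) ≤ n := by exact_mod_cast (card_le_univ J).trans hE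
  have hJ0 : 0 < J.card := by
    refine card_pos.2 (nonempty_of_sum_ne_zero (f := fun k => x k * u k z) ?_)
    rw [← hxz]; exact (hxU z).1
  have hle : ∀ i, (P.lv (x z) - P.lv (c z)) i ≤ ∑ k ∈ J', |e k i| + P.wt i * Real.log n := by
    intro i
    have h1 := P.lv_sum_le J (fun k => x k * u k z) i (P.lv (c z) i + ∑ k ∈ J', |e k i|) (by
      intro k hk h0
      have hk' : k ∈ J' := mem_filter.2 ⟨hk, right_ne_zero_of_mul h0⟩
      have h2 := single_le_sum (f := fun k => |e k i|) (fun k _ => abs_nonneg _) hk'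
      have h3 := le_abs_self (e k i)
      have h4 : e k i = P.lv (x k * u k z) i - P.lv (c z) i := rfl
      linarith) (by rw [← hxz]; exact (hxU z).1)
    rw [← hxz] at h1
    have h2 : P.wt i * Real.log J.card ≤ P.wt i * Real.log n :=
      mul_le_mul_of_nonneg_left (Real.log_le_log (by exact_mod_cast hJ0) hcardJ) (P.wt_nonneg i)
    rw [Pi.sub_apply]
    linarith
  have hsum0 : 0 ≤ ∑ i, (P.lv (x z) - P.lv (c z)) i := by
    have : ∑ i, (P.lv (x z) i - P.lv (c z) i) = 0 := by
      rw [sum_sub_distrib, P.sum_lv_eq_zero (hxU z), P.sum_lv_eq_zero (hc z), sub_zero]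
    exact this.ge
  have hmain := lnorm_le_two_mul_of_le hsum0 hle (fun i => add_nonneg (sum_nonneg fun _ _ => abs_nonneg _)
      (mul_nonneg (P.wt_nonneg i) hlogn))
  rw [sum_add_distrib, P.sum_wt_mul, sum_comm] at hmain
  have hsum : ∑ k ∈ J', ∑ i, |e k i| ≤ n * (T / (6 * n ^ 2) + β) := by
    refine (sum_le_sum he).trans ?_
    rw [sum_const, nsmul_eq_mul]
    gcongr
    exact (card_filter_le J _).trans ((card_le_univ J).trans hE)
  have h1 : T / n ≤ 2 * (n * (T / (6 * n ^ 2) + β) + P.D * Real.log n) := by linarith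
  have h2 : T ≤ n * (2 * (n * (T / (6 * n ^ 2) + β) + P.D * Real.log n)) := by
    rw [div_le_iff₀ (by positivity)] at h1
    linarith
  have h3 : (n : ℝ) * (2 * (n * (T / (6 * n ^ 2) + β) + P.D * Real.log n)) =
      T / 3 + 2 / 3 * (3 * n * (n * β + P.D * Real.log n)) := by
    field_simp; ring
  linarith

end PlaceSystem

namespace PlaceSystem

/-- Solutions at distance comparable to the minimal radius of a spanning cluster. -/
lemma exists_card_near_le (n ρ : ℕ) (K : ℝ) (hK : 0 < K) : ∃ C : ℕ, ∀ (L : Type*) [Field L]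
    (ι : Type*) [Fintype ι] (P : PlaceSystem L ι) (S : Finset Lˣ) (_ : S.card ≤ ρ)
    (E : Type*) [Fintype E] [DecidableEq E] (_ : Fintype.card E ≤ n) (W : Submodule L (E → L))
    (_ : Conn W) (_ : 2 ≤ Module.finrank L W) (X : Finset (E → L)) (_ : ∀ x ∈ X, x ∈ W)
    (_ : ∀ x ∈ X, ∀ k, PowMem S (x k)) (_ : ∀ x ∈ X, ∀ k, P.IsU (x k)) (M : ℕ)
    (_ : ∀ V < W, ∀ X' ⊆ X, (∀ x ∈ X', x ∈ V) → X'.card ≤ M) (r : ℝ) (_ : 0 ≤ r)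
    (_ : ∀ y ∈ X, ∀ s, Submodule.span L {x | x ∈ X ∧ P.tdist x y ≤ s} = W → r ≤ s)
    (c : E → L) (X' : Finset (E → L)) (_ : X' ⊆ X) (_ : ∀ x ∈ X', P.tdist x c ≤ K * (r + P.D)),
    X'.card ≤ C * M := by
  classical
  obtain ⟨δ, hδ, C₁, hC₁⟩ := exists_tiny_cell_cover n
  set κ := min (1 / 2) (δ / 2) with hκ
  have hκ0 : 0 < κ := lt_min (by norm_num) (by positivity)
  have hκ1 : κ ≤ 1 / 2 := min_le_left _ _
  have hκ2 : κ ≤ δ / 2 := min_le_right _ _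
  obtain ⟨C₂, hC₂⟩ := exists_tuple_cover n ρ (κ / (2 * K)) (by positivity)
  refine ⟨C₂ * (C₁ + 1), fun L _ ι _ P S hS E _ _ hE W hW hd X hXW hX hXU M hM r hr hmin c X' hX'
    hc => ?_⟩
  have hD := P.D_pos
  obtain ⟨t, htX, htc, hcov⟩ := hC₂ L ι P S hS E hE X' (fun x hx => hX x (hX' hx))
    (2 * K * (r + P.D)) (by positivity) (fun x hx y hy => by
      have h1 := P.tdist_triangle x c y
      have h2 := hc x hx
      have h3 := hc y hy
      rw [tdist_comm] at h3
      linarith)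
  rw [mul_assoc]
  refine (card_le_mul_of_cover X' t _ ((C₁ + 1) * M) hcov ?_).trans (Nat.mul_le_mul_right _ htc)
  intro y hy B hBX hB
  have hB' : ∀ x ∈ B, P.tdist x y ≤ κ * (r + P.D) := fun x hx => (hB x hx).trans (by
    apply le_of_eq; field_simp)
  by_cases hspan : Submodule.span L (B : Set (E → L)) = W
  · have h1 : r ≤ κ * (r + P.D) := by
      refine hmin y (hX' (htX hy)) _ (le_antisymm (Submodule.span_le.2 fun x hx => hXW x hx.1) ?_)
      rw [← hspan]
      exact Submodule.span_mono fun x hx => ⟨hX' (hBX hx), hB' x hx⟩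
    have h2 : κ * (r + P.D) ≤ δ * P.D := by nlinarith
    obtain ⟨T, hTc, hTV, hT⟩ := hC₁ L ι P E hE W hW hd B (fun x hx => hXW x (hX' (hBX hx)))
      (fun x hx => hXU x (hX' (hBX hx))) y (fun x hx => (hB' x hx).trans h2)
    refine (card_le_mul_of_cover B T (fun x V => x ∈ V) M hT fun V hV Y hY h => ?_).trans
      (Nat.mul_le_mul_right _ (hTc.trans C₁.le_succ))
    exact hM V (hTV V hV) Y (hY.trans (hBX.trans hX')) h
  · refine (hM (Submodule.span L B) (lt_of_le_of_ne (Submodule.span_le.2 fun x hx =>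
      hXW x (hX' (hBX hx))) hspan) B (hBX.trans hX') fun x hx => Submodule.subset_span hx).trans ?_
    exact Nat.le_mul_of_pos_left _ C₁.succ_pos

lemma exists_le_lnorm_lv_sub {L : Type*} [Field L] {ι : Type*} [Fintype ι] (P : PlaceSystem L ι)
    {E : Type*} [Fintype E] [Nonempty E] {n : ℕ} (hE : Fintype.card E ≤ n) (x c : E → L) :
    ∃ z, P.tdist x c / n ≤ lnorm (P.lv (x z) - P.lv (c z)) := by
  have hn : 0 < n := Fintype.card_pos.trans_le hE
  by_contra! h
  have h1 : P.tdist x c < ∑ _k : E, P.tdist x c / n := sum_lt_sum_of_nonempty univ_nonempty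
    fun k _ => h k
  rw [sum_const, nsmul_eq_mul, card_univ] at h1
  have h2 : (Fintype.card E : ℝ) * (P.tdist x c / n) ≤ n * (P.tdist x c / n) := by
    have := P.tdist_nonneg x c
    gcongr
  rw [mul_div_cancel₀ _ (by positivity)] at h2
  linarith

/-- Solutions far away from a spanning cluster. -/
lemma exists_card_far_le (n ρ : ℕ) (hn : 0 < n) : ∃ K : ℝ, 0 < K ∧ ∃ C : ℕ, ∀ (L : Type*) [Field L]
    (ι : Type*) [Fintype ι] (P : PlaceSystem L ι) (S : Finset Lˣ) (_ : S.card ≤ ρ)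
    (E : Type*) [Fintype E] [DecidableEq E] (_ : Fintype.card E ≤ n) (W : Submodule L (E → L))
    (_ : Conn W) (_ : 2 ≤ Module.finrank L W) (B : Finset L) (i₀ : E) (b₀ : L) (_ : b₀ ≠ 0)
    (X : Finset (E → L)) (_ : ∀ x ∈ X, x ∈ W) (_ : ∀ x ∈ X, ∀ k, x k ∈ B) (_ : ∀ x ∈ X, x i₀ = b₀)
    (_ : ∀ x ∈ X, ∀ k, PowMem S (x k)) (_ : ∀ x ∈ X, ∀ k, P.IsU (x k)) (M : ℕ)
    (_ : ∀ V ≤ W, Module.finrank L V + 2 ≤ Module.finrank L W →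
      ∀ X' ⊆ X, (∀ x ∈ X', x ∈ V) → X'.card ≤ M)
    (_ : ∀ p p' : E, ∀ α β γ : L, α ≠ 0 → β ≠ 0 → γ ≠ 0 →
      (∀ w ∈ W, α * w i₀ + β * w p + γ * w p' = 0) → Par W p i₀) (r : ℝ) (_ : 0 ≤ r)
    (c : E → L) (_ : c ∈ X) (_ : Submodule.span L {x | x ∈ X ∧ P.tdist x c ≤ r} = W)
    (X' : Finset (E → L)) (_ : X' ⊆ X) (_ : ∀ x ∈ X', K * (r + P.D) < P.tdist x c),
    X'.card ≤ C * (B.card * M) := by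
  classical
  set l := Real.log n.factorial with hl
  set m := Real.log n with hm
  have hl0 : 0 ≤ l := Real.log_natCast_nonneg _
  have hm0 : 0 ≤ m := Real.log_natCast_nonneg _
  have hn' : (1 : ℝ) ≤ n := by exact_mod_cast hn
  set K₂ : ℝ := 8 * n ^ 2 * (n + l) with hK₂
  have hK₂0 : 0 < K₂ := by positivity
  set K₃ : ℝ := 3 * n * (n * (4 * (n + l)) + m) with hK₃
  have hK₃0 : 0 ≤ K₃ := by positivity
  set ε : ℝ := 1 / (4 * K₂) with hε
  have hε0 : 0 < ε := by positivity
  set η : ℝ := 1 / (6 * n ^ 2) with hη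
  have hη0 : 0 < η := by positivity
  obtain ⟨C, hC⟩ := exists_tuple_cover n ρ (ε * η / 2) (by positivity)
  refine ⟨2 * K₂ + K₃, by positivity, n * C, fun L _ ι _ P S hS E _ _ hE W hW hd B i₀ b₀ hb₀ X hXW
    hXB hX0 hX hXU M hM hrel r hr c hc hspan X' hX' hfar => ?_⟩
  have hD := P.D_pos
  have : Nonempty E := ⟨i₀⟩
  let V : (E → L) → Submodule L (E → L) := fun x =>
    Submodule.span L {y | y ∈ X ∧ P.tdist y x ≤ ε * P.tdist x c}
  have hTpos : ∀ x ∈ X', 0 < P.tdist x c := fun x hx =>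
    lt_of_le_of_lt (by positivity) (hfar x hx)
  have hV : ∀ x ∈ X', V x < W := by
    intro x hx
    refine lt_of_le_of_ne (Submodule.span_le.2 fun y hy => hXW y hy.1) fun heq => ?_
    have hT := hTpos x hx
    have h1 := P.tdist_le_of_span_eq hE hW (hXU c hc) (hXU x (hX' hx))
      ((hX0 c hc).trans (hX0 x (hX' hx)).symm) hspan (fun y hy => hXU y hy.1) heq
      (fun y hy => hXU y hy.1) hr (by positivity : 0 ≤ ε * P.tdist x c) (fun y hy => hy.2)
      (fun y hy => hy.2)
    have h2 : K₂ * (r + ε * P.tdist x c + P.D) = K₂ * (r + P.D) + P.tdist x c / 4 := by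
      rw [hε]; field_simp; ring
    rw [← hl, ← hK₂, h2, tdist_comm] at h1
    have h3 := hfar x hx
    have h4 : 0 ≤ K₃ * (r + P.D) := by positivity
    linarith
  have hpar : ∀ x ∈ X', ∀ z, η * P.tdist x c ≤ lnorm (P.lv (x z) - P.lv (c z)) → ¬ Par W z i₀ := by
    rintro x hx z hz ⟨a, ha⟩
    have : x z = c z := by
      rw [ha x (hXW x (hX' hx)), ha c (hXW c hc), hX0 x (hX' hx), hX0 c hc]
    rw [this, sub_self, lnorm_zero] at hz
    have := hTpos x hx
    have : 0 < η * P.tdist x c := by positivity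
    linarith
  have hz : ∀ x ∈ X', ∃ z, η * P.tdist x c ≤ lnorm (P.lv (x z) - P.lv (c z)) ∧
      Module.finrank L (V x ⊓ ratioSubmodule b₀ (x z) z i₀ : Submodule L (E → L)) + 2 ≤
        Module.finrank L W := by
    intro x hx
    have hT := hTpos x hx
    obtain ⟨z, hz⟩ := P.exists_le_lnorm_lv_sub hE x c
    obtain ⟨z', hzz', hz'⟩ := P.exists_not_par hE hW hd hspan (fun y hy => hXU y hy.1) (hXU c hc) hr
      (fun y hy => hy.2) (hXW x (hX' hx)) (hXU x (hX' hx)) hz (by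
        refine lt_of_le_of_lt ?_ (hfar x hx)
        rw [← hl, ← hm]
        have h1 : (n : ℝ) * r + P.D * l ≤ (n + l) * (r + P.D) := by nlinarith
        have h2 : P.D * m ≤ m * (r + P.D) := by nlinarith
        have h3 : 3 * n * (n * (4 * (n * r + P.D * l)) + P.D * m) ≤
          3 * n * (n * (4 * ((n + l) * (r + P.D))) + m * (r + P.D)) := by gcongr
        have h4 : 0 ≤ 2 * K₂ * (r + P.D) := by positivity
        have h5 : 3 * n * (n * (4 * ((n + l) * (r + P.D))) + m * (r + P.D)) =
          K₃ * (r + P.D) := by rw [hK₃]; ring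
        linarith)
    have hz1 : η * P.tdist x c ≤ lnorm (P.lv (x z) - P.lv (c z)) := by
      refine le_trans ?_ hz
      rw [hη, one_div_mul_eq_div]
      gcongr
      nlinarith
    have hz1' : η * P.tdist x c ≤ lnorm (P.lv (x z') - P.lv (c z')) := by
      rw [hη, one_div_mul_eq_div]; exact hz'
    by_contra! hcon
    obtain ⟨α, β, γ, hα, hβ, hγ, h⟩ := exists_relation (hV x hx) hb₀ (hpar x hx z' hz1')
      (hpar x hx z hz1) hzz' (not_le.2 (hcon z' hz1')) (not_le.2 (hcon z hz1))
    exact hpar x hx z' hz1' (hrel z' z α β γ hα hβ hγ h)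
  choose! f hf1 hf2 using hz
  have hcard : ((univ : Finset E) ×ˢ B).card ≤ n * B.card := by
    rw [card_product, card_univ]; gcongr
  refine (card_le_mul_of_cover X' (univ ×ˢ B) (fun x q => f x = q.1 ∧ x q.1 = q.2) (C * M)
    (fun x hx => ⟨(f x, x (f x)), mem_product.2 ⟨mem_univ _, hXB x (hX' hx) _⟩, rfl, rfl⟩) ?_).trans
    ((Nat.mul_le_mul_right _ hcard).trans (le_of_eq (by ring)))
  rintro ⟨z, β⟩ _ Y hY hYR
  simp only at hYR
  rcases Y.eq_empty_or_nonempty with rfl | ⟨x₀, hx₀⟩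
  · simp
  set τ := lnorm (P.lv β - P.lv (c z)) with hτ
  have hτ1 : ∀ x ∈ Y, η * P.tdist x c ≤ τ := fun x hx => by
    have := hf1 x (hY hx)
    rwa [(hYR x hx).1, (hYR x hx).2] at this
  have hτ2 : ∀ x ∈ Y, τ ≤ P.tdist x c := fun x hx => by
    rw [hτ, ← (hYR x hx).2]; exact P.lnorm_le_tdist x c z
  have hτ0 : 0 < τ := (mul_pos hη0 (hTpos x₀ (hY hx₀))).trans_le (hτ1 x₀ hx₀)
  obtain ⟨t, htY, htc, hcov⟩ := hC L ι P S hS E hE Y (fun x hx => hX x (hX' (hY hx)))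
    (2 * τ / η) (by positivity) (fun x hx y hy => by
      have h1 := P.tdist_triangle x c y
      have h2 := hτ1 x hx
      have h3 := hτ1 y hy
      rw [tdist_comm P y] at h3
      rw [le_div_iff₀ hη0]
      nlinarith)
  refine (card_le_mul_of_cover Y t _ M hcov ?_).trans (Nat.mul_le_mul_right _ htc)
  intro y hy Z hZY hZ
  have hyX' := hY (htY hy)
  refine hM (V y ⊓ ratioSubmodule b₀ (y z) z i₀) (inf_le_left.trans (hV y hyX').le) ?_ Z
    (hZY.trans (hY.trans hX')) fun x hx => ⟨Submodule.subset_span ⟨hX' (hY (hZY hx)), ?_⟩, ?_⟩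
  · have := hf2 y hyX'
    rwa [(hYR y (htY hy)).1] at this
  · have h1 := hZ x hx
    have h2 : ε * η / 2 * (2 * τ / η) = ε * τ := by field_simp
    rw [h2] at h1
    exact h1.trans (mul_le_mul_of_nonneg_left (hτ2 y (htY hy)) hε0.le)
  · rw [SetLike.mem_coe, mem_ratioSubmodule, (hYR x (hZY hx)).2, (hYR y (htY hy)).2,
      hX0 x (hX' (hY (hZY hx)))]
    ring

end PlaceSystem

namespace PlaceSystem

variable {L : Type*} [Field L] {ι : Type*} [Fintype ι] (P : PlaceSystem L ι) {E : Type*}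
  [Fintype E] {W : Submodule L (E → L)} {X : Finset (E → L)}

lemma exists_span_eq_of_span_eq (hW : W ≠ ⊥) (hXW : ∀ x ∈ X, x ∈ W) {c : E → L} {s : ℝ}
    (h : Submodule.span L {x | x ∈ X ∧ P.tdist x c ≤ s} = W) :
    ∃ y ∈ X, P.tdist y c ≤ s ∧ Submodule.span L {x | x ∈ X ∧ P.tdist x c ≤ P.tdist y c} = W := by
  classical
  let F := X.filter fun x => P.tdist x c ≤ s
  have hF : F.Nonempty := by
    rw [nonempty_iff_ne_empty]
    intro h0
    apply hW
    rw [← h, Submodule.span_eq_bot]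
    intro x hx
    have : x ∈ F := mem_filter.2 hx
    simp [h0] at this
  obtain ⟨y, hy, hmax⟩ := F.exists_max_image (fun x => P.tdist x c) hF
  refine ⟨y, (mem_filter.1 hy).1, (mem_filter.1 hy).2,
    le_antisymm (Submodule.span_le.2 fun x hx => hXW x hx.1) ?_⟩
  rw [← h]
  exact Submodule.span_mono fun x hx => ⟨hx.1, hmax x (mem_filter.2 hx)⟩

/-- Existence of a spanning cluster of minimal radius. -/
lemma exists_min_cluster (hW : W ≠ ⊥) (hX : Submodule.span L (X : Set (E → L)) = W) :
    ∃ c ∈ X, ∃ r, 0 ≤ r ∧ Submodule.span L {x | x ∈ X ∧ P.tdist x c ≤ r} = W ∧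
      ∀ y ∈ X, ∀ s, Submodule.span L {x | x ∈ X ∧ P.tdist x y ≤ s} = W → r ≤ s := by
  classical
  have hXW : ∀ x ∈ X, x ∈ W := fun x hx => hX ▸ Submodule.subset_span hx
  have hne : X.Nonempty := by
    rw [nonempty_iff_ne_empty]
    rintro rfl
    apply hW
    rw [← hX]; simp
  let Q := (X ×ˢ X).filter fun q =>
    Submodule.span L {x | x ∈ X ∧ P.tdist x q.1 ≤ P.tdist q.2 q.1} = W
  have hQ : Q.Nonempty := by
    obtain ⟨c, hc⟩ := hne
    obtain ⟨y, hy, hmax⟩ := X.exists_max_image (fun x => P.tdist x c) ⟨c, hc⟩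
    refine ⟨(c, y), mem_filter.2 ⟨mem_product.2 ⟨hc, hy⟩, ?_⟩⟩
    rw [← hX]
    congr 1
    ext x
    exact ⟨fun h => h.1, fun h => ⟨h, hmax x h⟩⟩
  obtain ⟨⟨c, y⟩, hq, hmin⟩ := Q.exists_min_image (fun q => P.tdist q.2 q.1) hQ
  obtain ⟨hcy, hspan⟩ := mem_filter.1 hq
  refine ⟨c, (mem_product.1 hcy).1, P.tdist y c, P.tdist_nonneg _ _, hspan, fun c' hc' s hs => ?_⟩
  obtain ⟨y', hy', hle, hspan'⟩ := P.exists_span_eq_of_span_eq hW hXW hs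
  exact (hmin (c', y') (mem_filter.2 ⟨mem_product.2 ⟨hc', hy'⟩, hspan'⟩)).trans hle

end PlaceSystem

/-- A bound for the number of solutions in a connected subspace in terms of bounds for proper
subspaces and for subspaces of codimension at least two. -/
lemma exists_card_le_add (n ρ : ℕ) (hn : 0 < n) : ∃ C : ℕ, ∀ (L : Type u) [Field L] [NumberField L]
    (S : Finset Lˣ) (_ : S.card ≤ ρ) (E : Type) [Fintype E] [DecidableEq E]
    (_ : Fintype.card E ≤ n) (W : Submodule L (E → L)) (_ : Conn W) (_ : 2 ≤ Module.finrank L W)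
    (B : Finset L) (_ : ∀ b ∈ B, PowMem S b) (i₀ : E) (b₀ : L) (_ : b₀ ≠ 0)
    (X : Finset (E → L)) (_ : ∀ x ∈ X, x ∈ W) (_ : ∀ x ∈ X, ∀ k, x k ∈ B) (_ : ∀ x ∈ X, x i₀ = b₀)
    (M₁ M₂ : ℕ) (_ : ∀ V < W, ∀ X' ⊆ X, (∀ x ∈ X', x ∈ V) → X'.card ≤ M₁)
    (_ : ∀ V ≤ W, Module.finrank L V + 2 ≤ Module.finrank L W →
      ∀ X' ⊆ X, (∀ x ∈ X', x ∈ V) → X'.card ≤ M₂), X.card ≤ C * (M₁ + B.card * M₂) := by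
  classical
  obtain ⟨C₁, hC₁⟩ := exists_card_value_le.{u} ρ
  obtain ⟨K, hK, C₂, hC₂⟩ := PlaceSystem.exists_card_far_le.{u, u, 0} n ρ hn
  obtain ⟨C₃, hC₃⟩ := PlaceSystem.exists_card_near_le.{u, u, 0} n ρ K hK
  refine ⟨C₁ + 1 + C₂ + C₃, fun L _ _ S hS E _ _ hE W hW hd B hB i₀ b₀ hb₀ X hXW hXB hX0 M₁ M₂ hM₁
    hM₂ => ?_⟩
  have hXS : ∀ x ∈ X, ∀ k, PowMem S (x k) := fun x hx k => hB _ (hXB x hx k)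
  by_cases hrel : ∀ p p' : E, ∀ α β γ : L, α ≠ 0 → β ≠ 0 → γ ≠ 0 →
      (∀ w ∈ W, α * w i₀ + β * w p + γ * w p' = 0) → Par W p i₀
  swap
  · push Not at hrel
    obtain ⟨p, p', α, β, γ, hα, hβ, hγ, hrel, hpar⟩ := hrel
    have h1 := hC₁ L S hS (α * b₀) β γ (mul_ne_zero hα hb₀) hβ hγ (X.image fun x => x p) (by
      intro y hy
      obtain ⟨x, hx, rfl⟩ := mem_image.1 hy
      refine ⟨hXS x hx p, x p', hXS x hx p', ?_⟩
      rw [← hX0 x hx]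
      exact hrel x (hXW x hx))
    have h2 := card_le_mul_of_cover X (X.image fun x => x p) (fun x y => x p = y) M₁
      (fun x hx => ⟨x p, mem_image_of_mem _ hx, rfl⟩) (fun y _ X' hX' h =>
        hM₁ _ (inf_ratioSubmodule_lt (s := y) hb₀ hpar) X' hX' fun x hx =>
          ⟨hXW x (hX' hx), by
            rw [SetLike.mem_coe, mem_ratioSubmodule, h x hx, hX0 x (hX' hx), mul_comm]⟩)
    calc X.card ≤ C₁ * M₁ := h2.trans (Nat.mul_le_mul_right _ h1)
      _ ≤ _ := Nat.mul_le_mul (by omega) (by omega)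
  by_cases hspan : Submodule.span L (X : Set (E → L)) = W
  swap
  · calc X.card ≤ 1 * M₁ := by
          rw [one_mul]
          exact hM₁ _ (lt_of_le_of_ne (Submodule.span_le.2 hXW) hspan) X subset_rfl fun x hx =>
            Submodule.subset_span hx
      _ ≤ _ := Nat.mul_le_mul (by omega) (by omega)
  obtain ⟨ι, _, P, hP⟩ := exists_placeSystem L B fun b hb => (hB b hb).ne_zero
  have hXU : ∀ x ∈ X, ∀ k, P.IsU (x k) := fun x hx k => hP _ (hXB x hx k)
  have hbot : W ≠ ⊥ := by
    rintro rfl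
    rw [finrank_bot] at hd
    omega
  obtain ⟨c, hc, r, hr, hr1, hr2⟩ := P.exists_min_cluster hbot hspan
  have h1 := hC₃ L ι P S hS E hE W hW hd X hXW hXS hXU M₁ hM₁ r hr hr2 c
    (X.filter fun x => P.tdist x c ≤ K * (r + P.D)) (filter_subset _ _)
    fun x hx => (mem_filter.1 hx).2
  have h2 := hC₂ L ι P S hS E hE W hW hd B i₀ b₀ hb₀ X hXW hXB hX0 hXS hXU M₂ hM₂ hrel r hr c hc hr1
    (X.filter fun x => ¬ P.tdist x c ≤ K * (r + P.D)) (filter_subset _ _)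
    fun x hx => not_le.1 (mem_filter.1 hx).2
  rw [← card_filter_add_card_filter_not (fun x => P.tdist x c ≤ K * (r + P.D))]
  nlinarith [Nat.zero_le M₁, Nat.zero_le (B.card * M₂), Nat.zero_le (C₁ * M₁),
    Nat.zero_le (C₂ * M₁), Nat.zero_le (C₁ * (B.card * M₂)), Nat.zero_le (C₃ * (B.card * M₂))]

/-- Bounds for the number of nondegenerate solutions with a prescribed coordinate in a subspace of
given dimension. -/
lemma exists_card_le_pow_of_finrank_le (n ρ : ℕ) (hn : 0 < n) (d : ℕ) : ∃ C : ℕ,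
    ∀ (L : Type u) [Field L] [NumberField L] (S : Finset Lˣ) (_ : S.card ≤ ρ) (E : Type)
    [Fintype E] [DecidableEq E] (_ : Fintype.card E ≤ n) (W : Submodule L (E → L))
    (_ : W ≤ sumZero L E) (_ : Module.finrank L W ≤ d) (B : Finset L)
    (_ : ∀ b ∈ B, PowMem S b) (i₀ : E) (b₀ : L) (_ : b₀ ≠ 0) (X : Finset (E → L))
    (_ : ∀ x ∈ X, x ∈ W) (_ : ∀ x ∈ X, ∀ k, x k ∈ B) (_ : ∀ x ∈ X, x i₀ = b₀)
    (_ : ∀ x ∈ X, ∀ I : Finset E, I.Nonempty → I ≠ univ → ∑ k ∈ I, x k ≠ 0),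
    X.card ≤ if d = 0 then 0 else C * B.card ^ ((d - 1) / 2) := by
  classical
  obtain ⟨c, hc⟩ := exists_card_le_add.{u} n ρ hn
  induction d using Nat.strong_induction_on with
  | _ d ih =>
  rcases Nat.lt_or_ge d 2 with hd | hd
  · refine ⟨1, fun L _ _ S hS E _ _ hE W hW hWd B hB i₀ b₀ hb₀ X hXW hXB hX0 _ => ?_⟩
    split_ifs with h
    · have hbot : W = ⊥ := Submodule.finrank_eq_zero.1 (by omega)
      rw [Nat.le_zero, card_eq_zero, eq_empty_iff_forall_notMem]
      intro x hx
      have := hXW x hx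
      rw [hbot, Submodule.mem_bot] at this
      apply hb₀
      rw [← hX0 x hx, this]; rfl
    · have : d = 1 := by omega
      subst this
      rw [Nat.sub_self, Nat.zero_div, pow_zero, mul_one, card_le_one]
      exact fun x hx y hy => eq_of_finrank_le_one hWd (hXW x hx) (hXW y hy)
        ((hX0 x hx).trans (hX0 y hy).symm) (by rw [hX0 x hx]; exact hb₀)
  obtain ⟨C₁, hC₁⟩ := ih (d - 1) (by omega)
  obtain ⟨C₂, hC₂⟩ := ih (d - 2) (by omega)
  refine ⟨C₁ + c * (C₁ + C₂), fun L _ _ S hS E _ _ hE W hW hWd B hB i₀ b₀ hb₀ X hXW hXB hX0 hXI => ?_⟩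
  rw [if_neg (by omega)]
  rcases X.eq_empty_or_nonempty with rfl | ⟨x, hx⟩
  · simp
  have hBpos : 0 < B.card := card_pos.2 ⟨_, hXB x hx i₀⟩
  have hle : ∀ V ≤ W, ∀ X' ⊆ X, (∀ x ∈ X', x ∈ V) → Module.finrank L V ≤ d - 1 →
      X'.card ≤ C₁ * B.card ^ ((d - 1) / 2) := fun V hV X' hX' h hVd => by
    have := hC₁ L S hS E hE V (hV.trans hW) hVd B hB i₀ b₀ hb₀ X' h (fun x hx => hXB x (hX' hx))
      (fun x hx => hX0 x (hX' hx)) (fun x hx => hXI x (hX' hx))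
    rw [if_neg (by omega)] at this
    exact this.trans (Nat.mul_le_mul_left _ (Nat.pow_le_pow_right hBpos (by omega)))
  by_cases hlt : Module.finrank L W ≤ d - 1
  · exact (hle W le_rfl X subset_rfl hXW hlt).trans (Nat.mul_le_mul_right _ (Nat.le_add_right _ _))
  have hconn : Conn W := fun I hI hI' => ⟨x, hXW x hx, fun h => by
    have := mem_sumZero.1 (hW h)
    rw [sum_ite_mem, univ_inter] at this
    exact hXI x hx I hI hI' this⟩
  have h1 := hc L S hS E hE W hconn (by omega) B hB i₀ b₀ hb₀ X hXW hXB hX0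
    (C₁ * B.card ^ ((d - 1) / 2)) (if d - 2 = 0 then 0 else C₂ * B.card ^ ((d - 2 - 1) / 2))
    (fun V hV X' hX' h => hle V hV.le X' hX' h (by
      have := Submodule.finrank_lt_finrank_of_lt hV
      omega))
    (fun V hV hVd X' hX' h => hC₂ L S hS E hE V (hV.trans hW) (by omega) B hB i₀ b₀ hb₀ X' h
      (fun x hx => hXB x (hX' hx)) (fun x hx => hX0 x (hX' hx)) (fun x hx => hXI x (hX' hx)))
  have h2 : B.card * (if d - 2 = 0 then 0 else C₂ * B.card ^ ((d - 2 - 1) / 2)) ≤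
      C₂ * B.card ^ ((d - 1) / 2) := by
    split_ifs with h0
    · simp
    · obtain ⟨e, rfl⟩ : ∃ e, d = e + 3 := ⟨d - 3, by omega⟩
      have : (e + 3 - 1) / 2 = (e + 3 - 2 - 1) / 2 + 1 := by omega
      rw [this, pow_succ]
      exact le_of_eq (by ring)
  calc X.card ≤ c * (C₁ * B.card ^ ((d - 1) / 2) + C₂ * B.card ^ ((d - 1) / 2)) :=
        h1.trans (Nat.mul_le_mul_left _ (Nat.add_le_add_left h2 _))
    _ ≤ _ := by
        rw [← add_mul, ← mul_assoc]
        exact Nat.mul_le_mul_right _ (Nat.le_add_left _ _)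

/-- The number of nondegenerate solutions over a number field. -/
lemma exists_card_nondegenerate_le (n ρ : ℕ) (hn : 0 < n) : ∃ C : ℕ,
    ∀ (L : Type u) [Field L] [NumberField L] (S : Finset Lˣ) (_ : S.card ≤ ρ) (E : Type)
    [Fintype E] [DecidableEq E] [Nonempty E] (_ : Fintype.card E ≤ n) (B : Finset L)
    (_ : ∀ b ∈ B, PowMem S b) (X : Finset (E → L)) (_ : ∀ x ∈ X, ∀ k, x k ∈ B)
    (_ : ∀ x ∈ X, ∑ k, x k = 0)
    (_ : ∀ x ∈ X, ∀ I : Finset E, I.Nonempty → I ≠ univ → ∑ k ∈ I, x k ≠ 0),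
    X.card ≤ C * B.card ^ (Fintype.card E / 2) := by
  classical
  choose C hC using fun d => exists_card_le_pow_of_finrank_le.{u} n ρ hn d
  refine ⟨∑ d ∈ range n, C d, fun L _ _ S hS E _ _ _ hE B hB X hXB hX hXI => ?_⟩
  obtain ⟨i₀⟩ := ‹Nonempty E›
  have : Nonempty E := ⟨i₀⟩
  have hpos : 0 < Fintype.card E := Fintype.card_pos
  have hrank := finrank_sumZero (L := L) (E := E)
  set d := Module.finrank L (sumZero L E) with hd
  have h1 : ∀ b ∈ B, (X.filter fun x => x i₀ = b).card ≤
      if d = 0 then 0 else C d * B.card ^ ((d - 1) / 2) := fun b hb =>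
    hC d L S hS E hE (sumZero L E) le_rfl hd.ge B hB i₀ b (hB b hb).ne_zero _
      (fun x hx => hX x (mem_filter.1 hx).1) (fun x hx => hXB x (mem_filter.1 hx).1)
      (fun x hx => (mem_filter.1 hx).2) (fun x hx => hXI x (mem_filter.1 hx).1)
  have h2 : X.card ≤ B.card * if d = 0 then 0 else C d * B.card ^ ((d - 1) / 2) :=
    card_le_mul_of_cover X B (fun x b => x i₀ = b) _ (fun x hx => ⟨_, hXB x hx i₀, rfl⟩)
      fun b hb Y hY h => (card_le_card fun x hx => mem_filter.2 ⟨hY hx, h x hx⟩).trans (h1 b hb)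
  refine h2.trans ?_
  split_ifs with h0
  · simp
  · have h3 : C d ≤ ∑ d ∈ range n, C d :=
      single_le_sum (f := C) (fun _ _ => Nat.zero_le _) (mem_range.2 (by omega))
    have h4 : Fintype.card E / 2 = (d - 1) / 2 + 1 := by omega
    rw [h4, pow_succ]
    calc B.card * (C d * B.card ^ ((d - 1) / 2)) = C d * (B.card ^ ((d - 1) / 2) * B.card) := by ring
      _ ≤ _ := Nat.mul_le_mul_right _ h3

lemma PowMem.map {K L R : Type*} [Field K] [Field L] [CommRing R] {S : Finset Kˣ} {T : Finset Rˣ}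
    {S' : Finset Lˣ} {ψ : R →+* K} (hψ : Function.Injective ψ) {φ : R →+* L}
    (hT : ∀ s ∈ S, ∃ t ∈ T, Units.map (ψ : R →* K) t = s)
    (hS' : ∀ t ∈ T, Units.map (φ : R →* L) t ∈ S') {b : Rˣ} (hb : PowMem S (ψ b)) :
    PowMem S' (φ b) := by
  obtain ⟨v, hv, k, hk, hvk⟩ := hb
  refine ⟨Units.map (φ : R →* L) b, rfl, k, hk, ?_⟩
  have hvb : v = Units.map (ψ : R →* K) b := Units.ext hv
  have h1 : Subgroup.closure (S : Set Kˣ) ≤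
      (Subgroup.closure (T : Set Rˣ)).map (Units.map (ψ : R →* K)) := by
    rw [Subgroup.closure_le]
    intro s hs
    obtain ⟨t, ht, rfl⟩ := hT s hs
    exact ⟨t, Subgroup.subset_closure ht, rfl⟩
  obtain ⟨w, hw, hwk⟩ := h1 hvk
  rw [hvb, ← map_pow] at hwk
  have hinj : Function.Injective (Units.map (ψ : R →* K)) := Units.map_injective hψ
  rw [hinj hwk] at hw
  rw [← map_pow]
  have h2 : Subgroup.closure (T : Set Rˣ) ≤
      (Subgroup.closure (S' : Set Lˣ)).comap (Units.map (φ : R →* L)) := by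
    rw [Subgroup.closure_le]
    exact fun t ht => Subgroup.subset_closure (hS' t ht)
  exact h2 hw

lemma exists_ringHom_numberField (R : Type u) [CommRing R] [Nontrivial R] [Algebra ℚ R]
    [Algebra.FiniteType ℚ R] : ∃ (L : Type u) (_ : Field L) (_ : NumberField L), Nonempty (R →+* L) := by
  obtain ⟨m, hm⟩ := Ideal.exists_maximal R
  let inst : Field (R ⧸ m) := Ideal.Quotient.field m
  have : Algebra.FiniteType ℚ (R ⧸ m) :=
    Algebra.FiniteType.of_surjective (Ideal.Quotient.mkₐ ℚ m) (Ideal.Quotient.mkₐ_surjective ℚ m)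
  have h1 : Module.Finite ℚ (R ⧸ m) := finite_of_finite_type_of_isJacobsonRing ℚ (R ⧸ m)
  have h2 : CharZero (R ⧸ m) := algebraRat.charZero _
  refine ⟨R ⧸ m, inst, @NumberField.mk _ _ h2 ?_, ⟨Ideal.Quotient.mk m⟩⟩
  convert h1
  exact Subsingleton.elim _ _

/-- Specialization of finitely many elements of a field of characteristic zero to a number field. -/
lemma exists_specialization (K : Type u) [Field K] [CharZero K] (F : Finset K) (S : Finset Kˣ) :
    ∃ (L : Type u) (_ : Field L) (_ : NumberField L) (g : K → L) (S' : Finset Lˣ),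
      Set.InjOn g F ∧ S'.card ≤ S.card ∧ (∀ b ∈ F, PowMem S b → PowMem S' (g b)) ∧
      ∀ (E : Type) (I : Finset E) (x : E → K), (∀ k ∈ I, x k ∈ F) →
        g (∑ k ∈ I, x k) = ∑ k ∈ I, g (x k) := by
  classical
  let F' := F ∪ S.image (fun s : Kˣ => (s : K)) ∪ (F ×ˢ F).image fun q => q.1 - q.2
  let G : Finset K := F' ∪ F'.image fun f => f⁻¹
  let R := Algebra.adjoin ℚ (G : Set K)
  have : Algebra.FiniteType ℚ R := (Subalgebra.fg_iff_finiteType _).1 ⟨G, rfl⟩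
  obtain ⟨L, _, _, ⟨φ⟩⟩ := exists_ringHom_numberField R
  have hR : ∀ f ∈ F', f ∈ R ∧ f⁻¹ ∈ R := fun f hf =>
    ⟨Algebra.subset_adjoin (mem_coe.2 (mem_union_left _ hf)),
      Algebra.subset_adjoin (mem_coe.2 (mem_union_right _ (mem_image_of_mem _ hf)))⟩
  have hF : ∀ f ∈ F, f ∈ R ∧ f⁻¹ ∈ R := fun f hf =>
    hR f (mem_union_left _ (mem_union_left _ hf))
  have hunit : ∀ a : K, a ≠ 0 → a ∈ R → a⁻¹ ∈ R → ∃ r : Rˣ, ((r : R) : K) = a :=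
    fun a ha h h' => ⟨⟨⟨a, h⟩, ⟨a⁻¹, h'⟩, Subtype.ext (mul_inv_cancel₀ ha),
      Subtype.ext (inv_mul_cancel₀ ha)⟩, rfl⟩
  have hS : ∀ s ∈ S, ∃ r : Rˣ, ((r : R) : K) = s := fun s hs => by
    have := hR s (mem_union_left _ (mem_union_right _ (mem_image_of_mem _ hs)))
    exact hunit s s.ne_zero this.1 this.2
  choose! t ht using hS
  let g : K → L := fun a => if h : a ∈ R then φ ⟨a, h⟩ else 0
  have hg : ∀ r : R, g r = φ r := fun r => dif_pos r.2
  refine ⟨L, inferInstance, inferInstance, g,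
    (S.image t).image (Units.map (φ : R →* L)), ?_, card_image_le.trans card_image_le, ?_, ?_⟩
  · intro a ha b hb hab
    by_contra hne
    have h1 := hR (a - b) (mem_union_right _ (mem_image.2 ⟨(a, b), mem_product.2 ⟨ha, hb⟩, rfl⟩))
    obtain ⟨r, hr⟩ := hunit (a - b) (sub_ne_zero.2 hne) h1.1 h1.2
    have h2 := (r.isUnit.map φ).ne_zero
    apply h2
    have h3 : (r : R) = ⟨a, (hF a ha).1⟩ - ⟨b, (hF b hb).1⟩ := Subtype.ext hr
    rw [h3, map_sub, ← hg, ← hg]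
    exact sub_eq_zero.2 hab
  · intro b hb hbS
    obtain ⟨r, rfl⟩ := hunit b hbS.ne_zero (hF b hb).1 (hF b hb).2
    rw [hg]
    refine PowMem.map (T := S.image t) (ψ := R.subtype) Subtype.val_injective ?_ ?_ hbS
    · exact fun s hs => ⟨t s, mem_image_of_mem _ hs, Units.ext (ht s hs)⟩
    · exact fun s hs => mem_image_of_mem _ hs
  · intro E I x hx
    have hmem : ∀ k ∈ I, x k ∈ R := fun k hk => (hF _ (hx k hk)).1
    have h1 : ∑ k ∈ I, x k = ((∑ k ∈ I.attach, ⟨x k, hmem k k.2⟩ : R) : K) := by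
      rw [AddSubmonoidClass.coe_finsetSum, sum_attach I fun k => x k]
    rw [h1, hg, map_sum, ← sum_attach I fun k => g (x k)]
    exact sum_congr rfl fun k _ => (hg _).symm

/-- The number of nondegenerate solutions over a field of characteristic zero. -/
lemma exists_card_nondegenerate_le_of_charZero (n ρ : ℕ) (hn : 0 < n) : ∃ C : ℕ,
    ∀ (K : Type u) [Field K] [CharZero K] (S : Finset Kˣ) (_ : S.card ≤ ρ) (E : Type)
    [Fintype E] [DecidableEq E] [Nonempty E] (_ : Fintype.card E ≤ n) (B : Finset K)
    (_ : ∀ b ∈ B, PowMem S b) (X : Finset (E → K)) (_ : ∀ x ∈ X, ∀ k, x k ∈ B)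
    (_ : ∀ x ∈ X, ∑ k, x k = 0)
    (_ : ∀ x ∈ X, ∀ I : Finset E, I.Nonempty → I ≠ univ → ∑ k ∈ I, x k ≠ 0),
    X.card ≤ C * B.card ^ (Fintype.card E / 2) := by
  classical
  obtain ⟨C, hC⟩ := exists_card_nondegenerate_le.{u} n ρ hn
  refine ⟨C, fun K _ _ S hS E _ _ _ hE B hB X hXB hX hXI => ?_⟩
  let F : Finset K := insert 0 (B ∪ X.biUnion fun x => univ.image fun I : Finset E => ∑ k ∈ I, x k)
  have hBF : ∀ b ∈ B, b ∈ F := fun b hb => mem_insert_of_mem (mem_union_left _ hb)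
  have hXF : ∀ x ∈ X, ∀ I : Finset E, ∑ k ∈ I, x k ∈ F := fun x hx I =>
    mem_insert_of_mem (mem_union_right _ (mem_biUnion.2 ⟨x, hx, mem_image_of_mem _ (mem_univ I)⟩))
  obtain ⟨L, _, _, g, S', hg, hS', hgS, hsum⟩ := exists_specialization K F S
  have hg0 : g 0 = 0 := by simpa using hsum E ∅ 0 (by simp)
  have hinj : Set.InjOn (fun x : E → K => g ∘ x) X := fun x hx y hy h => funext fun k =>
    hg (hBF _ (hXB x hx k)) (hBF _ (hXB y hy k)) (congrFun h k)
  have hBinj : Set.InjOn g B := hg.mono fun b hb => hBF b hb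
  rw [← card_image_of_injOn hinj, ← card_image_of_injOn hBinj]
  have hsum' : ∀ x ∈ X, ∀ I : Finset E, ∑ k ∈ I, (g ∘ x) k = g (∑ k ∈ I, x k) := fun x hx I =>
    (hsum E I x fun k _ => hBF _ (hXB x hx k)).symm
  refine hC L S' (hS'.trans hS) E hE (B.image g) ?_ _ ?_ ?_ ?_
  · intro b hb
    obtain ⟨a, ha, rfl⟩ := mem_image.1 hb
    exact hgS a (hBF a ha) (hB a ha)
  · intro x hx k
    obtain ⟨y, hy, rfl⟩ := mem_image.1 hx
    exact mem_image_of_mem _ (hXB y hy k)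
  · intro x hx
    obtain ⟨y, hy, rfl⟩ := mem_image.1 hx
    rw [hsum' y hy, hX y hy, hg0]
  · intro x hx I hI hI' h
    obtain ⟨y, hy, rfl⟩ := mem_image.1 hx
    rw [hsum' y hy, ← hg0] at h
    exact hXI y hy I hI hI' (hg (hXF y hy I) (mem_insert_self _ _) h)

/-- The number of all solutions of `∑ x = 0` over a field of characteristic zero. -/
lemma exists_card_sum_eq_zero_le (ρ n : ℕ) : ∃ C : ℕ, ∀ (K : Type u) [Field K] [CharZero K]
    (S : Finset Kˣ) (_ : S.card ≤ ρ) (E : Type) [Fintype E] (_ : Fintype.card E = n)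
    (B : Finset K) (_ : ∀ b ∈ B, PowMem S b) (X : Finset (E → K)) (_ : ∀ x ∈ X, ∀ k, x k ∈ B)
    (_ : ∀ x ∈ X, ∑ k, x k = 0), X.card ≤ C * B.card ^ (n / 2) := by
  classical
  induction n using Nat.strong_induction_on with
  | _ n ih =>
  rcases Nat.eq_zero_or_pos n with rfl | hn
  · refine ⟨1, fun K _ _ S hS E _ hE B hB X _ _ => ?_⟩
    have := Fintype.card_eq_zero_iff.1 hE
    rw [Nat.zero_div, pow_zero, mul_one, card_le_one]
    exact fun x _ y _ => Subsingleton.elim x y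
  obtain ⟨C, hC⟩ := exists_card_nondegenerate_le_of_charZero.{u} n ρ hn
  choose! D hD using ih
  refine ⟨C + 2 ^ n * (∑ i ∈ range n, D i) ^ 2, fun K _ _ S hS E _ hE B hB X hXB hX => ?_⟩
  have : Nonempty E := Fintype.card_pos_iff.1 (hE ▸ hn)
  set M := ∑ i ∈ range n, D i with hM
  rcases X.eq_empty_or_nonempty with rfl | ⟨x₀, hx₀⟩
  · simp
  have hBpos : 0 < B.card := card_pos.2 ⟨_, hXB x₀ hx₀ (Classical.arbitrary E)⟩
  let Q : (E → K) → Prop := fun x => ∃ I : Finset E, I.Nonempty ∧ I ≠ univ ∧ ∑ k ∈ I, x k = 0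
  have h1 : (X.filter fun x => ¬ Q x).card ≤ C * B.card ^ (n / 2) := by
    have := hC K S hS E hE.le B hB (X.filter fun x => ¬ Q x)
      (fun x hx => hXB x (mem_filter.1 hx).1) (fun x hx => hX x (mem_filter.1 hx).1)
      (fun x hx I hI hI' h => (mem_filter.1 hx).2 ⟨I, hI, hI', h⟩)
    rwa [hE] at this
  have hpart : ∀ I : Finset E, I.card < n → ∀ Y : Finset (E → K), Y ⊆ X →
      (∀ x ∈ Y, ∑ k ∈ I, x k = 0) →
      (Y.image fun x => (fun k : I => x k)).card ≤ M * B.card ^ (I.card / 2) := by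
    intro I hI Y hYX hY
    have h := hD I.card hI K S hS I (Fintype.card_coe I) B hB (Y.image fun x => (fun k : I => x k))
      (fun y hy k => by
        obtain ⟨x, hx, rfl⟩ := mem_image.1 hy
        exact hXB x (hYX hx) k)
      (fun y hy => by
        obtain ⟨x, hx, rfl⟩ := mem_image.1 hy
        rw [sum_coe_sort I x]
        exact hY x hx)
    exact h.trans (Nat.mul_le_mul_right _ (single_le_sum (f := D) (fun _ _ => Nat.zero_le _)
      (mem_range.2 hI)))
  have h2 : (X.filter Q).card ≤ 2 ^ n * (M ^ 2 * B.card ^ (n / 2)) := by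
    have hcard : (univ : Finset (Finset E)).card = 2 ^ n := by
      rw [card_univ, Fintype.card_finset, hE]
    rw [← hcard]
    refine card_le_mul_of_cover _ univ
      (fun x I => I.Nonempty ∧ I ≠ univ ∧ ∑ k ∈ I, x k = 0) _ (fun x hx => ?_) ?_
    · obtain ⟨I, hI⟩ := (mem_filter.1 hx).2
      exact ⟨I, mem_univ _, hI⟩
    intro I _ Y hY h
    rcases Y.eq_empty_or_nonempty with rfl | ⟨x, hx⟩
    · simp
    have hYX : Y ⊆ X := fun x hx => (mem_filter.1 (hY hx)).1
    obtain ⟨hI, hI', -⟩ := h x hx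
    have hIpos : 0 < I.card := card_pos.2 hI
    have hIlt : I.card < n := hE ▸ (card_lt_univ_of_notMem (Classical.not_forall.1
      fun hall => hI' (eq_univ_iff_forall.2 hall)).choose_spec)
    have hIc : Iᶜ.card = n - I.card := by rw [card_compl, hE]
    have e1 := hpart I hIlt Y hYX fun x hx => (h x hx).2.2
    have e2 := hpart Iᶜ (by omega) Y hYX fun x hx => by
      have := sum_add_sum_compl I x
      rwa [(h x hx).2.2, zero_add, hX x (hYX hx)] at this
    have e3 : Y.card ≤ ((Y.image fun x => (fun k : I => x k)) ×ˢ
        (Y.image fun x => (fun k : (Iᶜ : Finset E) => x k))).card := by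
      refine card_le_card_of_injOn (fun x => (fun k : I => x k, fun k : (Iᶜ : Finset E) => x k))
        (fun x hx => mem_product.2 ⟨mem_image_of_mem _ hx, mem_image_of_mem _ hx⟩) ?_
      intro x _ y _ hxy
      obtain ⟨h1, h2⟩ := Prod.mk.inj hxy
      ext k
      by_cases hk : k ∈ I
      · exact congrFun h1 ⟨k, hk⟩
      · exact congrFun h2 ⟨k, mem_compl.2 hk⟩
    rw [card_product] at e3
    calc Y.card ≤ M * B.card ^ (I.card / 2) * (M * B.card ^ (Iᶜ.card / 2)) :=
          e3.trans (Nat.mul_le_mul e1 e2)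
      _ = M ^ 2 * B.card ^ (I.card / 2 + Iᶜ.card / 2) := by rw [pow_add]; ring
      _ ≤ _ := Nat.mul_le_mul_left _ (Nat.pow_le_pow_right hBpos (by omega))
  rw [← card_filter_add_card_filter_not Q]
  calc _ ≤ 2 ^ n * (M ^ 2 * B.card ^ (n / 2)) + C * B.card ^ (n / 2) := add_le_add h2 h1
    _ = _ := by ring

end PadeApproximation

end Auxiliary

theorem count_solutions_homogeneous (n ρ : ℕ) (hn : 0 < n) :
    ∃ C : ℝ, 0 < C ∧ ∀ (K : Type*) [Field K] [CharZero K] (Γ : Subgroup Kˣ),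
      FinRank Γ ρ →
      ∀ A : Finset K, (∀ a ∈ A, ∃ u : Kˣ, u ∈ Γ ∧ (u : K) = a) →
      ∀ a : Fin n → K, (∀ i, a i ≠ 0) →
      ({x : Fin n → K | (∀ i, x i ∈ A) ∧ ∑ i, a i * x i = 0}.ncard : ℝ) ≤
        C * (A.card : ℝ) ^ (n / 2) := by
  classical
  obtain ⟨C, hC⟩ := exists_card_sum_eq_zero_le (ρ + n) n
  refine ⟨C * n ^ (n / 2) + 1, by positivity, fun K _ _ Γ hΓ A hA a ha => ?_⟩
  obtain ⟨S, hS, -, hSΓ⟩ := hΓ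
  let T : Finset Kˣ := Finset.univ.image fun i => Units.mk0 (a i) (ha i)
  let B : Finset K := Finset.univ.biUnion fun i => A.image fun y => a i * y
  let Y : Finset (Fin n → K) := (Fintype.piFinset fun _ => A).filter fun x => ∑ i, a i * x i = 0
  have hY : {x : Fin n → K | (∀ i, x i ∈ A) ∧ ∑ i, a i * x i = 0} = Y := by
    ext x
    simp [Y, Fintype.mem_piFinset]
  have hT : T.card ≤ n := Finset.card_image_le.trans (by simp)
  have hB : B.card ≤ n * A.card := by
    have := Finset.card_biUnion_le_card_mul (Finset.univ : Finset (Fin n))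
      (fun i => A.image fun y => a i * y) A.card fun i _ => Finset.card_image_le
    simpa using this
  have hcard : Y.card ≤ C * B.card ^ (n / 2) := by
    have hinj : Function.Injective fun (x : Fin n → K) (i : Fin n) => a i * x i :=
      fun x y h => funext fun i => mul_left_cancel₀ (ha i) (congrFun h i)
    rw [← Finset.card_image_of_injective Y hinj]
    refine hC K (S ∪ T) ((Finset.card_union_le _ _).trans (by omega)) (Fin n) (by simp) B ?_ _ ?_ ?_
    · intro b hb
      obtain ⟨i, _, hb⟩ := Finset.mem_biUnion.1 hb
      obtain ⟨y, hy, rfl⟩ := Finset.mem_image.1 hb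
      obtain ⟨u, hu, rfl⟩ := hA y hy
      obtain ⟨k, hk, huk⟩ := hSΓ u hu
      have h1 : PowMem (S ∪ T) (u : K) :=
        PowMem.mono (S := S) ⟨u, rfl, k, hk, huk⟩ Finset.subset_union_left
      have h2 : PowMem (S ∪ T) (a i) := powMem_of_mem (u := Units.mk0 (a i) (ha i))
        (Finset.mem_union_right _ (Finset.mem_image_of_mem _ (Finset.mem_univ i)))
      exact h2.mul h1
    · intro z hz i
      obtain ⟨x, hx, rfl⟩ := Finset.mem_image.1 hz
      have hxA := Fintype.mem_piFinset.1 (Finset.mem_filter.1 hx).1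
      exact Finset.mem_biUnion.2 ⟨i, Finset.mem_univ i, Finset.mem_image_of_mem _ (hxA i)⟩
    · intro z hz
      obtain ⟨x, hx, rfl⟩ := Finset.mem_image.1 hz
      exact (Finset.mem_filter.1 hx).2
  rw [hY, Set.ncard_coe_finset]
  have h : Y.card ≤ C * n ^ (n / 2) * A.card ^ (n / 2) := by
    rw [mul_assoc, ← mul_pow]
    exact hcard.trans (Nat.mul_le_mul_left _ (Nat.pow_le_pow_left hB _))
  calc (Y.card : ℝ) ≤ C * n ^ (n / 2) * A.card ^ (n / 2) := by exact_mod_cast h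
    _ ≤ _ := mul_le_mul_of_nonneg_right (le_add_of_nonneg_right zero_le_one) (by positivity)
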